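/- Let S be a connected and simply connected analytic submanifold of ℝ^{n−1} and let P ∈ ℝ[x₁,…,x_{n−1};x_n] have degree d_n in x_n. Assume P never nullifies on S, and that Disc^{d_n}_{x_n}(P) is not the zero polynomial and is order-invariant on S. Then P is projectively delineable on S, and H^{d_n}(P) is order-invariant on each projective P-section over S. -/

import Mathlib

noncomputable section

open Polynomial Finset

/-- The real projective line `ℝP¹`: the quotient of `ℝ² ∖ {0}` by proportionality. -/
abbrev RP1 : Type := Projectivization ℝ (Fin 2 → ℝ)

/-- The quotient topology on the real projective line. -/
instance : TopologicalSpace RP1 :=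
  inferInstanceAs (TopologicalSpace (Quotient (projectivizationSetoid ℝ (Fin 2 → ℝ))))

/-- Homogenization of a univariate real polynomial with respect to the degree `d`,
as a binary form (an element of `ℝ[x,y]`, homogeneous of degree `d` when `P.natDegree ≤ d`):
`H^d(P)(x,y) = ∑_{k=0}^d c_k x^k y^(d-k)`. -/
def homog (d : ℕ) (P : Polynomial ℝ) : MvPolynomial (Fin 2) ℝ :=
  ∑ k ∈ Finset.range (d + 1),
    MvPolynomial.C (P.coeff k) * MvPolynomial.X 0 ^ k * MvPolynomial.X 1 ^ (d - k)

/-- The pull-back `ι_M^{*}` of a binary form `g` along the parametrized line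
`ι_M : x ↦ M (x,1)ᵀ`, i.e. the univariate polynomial `g(m₁₁ x + m₁₂, m₂₁ x + m₂₂)`.
For `M = 1` this is the standard pull-back `ι^{*d} g = g(x, 1)`. -/
def pullM (M : Matrix (Fin 2) (Fin 2) ℝ) (g : MvPolynomial (Fin 2) ℝ) : Polynomial ℝ :=
  MvPolynomial.eval₂ Polynomial.C
    ![Polynomial.C (M 0 0) * Polynomial.X + Polynomial.C (M 0 1),
      Polynomial.C (M 1 0) * Polynomial.X + Polynomial.C (M 1 1)] g

/-- Right composition `R_M g = g ∘ M` of a binary form with a linear map of `ℝ²`. -/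
def compM (M : Matrix (Fin 2) (Fin 2) ℝ) (g : MvPolynomial (Fin 2) ℝ) : MvPolynomial (Fin 2) ℝ :=
  MvPolynomial.eval₂ MvPolynomial.C
    (fun i => ∑ j, MvPolynomial.C (M i j) * MvPolynomial.X j) g

/-- The operator `A^{*d} P = ι_A^{*d} (H^d P)`, i.e.
`A^{*d}P(x) = ∑_{k=0}^d c_k (a₁₁x+a₁₂)^k (a₂₁x+a₂₂)^{d-k}` for `P = ∑ c_k x^k`. -/
def AstarU (d : ℕ) (M : Matrix (Fin 2) (Fin 2) ℝ) (P : Polynomial ℝ) : Polynomial ℝ :=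
  pullM M (homog d P)

/-- The Sylvester matrix of `P` and `Q` with respect to the fixed degrees `p` and `q`
(padding with zero coefficients as if `deg P = p` and `deg Q = q`). -/
def sylvester {R : Type*} [CommRing R] (p q : ℕ) (P Q : Polynomial R) :
    Matrix (Fin (p + q)) (Fin (p + q)) R := fun i j =>
  if (i : ℕ) < q then
    (if (i : ℕ) ≤ (j : ℕ) ∧ (j : ℕ) ≤ (i : ℕ) + p then P.coeff (p + (i : ℕ) - (j : ℕ)) else 0)
  else
    (if (i : ℕ) - q ≤ (j : ℕ) ∧ (j : ℕ) ≤ (i : ℕ) then Q.coeff (q + ((i : ℕ) - q) - (j : ℕ)) else 0)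

/-- The resultant `Res^{p,q}(P,Q)` with respect to the fixed degrees `p` and `q`:
the determinant of the corresponding Sylvester matrix. -/
def resFixed {R : Type*} [CommRing R] (p q : ℕ) (P Q : Polynomial R) : R :=
  (sylvester p q P Q).det

/-- The discriminant `Disc^p(P)` of `P` with respect to the fixed degree `p`: the resultant
(with respect to degrees `(p-1, p-1)`) of the pull-backs of the two partial derivatives
`F_x`, `F_y` of the binary form `F = H^p(P)`; these pull-backs are `P'` and `p·P − x·P'`. -/
def discFixed {R : Type*} [CommRing R] (p : ℕ) (P : Polynomial R) : R :=
  (-1) ^ (p * (p - 1) / 2) *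
    resFixed (p - 1) (p - 1) (Polynomial.derivative P)
      (Polynomial.C (p : R) * P - Polynomial.X * Polynomial.derivative P)

/-- Evaluation `E_x` of a polynomial in `x₁,…,x_m;x_n` at `x ∈ ℝ^m` in its first `m`
variables, giving a univariate real polynomial in `x_n`. -/
def evalP {m : ℕ} (P : Polynomial (MvPolynomial (Fin m) ℝ)) (x : Fin m → ℝ) : Polynomial ℝ :=
  P.map (MvPolynomial.eval x : MvPolynomial (Fin m) ℝ →+* ℝ)

/-- The operator `A^{*d}` acting on the last variable of a polynomial in `x₁,…,x_m;x_n`: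
`A^{*d}P(x,x_n) = ∑_{k=0}^d c_k(x) (a₁₁x_n+a₁₂)^k (a₂₁x_n+a₂₂)^{d-k}`. -/
def AstarPoly {m : ℕ} (d : ℕ) (M : Matrix (Fin 2) (Fin 2) ℝ)
    (P : Polynomial (MvPolynomial (Fin m) ℝ)) : Polynomial (MvPolynomial (Fin m) ℝ) :=
  ∑ k ∈ Finset.range (d + 1),
    Polynomial.C (P.coeff k) *
      (Polynomial.C (MvPolynomial.C (M 0 0)) * Polynomial.X
        + Polynomial.C (MvPolynomial.C (M 0 1))) ^ k *
      (Polynomial.C (MvPolynomial.C (M 1 0)) * Polynomial.X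
        + Polynomial.C (MvPolynomial.C (M 1 1))) ^ (d - k)

/-- The order of a (polynomial) function at a point: the smallest `k` such that some
partial derivative of total order `k` does not vanish at the point, i.e. the smallest `k`
with `iteratedFDeriv ℝ k f v ≠ 0`; it is `⊤` if all derivatives vanish. -/
def ordAt {E : Type*} [NormedAddCommGroup E] [NormedSpace ℝ E] (f : E → ℝ) (v : E) : ℕ∞ :=
  sInf {k : ℕ∞ | ∃ n : ℕ, k = n ∧ iteratedFDeriv ℝ n f v ≠ 0}

/-- A function is order-invariant on a set if it has the same order at every point of the set. -/
def OrderInvariantOn {E : Type*} [NormedAddCommGroup E] [NormedSpace ℝ E]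
    (f : E → ℝ) (S : Set E) : Prop :=
  ∀ x ∈ S, ∀ y ∈ S, ordAt f x = ordAt f y

/-- `(v 0 : v 1)` is a projective root of the binary form `g` of multiplicity (exactly) `mult`:
in the factorization of `g`, the linear form vanishing on the line through `v` occurs with
exponent `mult`. -/
def HasProjRootOfMult (g : MvPolynomial (Fin 2) ℝ) (v : Fin 2 → ℝ) (mult : ℕ) : Prop :=
  ∃ h : MvPolynomial (Fin 2) ℝ,
    g = (MvPolynomial.C (v 1) * MvPolynomial.X 0 - MvPolynomial.C (v 0) * MvPolynomial.X 1) ^ mult * h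
      ∧ MvPolynomial.eval v h ≠ 0

/-- The projective zero set `Z_{ℝP¹}(P,S)` of `P` over `S`, with respect to the degree `d`
in the last variable: the set of `(x, (x_n : y))` with `x ∈ S` and `H^d(P)(x,(x_n,y)) = 0`. -/
def ZProj {m : ℕ} (d : ℕ) (P : Polynomial (MvPolynomial (Fin m) ℝ)) (S : Set (Fin m → ℝ)) :
    Set ((Fin m → ℝ) × RP1) :=
  {p | p.1 ∈ S ∧ ∃ (v : Fin 2 → ℝ) (hv : v ≠ 0),
    Projectivization.mk ℝ v hv = p.2 ∧ MvPolynomial.eval v (homog d (evalP P p.1)) = 0}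

/-- `θ` is a (finite) system of real root functions for `P` on `S`: continuous functions with
pairwise disjoint graphs whose union is `Z_ℝ(P,S)`, each of constant positive multiplicity. -/
def IsRealRootFunctions {m : ℕ} (P : Polynomial (MvPolynomial (Fin m) ℝ)) (S : Set (Fin m → ℝ))
    {k : ℕ} (θ : Fin k → (Fin m → ℝ) → ℝ) : Prop :=
  (∀ l, ContinuousOn (θ l) S) ∧
  (∀ x ∈ S, ∀ l l' : Fin k, l ≠ l' → θ l x ≠ θ l' x) ∧
  (∀ x ∈ S, ∀ t : ℝ, (evalP P x).eval t = 0 ↔ ∃ l, θ l x = t) ∧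
  (∀ l : Fin k, ∃ mult : ℕ, 0 < mult ∧ ∀ x ∈ S, (evalP P x).rootMultiplicity (θ l x) = mult)

/-- `P` is delineable on `S`. -/
def Delineable {m : ℕ} (P : Polynomial (MvPolynomial (Fin m) ℝ)) (S : Set (Fin m → ℝ)) : Prop :=
  ∃ (k : ℕ) (θ : Fin k → (Fin m → ℝ) → ℝ), IsRealRootFunctions P S θ

/-- `θ` is a (finite) system of projective root functions for `P` on `S` with respect to the
degree `d` in the last variable: continuous functions into `ℝP¹` with pairwise disjoint graphs
whose union is `Z_{ℝP¹}(P,S)`, each of constant positive multiplicity. -/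
def IsProjRootFunctions {m : ℕ} (d : ℕ) (P : Polynomial (MvPolynomial (Fin m) ℝ))
    (S : Set (Fin m → ℝ)) {k : ℕ} (θ : Fin k → (Fin m → ℝ) → RP1) : Prop :=
  (∀ l, ContinuousOn (θ l) S) ∧
  (∀ x ∈ S, ∀ l l' : Fin k, l ≠ l' → θ l x ≠ θ l' x) ∧
  (∀ x ∈ S, ∀ (v : Fin 2 → ℝ) (hv : v ≠ 0),
    (MvPolynomial.eval v (homog d (evalP P x)) = 0 ↔ ∃ l, θ l x = Projectivization.mk ℝ v hv)) ∧
  (∀ l : Fin k, ∃ mult : ℕ, 0 < mult ∧ ∀ x ∈ S, ∀ (v : Fin 2 → ℝ) (hv : v ≠ 0),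
    θ l x = Projectivization.mk ℝ v hv → HasProjRootOfMult (homog d (evalP P x)) v mult)

/-- `P` is projectively delineable on `S` (with respect to the degree `d` in the last variable). -/
def ProjDelineable {m : ℕ} (d : ℕ) (P : Polynomial (MvPolynomial (Fin m) ℝ))
    (S : Set (Fin m → ℝ)) : Prop :=
  ∃ (k : ℕ) (θ : Fin k → (Fin m → ℝ) → RP1), IsProjRootFunctions d P S θ

/-- `S` is an analytic submanifold of `ℝ^m`: around each of its points, in suitable
real-analytic coordinates, `S` is an open piece of a linear subspace. -/
def IsAnalyticSubmanifold {m : ℕ} (S : Set (Fin m → ℝ)) : Prop :=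
  ∀ s ∈ S, ∃ (U V : Set (Fin m → ℝ)) (φ ψ : (Fin m → ℝ) → (Fin m → ℝ))
      (L : Submodule ℝ (Fin m → ℝ)),
    IsOpen U ∧ IsOpen V ∧ s ∈ U ∧
    AnalyticOnNhd ℝ φ U ∧ AnalyticOnNhd ℝ ψ V ∧
    Set.MapsTo φ U V ∧ Set.MapsTo ψ V U ∧
    Set.EqOn (ψ ∘ φ) id U ∧ Set.EqOn (φ ∘ ψ) id V ∧
    φ '' (U ∩ S) = V ∩ (L : Set (Fin m → ℝ))

end

section
open Polynomial Finset

theorem gpd_polar {E : Type*} [NormedAddCommGroup E] [NormedSpace ℝ E] : ∀ (n : ℕ)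
    (T : ContinuousMultilinearMap ℝ (fun _ : Fin n => E) ℝ)
    (_ : ∀ (σ : Equiv.Perm (Fin n)) v, T (v ∘ σ) = T v)
    (_ : ∀ w : E, T (fun _ => w) = 0), T = 0 := by
  intro n
  induction n with
  | zero =>
    intro T _ h0
    ext v
    have := h0 0
    rw [Subsingleton.elim v (fun _ => 0), this]; rfl
  | succ n ih =>
    intro T hs h0
    have key : ∀ y w : E, T (Fin.cons y (fun _ => w)) = 0 := by
      intro y w
      have h1 : HasDerivAt (fun τ : ℝ => T (fun _ => w + τ • y)) 
          (T.linearDeriv (fun _ => w) (fun _ => y)) 0 := by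
        have ha : HasFDerivAt T (T.linearDeriv (fun _ => w)) ((fun τ : ℝ => (fun _ : Fin (n+1) => w + τ • y)) 0) := by
          simpa using T.hasFDerivAt (fun _ => w)
        have hb : HasDerivAt (fun τ : ℝ => (fun _ : Fin (n+1) => w + τ • y)) (fun _ => y) 0 := by
          rw [hasDerivAt_pi]
          intro i
          simpa using ((hasDerivAt_id (0:ℝ)).smul_const y).const_add w
        exact ha.comp_hasDerivAt (0:ℝ) hb
      have h2 : T.linearDeriv (fun _ => w) (fun _ => y) = 0 := by
        have : (fun τ : ℝ => T (fun _ => w + τ • y)) = fun _ => 0 := by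
          funext τ; exact h0 _
        rw [this] at h1
        exact h1.unique (hasDerivAt_const _ _)
      have h3 : ∀ i : Fin (n+1), T (Function.update (fun _ => w) i y) = T (Fin.cons y (fun _ => w)) := by
        intro i
        rw [← hs (Equiv.swap 0 i) (Fin.cons y (fun _ => w))]
        congr 1
        funext j
        simp only [Function.comp]
        by_cases hj : j = i
        · subst hj; simp
        · rw [Function.update_of_ne hj]
          by_cases hj0 : j = 0
          · subst hj0
            rw [Equiv.swap_apply_left]
            obtain ⟨k, rfl⟩ := Fin.exists_succ_eq.mpr (Ne.symm hj)
            simp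
          · rw [Equiv.swap_apply_of_ne_of_ne hj0 hj]
            obtain ⟨k, rfl⟩ := Fin.exists_succ_eq.mpr hj0
            simp
      rw [ContinuousMultilinearMap.linearDeriv_apply] at h2
      simp only [h3] at h2
      simp at h2
      rcases h2 with h2 | h2
      · exfalso; have : (0:ℝ) < (n:ℝ)+1 := by positivity
        linarith
      · exact h2
    have h4 : ∀ y, T.curryLeft y = 0 := by
      intro y
      apply ih
      · intro σ v
        simp only [ContinuousMultilinearMap.curryLeft_apply]
        rw [← hs (Equiv.Perm.decomposeFin.symm (0, σ)) (Fin.cons y v)]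
        congr 1
        funext j
        refine Fin.cases ?_ (fun k => ?_) j
        · simp
        · simp
      · intro w
        exact key y w
    ext v
    have := congrArg (fun S => S (Fin.tail v)) (h4 (v 0))
    simpa using this

theorem gpd_diag {E : Type*} [NormedAddCommGroup E] [NormedSpace ℝ E] (f : E → ℝ)
    (hf : ContDiff ℝ ⊤ f) (p w : E) (q : ℝ[X]) (hq : ∀ τ : ℝ, q.eval τ = f (p + τ • w)) (n : ℕ) :
    iteratedFDeriv ℝ n f p (fun _ => w) = (n.factorial : ℝ) * q.coeff n := by
  have h1 : iteratedDeriv n (fun τ : ℝ => q.eval τ) 0 = (n.factorial : ℝ) * q.coeff n := by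
    have hi : ∀ n : ℕ, iteratedDeriv n (fun τ : ℝ => q.eval τ) = fun τ => (derivative^[n] q).eval τ := by
      intro n
      induction n with
      | zero => simp
      | succ n ih =>
        rw [iteratedDeriv_succ, ih]
        funext τ
        rw [Polynomial.deriv, Function.iterate_succ_apply']
    rw [hi]
    have := Polynomial.coeff_iterate_derivative (p := q) (k := n) 0
    beta_reduce
    rw [← Polynomial.coeff_zero_eq_eval_zero, this]
    simp [Nat.descFactorial_self]
  have h2 : (fun τ : ℝ => q.eval τ) = (fun z => f (p + z)) ∘ (ContinuousLinearMap.toSpanSingleton ℝ w) := by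
    funext τ; simp [hq]
  rw [← h1, h2, iteratedDeriv_eq_iteratedFDeriv,
    ContinuousLinearMap.iteratedFDeriv_comp_right (n := ⊤) _ (by fun_prop) _ (by exact_mod_cast le_top),
    iteratedFDeriv_comp_add_left]
  simp [ContinuousMultilinearMap.compContinuousLinearMap_apply]

theorem gpd_ord_le {E : Type*} [NormedAddCommGroup E] [NormedSpace ℝ E] (f : E → ℝ)
    (hf : ContDiff ℝ ⊤ f) (p : E) (L : E → ℝ[X]) (hL : ∀ w (τ : ℝ), (L w).eval τ = f (p + τ • w)) (n : ℕ) :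
    ordAt f p ≤ n ↔ ∃ j ≤ n, ∃ w, (L w).coeff j ≠ 0 := by
  have h1 : ordAt f p ≤ n ↔ ∃ j ≤ n, iteratedFDeriv ℝ j f p ≠ 0 := by
    unfold ordAt
    constructor
    · intro h
      have hne : {k : ℕ∞ | ∃ n : ℕ, k = n ∧ iteratedFDeriv ℝ n f p ≠ 0}.Nonempty := by
        by_contra hc
        rw [Set.not_nonempty_iff_eq_empty] at hc
        rw [hc, sInf_empty] at h
        simp at h
      obtain ⟨j, hj, hj'⟩ := csInf_mem hne
      rw [hj] at h
      exact ⟨j, by exact_mod_cast h, hj'⟩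
    · rintro ⟨j, hj, h⟩
      refine le_trans (sInf_le ⟨j, rfl, h⟩) (by exact_mod_cast hj)
  rw [h1]
  refine exists_congr fun j => and_congr_right fun _ => ?_
  constructor
  · intro h
    by_contra hc
    push Not at hc
    apply h
    apply gpd_polar
    · intro σ v
      refine ContDiffAt.iteratedFDeriv_comp_perm (hf.contDiffAt) v σ
    · intro w
      rw [gpd_diag f hf p w (L w) (hL w), hc]; simp
  · rintro ⟨w, hw⟩ h
    have := gpd_diag f hf p w (L w) (hL w) j
    rw [h] at this
    simp at this
    rcases this with h | h
    · exact Nat.factorial_ne_zero _ h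
    · exact hw h

theorem gpd_cover {X Y : Type*} [TopologicalSpace X] [TopologicalSpace Y] [T2Space Y]
    (R : X → Y → Prop)
    (h : ∀ x0, ∃ U : Set X, IsOpen U ∧ x0 ∈ U ∧ ∃ (k : ℕ) (θ : Fin k → X → Y),
      (∀ l, ContinuousOn (θ l) U) ∧ (∀ x ∈ U, Function.Injective (fun l => θ l x)) ∧
      (∀ x ∈ U, ∀ y, R x y ↔ ∃ l, θ l x = y)) :
    IsCoveringMap (fun e : {p : X × Y // R p.1 p.2} => e.1.1) := by
  intro x0
  obtain ⟨U, hU, hx0, k, θ, hc, hinj, hR⟩ := h x0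
  set f := (fun e : {p : X × Y // R p.1 p.2} => e.1.1) with hf
  have hfc : Continuous f := by fun_prop
  have hex : ∀ e : f ⁻¹' U, ∃ l, θ l e.1.1.1 = e.1.1.2 := fun e => (hR _ e.2 _).1 e.1.2
  choose ind hind using hex
  have hcl : ∀ l, IsClosed {e : f ⁻¹' U | θ l e.1.1.1 = e.1.1.2} := by
    intro l
    refine isClosed_eq ?_ (by fun_prop)
    exact (hc l).comp_continuous (by fun_prop) (fun e => e.2)
  have hindc : Continuous ind := by
    rw [continuous_discrete_rng]
    intro l
    have : ind ⁻¹' {l} = (⋃ l' ∈ {l' | l' ≠ l}, {e : f ⁻¹' U | θ l' e.1.1.1 = e.1.1.2})ᶜ := by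
      ext e
      simp only [Set.mem_preimage, Set.mem_singleton_iff, Set.mem_compl_iff, Set.mem_iUnion]
      constructor
      · rintro rfl ⟨l', hl', he⟩
        exact hl' (hinj _ e.2 (he.trans (hind e).symm))
      · intro hne
        by_contra hl
        exact hne ⟨ind e, hl, hind e⟩
    rw [this, isOpen_compl_iff]
    exact Set.Finite.isClosed_biUnion (Set.toFinite _) (fun l' _ => hcl l')
  refine IsEvenlyCovered.to_isEvenlyCovered_preimage (I := Fin k) ⟨inferInstance, U, hx0, hU, hU.preimage hfc, ?_⟩
  refine ⟨{ toFun := fun e => (⟨e.1.1.1, e.2⟩, ind e)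
            invFun := fun q => ⟨⟨(q.1.1, θ q.2 q.1.1), (hR _ q.1.2 _).2 ⟨q.2, rfl⟩⟩, q.1.2⟩
            left_inv := ?_
            right_inv := ?_
            continuous_toFun := ?_
            continuous_invFun := ?_ }, fun e => rfl⟩
  · intro e
    apply Subtype.ext
    apply Subtype.ext
    exact Prod.ext rfl (hind e)
  · intro q
    refine Prod.ext rfl ?_
    exact hinj _ q.1.2 (hind _)
  · fun_prop
  · apply Continuous.subtype_mk
    apply Continuous.subtype_mk
    refine Continuous.prodMk (by fun_prop) ?_
    rw [continuous_iff_continuousAt]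
    rintro ⟨x, l⟩
    have h1 : ContinuousAt (fun q : U × Fin k => θ l q.1.1) (x, l) := by
      have : Continuous (fun q : U × Fin k => θ l q.1.1) :=
        (hc l).comp_continuous (by fun_prop) (fun q => q.1.2)
      exact this.continuousAt
    refine h1.congr ?_
    have : {q : U × Fin k | q.2 = l} ∈ nhds (x, l) := by
      have ho : IsOpen ((Prod.snd : U × Fin k → Fin k) ⁻¹' {l}) :=
        (isOpen_discrete {l}).preimage continuous_snd
      exact ho.mem_nhds (by simp)
    filter_upwards [this] with q hq
    have hq' : q.2 = l := hq
    rw [hq']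

theorem gpd_glue {X Y : Type*} [TopologicalSpace X] [TopologicalSpace Y] [T2Space Y]
    [SimplyConnectedSpace X] [LocallyPathConnectedSpace X]
    (R : X → Y → Prop)
    (h : ∀ x0, ∃ U : Set X, IsOpen U ∧ x0 ∈ U ∧ ∃ (k : ℕ) (θ : Fin k → X → Y),
      (∀ l, ContinuousOn (θ l) U) ∧ (∀ x ∈ U, Function.Injective (fun l => θ l x)) ∧
      (∀ x ∈ U, ∀ y, R x y ↔ ∃ l, θ l x = y)) (x0 : X) :
    ∃ (k : ℕ) (θ : Fin k → X → Y), 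
      (∀ l, Continuous (θ l)) ∧ (∀ x, Function.Injective (fun l => θ l x)) ∧
      (∀ x, ∀ y, R x y ↔ ∃ l, θ l x = y) := by
  have cov := gpd_cover R h
  obtain ⟨U, hU, hx0, k, θ, hc, hinj, hR⟩ := h x0
  have hlift : ∀ e : {p : X × Y // R p.1 p.2}, ∃ F : C(X, {p : X × Y // R p.1 p.2}),
      F e.1.1 = e ∧ ∀ x, (F x).1.1 = x := by
    intro e
    obtain ⟨F, ⟨h1, h2⟩, _⟩ := cov.existsUnique_continuousMap_lifts (ContinuousMap.id X) e.1.1 e rfl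
    exact ⟨F, h1, fun x => congrFun h2 x⟩
  have huniq : ∀ F G : C(X, {p : X × Y // R p.1 p.2}), (∀ x, (F x).1.1 = x) → (∀ x, (G x).1.1 = x) →
      ∀ x, F x = G x → F = G := by
    intro F G hF hG x hx
    have := cov.eq_of_comp_eq F.continuous G.continuous (by funext x; simp [hF, hG]) x hx
    exact DFunLike.coe_injective this
  choose F hF1 hF2 using hlift
  let e0 : Fin k → {p : X × Y // R p.1 p.2} := fun l => ⟨(x0, θ l x0), (hR x0 hx0 _).2 ⟨l, rfl⟩⟩
  refine ⟨k, fun l x => (F (e0 l) x).1.2, fun l => by fun_prop, ?_, ?_⟩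
  · intro x l l' hll
    have h1 : F (e0 l) = F (e0 l') := by
      apply huniq _ _ (hF2 _) (hF2 _) x
      apply Subtype.ext
      exact Prod.ext ((hF2 _ _).trans (hF2 _ _).symm) hll
    have h2 : e0 l = e0 l' := by
      have a := hF1 (e0 l); have b := hF1 (e0 l')
      rw [← a, h1]; exact b
    have h3 : θ l x0 = θ l' x0 := congrArg (fun e => e.1.2) h2
    exact hinj x0 hx0 h3
  · intro x y
    constructor
    · intro hxy
      let e : {p : X × Y // R p.1 p.2} := ⟨(x, y), hxy⟩
      have h1 := (F e x0).2
      rw [hF2 e x0] at h1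
      obtain ⟨l, hl⟩ := (hR x0 hx0 _).1 h1
      refine ⟨l, ?_⟩
      have : F (e0 l) = F e := by
        apply huniq _ _ (hF2 _) (hF2 _) x0
        rw [show F (e0 l) x0 = e0 l from hF1 (e0 l)]
        apply Subtype.ext
        exact Prod.ext (hF2 e x0).symm hl
      show (F (e0 l) x).1.2 = y
      rw [this, show F e x = e from hF1 e]
    · rintro ⟨l, rfl⟩
      have := (F (e0 l) x).2
      rwa [hF2] at this

/-- a continuous selection from finitely many continuous functions which are
pairwise everywhere-equal or nowhere-equal coincides with one of them. -/
theorem gpd_select {X Y ι : Type*} [TopologicalSpace X] [TopologicalSpace Y] [T2Space Y]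
    [PreconnectedSpace X] [Finite ι] (θ : ι → X → Y) (hθ : ∀ l, Continuous (θ l))
    (hd : ∀ l l', (∃ x, θ l x = θ l' x) → ∀ x, θ l x = θ l' x)
    (g : X → Y) (hg : Continuous g) (hs : ∀ x, ∃ l, g x = θ l x) (x0 : X) (l : ι) (hl : g x0 = θ l x0) :
    ∀ x, g x = θ l x := by
  have hcl : ∀ l, IsClosed {x | g x = θ l x} := fun l => isClosed_eq hg (hθ l)
  have ho : IsOpen {x | g x = θ l x} := by
    have : {x | g x = θ l x} = (⋃ l' ∈ {l' | ∀ x, θ l x ≠ θ l' x}, {x | g x = θ l' x})ᶜ := by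
      ext x
      simp only [Set.mem_compl_iff, Set.mem_iUnion]
      constructor
      · rintro h1 ⟨l', hl', h2⟩
        exact hl' x (h1.symm.trans h2)
      · intro hne
        obtain ⟨l', hl'⟩ := hs x
        by_cases hx : ∃ x, θ l x = θ l' x
        · exact hl'.trans (hd l l' hx x).symm
        · push Not at hx
          exact (hne ⟨l', hx, hl'⟩).elim
    rw [this, isOpen_compl_iff]
    exact Set.Finite.isClosed_biUnion (Set.toFinite _) (fun l' _ => hcl l')
  have := IsClopen.eq_univ ⟨hcl l, ho⟩ ⟨x0, hl⟩
  intro x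
  have : x ∈ {x | g x = θ l x} := by rw [this]; trivial
  exact this

theorem gpd_factor (g : ℂ → ℂ) (R : ℝ) (hR : 0 < R) (hg : DifferentiableOn ℂ g (Metric.ball 0 R))
    (h0 : ∀ u ∈ Metric.ball (0:ℂ) R, u ≠ 0 → g u ≠ 0) :
    ∃ (e : ℕ) (H : ℂ → ℂ), analyticOrderAt g 0 = e ∧ DifferentiableOn ℂ H (Metric.ball 0 R) ∧
      (∀ u ∈ Metric.ball (0:ℂ) R, H u ≠ 0) ∧ ∀ u ∈ Metric.ball (0:ℂ) R, u ≠ 0 → g u = u ^ e * H u := by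
  have hb : Metric.ball (0:ℂ) R ∈ nhds (0:ℂ) := Metric.ball_mem_nhds _ hR
  have hga : AnalyticAt ℂ g 0 := hg.analyticAt hb
  have htop : analyticOrderAt g 0 ≠ ⊤ := by
    intro h
    rw [analyticOrderAt_eq_top] at h
    have h1 : ∀ᶠ z in nhdsWithin (0:ℂ) {0}ᶜ, g z = 0 := h.filter_mono nhdsWithin_le_nhds
    have h2 : ∀ᶠ z in nhdsWithin (0:ℂ) {0}ᶜ, z ∈ Metric.ball (0:ℂ) R := 
      (Filter.eventually_mem_set.2 hb).filter_mono nhdsWithin_le_nhds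
    have h3 : ∀ᶠ z in nhdsWithin (0:ℂ) {0}ᶜ, z ∈ ({0}ᶜ : Set ℂ) := eventually_mem_nhdsWithin
    obtain ⟨z, hz1, hz2, hz3⟩ := (h1.and (h2.and h3)).exists
    exact h0 z hz2 hz3 hz1
  obtain ⟨e, he⟩ := ENat.ne_top_iff_exists.1 htop
  obtain ⟨h, hha, hh0, hhe⟩ := (hga.analyticOrderAt_eq_natCast (n := e)).1 he.symm
  classical
  refine ⟨e, fun u => if u = 0 then h 0 else g u / u ^ e, he.symm, ?_, ?_, ?_⟩
  · intro u hu
    apply DifferentiableAt.differentiableWithinAt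
    by_cases hu0 : u = 0
    · subst hu0
      refine hha.differentiableAt.congr_of_eventuallyEq ?_
      filter_upwards [hhe] with z hz
      split_ifs with hz0
      · rw [hz0]
      · rw [hz]; simp; field_simp
    · have h1 : DifferentiableAt ℂ (fun u => g u / u ^ e) u := 
        (hg.differentiableAt (Metric.isOpen_ball.mem_nhds hu)).div (by fun_prop) (pow_ne_zero _ hu0)
      refine h1.congr_of_eventuallyEq ?_
      filter_upwards [isOpen_ne.mem_nhds hu0] with z hz
      rw [if_neg hz]
  · intro u hu
    dsimp only
    split_ifs with hz
    · exact hh0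
    · exact div_ne_zero (h0 u hu hz) (pow_ne_zero _ hz)
  · intro u hu hu0
    dsimp only
    rw [if_neg hu0]; field_simp

theorem gpd_rouche (g₁ g₂ : ℂ → ℂ) (R r : ℝ) (hr : 0 < r) (hrR : r < R)
    (hg₁ : DifferentiableOn ℂ g₁ (Metric.ball 0 R)) (hg₂ : DifferentiableOn ℂ g₂ (Metric.ball 0 R))
    (h₁ : ∀ u ∈ Metric.ball (0:ℂ) R, u ≠ 0 → g₁ u ≠ 0)
    (h₂ : ∀ u ∈ Metric.ball (0:ℂ) R, u ≠ 0 → g₂ u ≠ 0)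
    (hcl : ∀ u ∈ Metric.sphere (0:ℂ) r, ‖g₁ u - g₂ u‖ < ‖g₂ u‖) :
    analyticOrderAt g₁ 0 = analyticOrderAt g₂ 0 := by
  have hsub : ∀ u ∈ Metric.sphere (0:ℂ) r, u ∈ Metric.ball (0:ℂ) R ∧ u ≠ 0 := by
    intro u hu
    have : ‖u‖ = r := by simpa using hu
    refine ⟨by simp [this, hrR], ?_⟩
    rintro rfl; simp at this; linarith
  have key : ∀ g : ℂ → ℂ, DifferentiableOn ℂ g (Metric.ball 0 R) → 
      (∀ u ∈ Metric.ball (0:ℂ) R, u ≠ 0 → g u ≠ 0) → ∃ e : ℕ, analyticOrderAt g 0 = e ∧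
      CircleIntegrable (logDeriv g) 0 r ∧ (∮ z in C(0, r), logDeriv g z) = e * (2 * Real.pi * Complex.I) := by
    intro g hg h
    obtain ⟨e, H, he, hH, hH0, hgH⟩ := gpd_factor g R (hr.trans hrR) hg h
    have hLd : DifferentiableOn ℂ (logDeriv H) (Metric.ball 0 R) := 
      (hH.deriv Metric.isOpen_ball).div hH hH0
    have hint1 : CircleIntegrable (logDeriv H) 0 r := by
      apply ContinuousOn.circleIntegrable hr.le
      exact hLd.continuousOn.mono (fun u hu => (hsub u hu).1)
    have hint2 : CircleIntegrable (fun z : ℂ => (e:ℂ) * (z - 0)⁻¹) 0 r := by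
      apply ContinuousOn.circleIntegrable hr.le
      apply ContinuousOn.mul continuousOn_const
      apply ContinuousOn.inv₀ (by fun_prop)
      intro x hx; simpa using (hsub x hx).2
    have heq : Set.EqOn (logDeriv g) (fun z => (e:ℂ) * (z - 0)⁻¹ + logDeriv H z) (Metric.sphere 0 r) := by
      intro u hu
      obtain ⟨hu1, hu0⟩ := hsub u hu
      have hev : g =ᶠ[nhds u] fun z => z ^ e * H z := by
        filter_upwards [Metric.isOpen_ball.mem_nhds hu1, isOpen_ne.mem_nhds hu0] with z hz hz0
        exact hgH z hz hz0
      have : logDeriv g u = logDeriv (fun z => z ^ e * H z) u := by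
        simp only [logDeriv_apply, hev.deriv_eq, hev.eq_of_nhds]
      rw [this, logDeriv_mul (f := fun z => z ^ e) u (pow_ne_zero _ hu0) (hH0 u hu1) (by fun_prop)
        (hH.differentiableAt (Metric.isOpen_ball.mem_nhds hu1))]
      congr 1
      rw [logDeriv_fun_pow (by fun_prop)]
      simp [logDeriv_apply, div_eq_mul_inv]
    refine ⟨e, he, ?_, ?_⟩
    · refine (circleIntegrable_congr ?_).2 (hint2.add hint1)
      rw [abs_of_pos hr]
      exact heq
    · rw [circleIntegral.integral_congr hr.le heq, circleIntegral.integral_add hint2 hint1,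
        circleIntegral.integral_const_mul, circleIntegral.integral_sub_center_inv 0 hr.ne',
        Complex.circleIntegral_eq_zero_of_differentiable_on_off_countable hr.le Set.countable_empty
          (hLd.continuousOn.mono (Metric.closedBall_subset_ball hrR)) ?_, add_zero]
      intro z hz
      exact hLd.differentiableAt (Metric.isOpen_ball.mem_nhds (Metric.ball_subset_ball hrR.le hz.1))
  obtain ⟨e₁, he₁, hi₁, hint₁⟩ := key g₁ hg₁ h₁
  obtain ⟨e₂, he₂, hi₂, hint₂⟩ := key g₂ hg₂ h₂
  have hz : (∮ z in C(0, r), (logDeriv g₁ z - logDeriv g₂ z)) = 0 := by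
    apply circleIntegral.integral_eq_zero_of_hasDerivWithinAt hr.le (f := fun z => Complex.log (g₁ z / g₂ z))
    intro z hz
    apply HasDerivAt.hasDerivWithinAt
    obtain ⟨hz1, hz0⟩ := hsub z hz
    have d1 := (hg₁.differentiableAt (Metric.isOpen_ball.mem_nhds hz1)).hasDerivAt
    have d2 := (hg₂.differentiableAt (Metric.isOpen_ball.mem_nhds hz1)).hasDerivAt
    have n1 := h₁ z hz1 hz0
    have n2 := h₂ z hz1 hz0
    have hs : g₁ z / g₂ z ∈ Complex.slitPlane := by
      have hb : g₁ z / g₂ z ∈ Metric.ball (1:ℂ) 1 := by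
        rw [mem_ball_iff_norm]
        have : g₁ z / g₂ z - 1 = (g₁ z - g₂ z) / g₂ z := by field_simp
        rw [this, norm_div, div_lt_one (by simpa using n2)]
        exact hcl z hz
      exact Complex.ball_one_subset_slitPlane hb
    have := (d1.div d2 n2).clog hs
    convert! this using 1
    simp only [logDeriv_apply, Pi.div_apply]
    field_simp
  rw [circleIntegral.integral_sub hi₁ hi₂, hint₁, hint₂, ← sub_mul] at hz
  have : (e₁ : ℂ) - e₂ = 0 := by
    rcases mul_eq_zero.1 hz with h | h
    · exact h
    · exact (Complex.two_pi_I_ne_zero h).elim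
  rw [he₁, he₂]
  have h3 : (e₁:ℂ) = e₂ := sub_eq_zero.1 this
  have h4 : e₁ = e₂ := by exact_mod_cast h3
  rw [h4]

theorem gpd_twist (g : ℂ → ℂ) (hg : AnalyticAt ℂ g 0) (hg0 : g 0 = 0) (N : ℕ) (ω : ℂ)
    (hω : IsPrimitiveRoot ω N) (hN : N ≠ 0) :
    min (N : ℕ∞) (analyticOrderAt g 0) = min (N : ℕ∞) (analyticOrderAt (fun u => g u - g (ω * u)) 0) := by
  have hω0 : ω ≠ 0 := hω.ne_zero hN
  have hgo : AnalyticAt ℂ (fun u => g (ω * u)) 0 := by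
    have : AnalyticAt ℂ (fun u : ℂ => ω * u) 0 := by fun_prop
    exact AnalyticAt.fun_comp (g := g) (by simpa using hg) this
  have hord : analyticOrderAt (fun u => g (ω * u)) 0 = analyticOrderAt g 0 := by
    have := analyticOrderAt_comp_of_deriv_ne_zero (f := g) (g := fun u : ℂ => ω * u) (z₀ := 0) (by fun_prop)
      (by rw [deriv_const_mul _ (by fun_prop)]; simpa using hω0)
    simpa [Function.comp_def] using this
  by_cases h : (N : ℕ∞) ≤ analyticOrderAt g 0
  · have h2 : (N : ℕ∞) ≤ analyticOrderAt (fun u => g u - g (ω * u)) 0 := by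
      have := le_analyticOrderAt_sub (f := g) (g := fun u => g (ω * u)) (z₀ := 0)
      rw [hord, min_self] at this
      exact h.trans this
    rw [min_eq_left h, min_eq_left h2]
  · push Not at h
    obtain ⟨p, hp⟩ := ENat.ne_top_iff_exists.1 (ne_top_of_lt h)
    rw [← hp] at h
    have hpN : p < N := by exact_mod_cast h
    have hp0 : p ≠ 0 := by
      rintro rfl
      have := (hg.analyticOrderAt_eq_zero).1 (by rw [← hp]; rfl)
      exact this hg0
    obtain ⟨k, hk, hk0, hgk⟩ := (hg.analyticOrderAt_eq_natCast (n := p)).1 hp.symm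
    have hkω : AnalyticAt ℂ (fun u => k (ω * u)) 0 := by
      have : AnalyticAt ℂ (fun u : ℂ => ω * u) 0 := by fun_prop
      exact AnalyticAt.fun_comp (g := k) (by simpa using hk) this
    have : analyticOrderAt (fun u => g u - g (ω * u)) 0 = p := by
      refine (AnalyticAt.analyticOrderAt_eq_natCast (hg.sub hgo)).2 ⟨fun u => k u - ω ^ p * k (ω * u), ?_, ?_, ?_⟩
      · exact hk.sub (analyticAt_const.mul hkω)
      · simp only [mul_zero]
        have : k 0 - ω ^ p * k 0 = k 0 * (1 - ω ^ p) := by ring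
        rw [this]
        refine mul_ne_zero hk0 (sub_ne_zero.2 (Ne.symm ?_))
        exact hω.pow_ne_one_of_pos_of_lt hp0 hpN
      · have ht : Filter.Tendsto (fun u : ℂ => ω * u) (nhds 0) (nhds 0) := by
          have : ContinuousAt (fun u : ℂ => ω * u) 0 := by fun_prop
          simpa [ContinuousAt] using this
        filter_upwards [hgk, ht.eventually hgk] with z hz1 hz2
        simp only [Pi.sub_apply, hz1, hz2, sub_zero, smul_eq_mul]
        ring
    rw [this, ← hp]

theorem gpd_fac_ge (Y : ℂ → ℂ) (hY : AnalyticAt ℂ Y 0) (N : ℕ) (α β : ℂ) :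
    min (N : ℕ∞) (analyticOrderAt (fun u => Y u - Y 0) 0) ≤ 
      analyticOrderAt (fun u => (Y 0 + u ^ N * α) - (1 + u ^ N * β) * Y u) 0 := by
  have e : (fun u => (Y 0 + u ^ N * α) - (1 + u ^ N * β) * Y u) = 
     (fun u : ℂ => u ^ N * (α - β * Y u)) - (fun u => Y u - Y 0) := by
    funext u; simp only [Pi.sub_apply]; ring
  rw [e]
  refine le_trans (min_le_min ?_ le_rfl) le_analyticOrderAt_sub
  rw [natCast_le_analyticOrderAt (by fun_prop)]
  refine ⟨fun u => α - β * Y u, by fun_prop, ?_⟩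
  filter_upwards with z
  simp

theorem gpd_fac_eq (Y : ℂ → ℂ) (hY : AnalyticAt ℂ Y 0) (N : ℕ) :
    ∃ α₀ : ℂ, ∀ α : ℂ, α ≠ 0 → α ≠ α₀ →
    min (N : ℕ∞) (analyticOrderAt (fun u => Y u - Y 0) 0) = 
      analyticOrderAt (fun u => (Y 0 + u ^ N * α) - Y u) 0 := by
  have hm : ∀ α : ℂ, α ≠ 0 → analyticOrderAt (fun u : ℂ => u ^ N * α) 0 = N := by
    intro α hα
    refine (AnalyticAt.analyticOrderAt_eq_natCast (by fun_prop)).2 ⟨fun _ => α, by fun_prop, hα, ?_⟩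
    filter_upwards with z; simp
  have e : ∀ α : ℂ, (fun u => (Y 0 + u ^ N * α) - Y u) = 
     (fun u : ℂ => u ^ N * α) + (-(fun u => Y u - Y 0)) := by
    intro α; funext u; simp only [Pi.add_apply, Pi.neg_apply]; ring
  by_cases h : (N : ℕ∞) = analyticOrderAt (fun u => Y u - Y 0) 0
  · obtain ⟨k, hk, hk0, hgk⟩ := (AnalyticAt.analyticOrderAt_eq_natCast (by fun_prop)).1 h.symm
    refine ⟨k 0, fun α hα hα' => ?_⟩
    rw [← h, min_self]
    symm
    refine (AnalyticAt.analyticOrderAt_eq_natCast (by fun_prop)).2 ⟨fun u => α - k u, by fun_prop, sub_ne_zero.2 hα', ?_⟩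
    filter_upwards [hgk] with z hz
    simp only [sub_zero, smul_eq_mul] at hz ⊢
    linear_combination -hz
  · refine ⟨0, fun α hα _ => ?_⟩
    rw [e, analyticOrderAt_add_of_ne, hm α hα]
    · congr 1
      exact (analyticOrderAt_neg).symm
    · rw [hm α hα, analyticOrderAt_neg]; exact h

theorem gpd_prod_roots (q : ℂ[X]) (z : ℂ) : q.eval z = q.leadingCoeff * (q.roots.map (fun r => z - r)).prod := by
  exact (IsAlgClosed.splits q).eval_eq_prod_roots z

theorem gpd_near {X : Type*} [TopologicalSpace X] (q : X → ℂ[X]) (d : ℕ)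
    (hc : ∀ k, Continuous fun x => (q x).coeff k) (hd : ∀ x, (q x).natDegree = d)
    (hne : ∀ x, q x ≠ 0) (x0 : X) (r : ℂ) (hr : (q x0).IsRoot r) (ε : ℝ) (hε : 0 < ε) :
    ∀ᶠ x in nhds x0, ∃ z, (q x).IsRoot z ∧ ‖z - r‖ < ε := by
  have hlead : ∀ x, (q x).leadingCoeff = (q x).coeff d := fun x => by rw [leadingCoeff, hd]
  have hev : Continuous fun x => (q x).eval r := by
    have : (fun x => (q x).eval r) = fun x => ∑ k ∈ Finset.range (d+1), (q x).coeff k * r ^ k := by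
      funext x; rw [eval_eq_sum_range, hd]
    rw [this]
    fun_prop
  have h1 : ∀ᶠ x in nhds x0, ‖(q x).eval r‖ < ‖(q x).coeff d‖ * ε ^ d := by
    refine (hev.norm.continuousAt).eventually_lt (((hc d).norm.mul continuous_const).continuousAt) ?_
    rw [hr, norm_zero, ← hlead]
    have := leadingCoeff_ne_zero.2 (hne x0)
    positivity
  filter_upwards [h1] with x hx
  by_contra hcon
  push Not at hcon
  rw [gpd_prod_roots, norm_mul, hlead] at hx
  refine absurd hx (not_lt.2 ?_)
  gcongr
  have hcard : (q x).roots.card = d := by rw [← hd x]; exact (IsAlgClosed.splits (q x)).natDegree_eq_card_roots.symm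
  have : ∀ s : Multiset ℂ, (∀ z ∈ s, ε ≤ ‖z - r‖) → ε ^ s.card ≤ ‖(s.map (fun z => r - z)).prod‖ := by
    intro s
    induction s using Multiset.induction with
    | empty => simp
    | cons a s ih =>
      intro hs
      simp only [Multiset.card_cons, Multiset.map_cons, Multiset.prod_cons, norm_mul, pow_succ']
      have h1 := hs a (Multiset.mem_cons_self a s)
      have h2 := ih (fun z hz => hs z (Multiset.mem_cons_of_mem hz))
      rw [norm_sub_rev] at h1
      gcongr
  have := this (q x).roots (fun z hz => hcon z (isRoot_of_mem_roots hz))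
  rwa [hcard] at this

theorem gpd_sections {X : Type*} [TopologicalSpace X] (q : X → ℂ[X]) (d l : ℕ)
    (hc : ∀ k, Continuous fun x => (q x).coeff k) (hd : ∀ x, (q x).natDegree = d)
    (hne : ∀ x, q x ≠ 0) (hl : ∀ x, (q x).roots.toFinset.card = l) (x0 : X) :
    ∃ U : Set X, IsOpen U ∧ x0 ∈ U ∧ ∃ θ : Fin l → X → ℂ, (∀ i, ContinuousOn (θ i) U) ∧
      (∀ x ∈ U, Function.Injective fun i => θ i x) ∧ 
      (∀ x ∈ U, ∀ y, (q x).IsRoot y ↔ ∃ i, θ i x = y) := by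
  classical
  have e : Fin l ≃ (q x0).roots.toFinset := (Finset.equivFinOfCardEq (hl x0)).symm
  set r : Fin l → ℂ := fun i => (e i : ℂ) with hrdef
  have hrinj : Function.Injective r := fun i j h => e.injective (Subtype.ext h)
  have hr : ∀ i, (q x0).IsRoot (r i) := fun i => isRoot_of_mem_roots (Multiset.mem_toFinset.1 (e i).2)
  obtain ⟨δ, hδ, hsep⟩ : ∃ δ : ℝ, 0 < δ ∧ ∀ i j, i ≠ j → 2 * δ < ‖r i - r j‖ := by
    have : ∀ᶠ δ in nhdsWithin (0:ℝ) (Set.Ioi 0), ∀ i j, i ≠ j → 2 * δ < ‖r i - r j‖ := by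
      refine Filter.eventually_all.2 fun i => Filter.eventually_all.2 fun j => ?_
      by_cases hij : i = j
      · simp [hij]
      · have : ∀ᶠ δ in nhds (0:ℝ), 2 * δ < ‖r i - r j‖ := by
          refine ContinuousAt.eventually_lt (by fun_prop) continuousAt_const ?_
          have := sub_ne_zero.2 (hrinj.ne hij)
          simpa using this
        filter_upwards [this.filter_mono nhdsWithin_le_nhds] with δ h _ using h
    obtain ⟨δ, h1, h2⟩ := (this.and self_mem_nhdsWithin).exists
    exact ⟨δ, h2, h1⟩
  have hev : ∀ᶠ x in nhds x0, ∀ i, ∃ z, (q x).IsRoot z ∧ ‖z - r i‖ < δ :=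
    Filter.eventually_all.2 fun i => gpd_near q d hc hd hne x0 (r i) (hr i) δ hδ
  obtain ⟨U, hU, hUo, hx0⟩ := eventually_nhds_iff.1 hev
  choose! θ hθ hθr using hU
  have hinj : ∀ x ∈ U, Function.Injective fun i => θ x i := by
    intro x hx i j hij
    by_contra hne'
    have h1 := hθr x hx i
    have h2 := hθr x hx j
    simp only at hij
    rw [← hij] at h2
    have h3 := hsep i j hne'
    have : ‖r i - r j‖ ≤ ‖θ x i - r i‖ + ‖θ x i - r j‖ := by
      have : r i - r j = (θ x i - r j) - (θ x i - r i) := by ring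
      rw [this]
      exact (norm_sub_le _ _).trans (by rw [add_comm])
    linarith
  have hsurj : ∀ x ∈ U, ∀ y, (q x).IsRoot y ↔ ∃ i, θ x i = y := by
    intro x hx y
    constructor
    · intro hy
      have himg : Finset.univ.image (θ x) = (q x).roots.toFinset := by
        apply Finset.eq_of_subset_of_card_le
        · intro z hz
          obtain ⟨i, _, rfl⟩ := Finset.mem_image.1 hz
          exact Multiset.mem_toFinset.2 ((mem_roots (hne x)).2 (hθ x hx i))
        · rw [hl, Finset.card_image_of_injective _ (hinj x hx)]; simp
      have : y ∈ (q x).roots.toFinset := Multiset.mem_toFinset.2 ((mem_roots (hne x)).2 hy)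
      rw [← himg] at this
      simpa using this
    · rintro ⟨i, rfl⟩
      exact hθ x hx i
  have huniq : ∀ x ∈ U, ∀ i z, (q x).IsRoot z → ‖z - r i‖ < δ → z = θ x i := by
    intro x hx i z hz hzr
    obtain ⟨j, rfl⟩ := (hsurj x hx z).1 hz
    by_cases hij : i = j
    · rw [hij]
    · exfalso
      have h1 := hθr x hx j
      have h3 := hsep i j hij
      have : ‖r i - r j‖ ≤ ‖θ x j - r i‖ + ‖θ x j - r j‖ := by
        have : r i - r j = (θ x j - r j) - (θ x j - r i) := by ring
        rw [this]
        exact (norm_sub_le _ _).trans (by rw [add_comm])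
      linarith
  refine ⟨U, hUo, hx0, fun i x => θ x i, ?_, hinj, hsurj⟩
  intro i x hx
  apply ContinuousAt.continuousWithinAt
  rw [Metric.continuousAt_iff']
  intro ε hε
  have hp : 0 < min ε (δ - ‖θ x i - r i‖) := lt_min hε (by linarith [hθr x hx i])
  filter_upwards [gpd_near q d hc hd hne x (θ x i) (hθ x hx i) _ hp, hUo.mem_nhds hx] with x' ⟨z, hz, hzl⟩ hx'
  have hz2 : z = θ x' i := by
    apply huniq x' hx' i z hz
    have : z - r i = (z - θ x i) + (θ x i - r i) := by ring
    rw [this]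
    refine (norm_add_le _ _).trans_lt ?_
    have := lt_min_iff.1 hzl
    linarith
  rw [dist_eq_norm, ← hz2]
  exact (lt_min_iff.1 hzl).1

/-- real sections -/
theorem gpd_real_sections {X : Type*} [TopologicalSpace X] (q : X → ℝ[X]) (d l : ℕ)
    (hc : ∀ k, Continuous fun x => (q x).coeff k) (hd : ∀ x, (q x).natDegree = d)
    (hne : ∀ x, q x ≠ 0) (hl : ∀ x, ((q x).map Complex.ofRealHom).roots.toFinset.card = l) (x0 : X) :
    ∃ U : Set X, IsOpen U ∧ x0 ∈ U ∧ ∃ (k : ℕ) (θ : Fin k → X → ℝ), (∀ i, ContinuousOn (θ i) U) ∧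
      (∀ x ∈ U, Function.Injective fun i => θ i x) ∧ 
      (∀ x ∈ U, ∀ y, (q x).IsRoot y ↔ ∃ i, θ i x = y) := by
  classical
  obtain ⟨U, hU, hx0, θ, hθc, hθi, hθs⟩ := gpd_sections (fun x => (q x).map Complex.ofRealHom) d l
    (fun k => by simpa [coeff_map, Function.comp_def] using Complex.continuous_ofReal.comp (hc k))
    (fun x => by rw [natDegree_map, hd]) (fun x => (Polynomial.map_ne_zero_iff Complex.ofRealHom.injective).2 (hne x)) hl x0
  have hcat : ∀ i, ContinuousAt (θ i) x0 := fun i => (hθc i).continuousAt (hU.mem_nhds hx0)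
  have hconj : ∀ x ∈ U, ∀ i, ∃ j, θ j x = (starRingEnd ℂ) (θ i x) := by
    intro x hx i
    refine (hθs x hx _).1 ?_
    have := (hθs x hx _).2 ⟨i, rfl⟩
    have h2 := congrArg (starRingEnd ℂ) this.eq_zero
    rw [IsRoot, eval_map, eval₂_eq_sum_range] at *
    rw [map_zero, map_sum] at h2
    rw [← h2]
    refine Finset.sum_congr rfl fun k _ => ?_
    simp
  have hA : ∀ᶠ x in nhds x0, ∀ i, (θ i x0).im ≠ 0 → (θ i x).im ≠ 0 := by
    refine Filter.eventually_all.2 fun i => ?_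
    by_cases h : (θ i x0).im = 0
    · simp [h]
    · have : ContinuousAt (fun x => (θ i x).im) x0 := Complex.continuous_im.continuousAt.comp (hcat i)
      filter_upwards [this.eventually_ne h] with x hx _ using hx
  have hB : ∀ᶠ x in nhds x0, ∀ i j, (θ i x0).im = 0 → i ≠ j → θ j x ≠ (starRingEnd ℂ) (θ i x) := by
    refine Filter.eventually_all.2 fun i => Filter.eventually_all.2 fun j => ?_
    by_cases h : (θ i x0).im = 0 ∧ i ≠ j
    · have hs : ContinuousAt (fun x => (starRingEnd ℂ) (θ i x)) x0 := Complex.continuous_conj.continuousAt.comp (hcat i)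
      have : ContinuousAt (fun x => θ j x - (starRingEnd ℂ) (θ i x)) x0 := (hcat j).sub hs
      have h0 : θ j x0 - (starRingEnd ℂ) (θ i x0) ≠ 0 := by
        rw [Complex.conj_eq_iff_im.2 h.1]
        exact sub_ne_zero.2 ((hθi x0 hx0).ne h.2.symm)
      filter_upwards [this.eventually_ne h0] with x hx _ _ using sub_ne_zero.1 hx
    · filter_upwards with x h1 h2 using (h ⟨h1, h2⟩).elim
  obtain ⟨V, hV, hVo, hx0V⟩ := eventually_nhds_iff.1 (hA.and hB)
  let e := Fintype.equivFin {i : Fin l // (θ i x0).im = 0}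
  have hreal : ∀ x ∈ U ∩ V, ∀ i, (θ i x0).im = 0 → (θ i x).im = 0 := by
    intro x hx i hi
    obtain ⟨j, hj⟩ := hconj x hx.1 i
    by_cases hij : i = j
    · subst hij; exact Complex.conj_eq_iff_im.1 hj.symm
    · exact ((hV x hx.2).2 i j hi hij hj).elim
  refine ⟨U ∩ V, hU.inter hVo, ⟨hx0, hx0V⟩, _, fun i x => (θ (e.symm i) x).re, ?_, ?_, ?_⟩
  · intro i
    exact Complex.continuous_re.comp_continuousOn ((hθc _).mono Set.inter_subset_left)
  · intro x hx i j hij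
    simp only at hij
    have : θ (e.symm i) x = θ (e.symm j) x := by
      apply Complex.ext hij
      rw [hreal x hx _ (e.symm i).2, hreal x hx _ (e.symm j).2]
    exact e.symm.injective (Subtype.ext (hθi x hx.1 this))
  · intro x hx y
    have hroot : (q x).IsRoot y ↔ ((q x).map Complex.ofRealHom).IsRoot (y:ℂ) := by
      rw [IsRoot, IsRoot, eval_map, ← Complex.ofRealHom_eq_coe, eval₂_at_apply]
      simp
    rw [hroot, hθs x hx.1]
    constructor
    · rintro ⟨i, hi⟩
      have him : (θ i x0).im = 0 := by
        by_contra h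
        have := (hV x hx.2).1 i h
        rw [hi] at this
        simp at this
      refine ⟨e ⟨i, him⟩, ?_⟩
      simp [hi]
    · rintro ⟨i, rfl⟩
      refine ⟨e.symm i, ?_⟩
      apply Complex.ext <;> simp
      exact hreal x hx _ (e.symm i).2

theorem gpd_core1 (Q : ℝ → ℂ → ℂ[X]) (d : ℕ) (ε : ℝ) (hε : 0 < ε)
    (hc : ∀ k, Continuous fun p : ℝ × ℂ => (Q p.1 p.2).coeff k)
    (hd : ∀ t τ, ‖τ‖ < ε → (Q t τ).natDegree = d)
    (hne : ∀ t τ, ‖τ‖ < ε → Q t τ ≠ 0)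
    (hsep : ∀ t τ, τ ≠ 0 → ‖τ‖ < ε → (Q t τ).roots.toFinset.card = d) :
    ∃ Z : Fin d → ℝ × ℂ → ℂ, (∀ i, ContinuousOn (Z i) {p | p.2.re < Real.log ε}) ∧
      (∀ p : ℝ × ℂ, p.2.re < Real.log ε → Function.Injective fun i => Z i p) ∧
      (∀ p : ℝ × ℂ, p.2.re < Real.log ε → ∀ y, (Q p.1 (Complex.exp p.2)).IsRoot y ↔ ∃ i, Z i p = y) := by
  classical
  set X : Set (ℝ × ℂ) := {p | p.2.re < Real.log ε} with hX
  have hXo : IsOpen X := isOpen_lt (by fun_prop) (by fun_prop)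
  have hXc : Convex ℝ X := by
    have : X = (LinearMap.snd ℝ ℝ ℂ) ⁻¹' {w : ℂ | w.re < Real.log ε} := rfl
    rw [this]
    exact (convex_halfSpace_re_lt _).linear_preimage _
  have hXn : X.Nonempty := ⟨(0, ((Real.log ε - 1 : ℝ) : ℂ)), by simp [hX]⟩
  haveI : ContractibleSpace X := hXc.contractibleSpace hXn
  haveI : LocallyPathConnectedSpace X := hXo.locallyPathConnectedSpace
  have hexp : ∀ p ∈ X, ‖Complex.exp p.2‖ < ε := by
    intro p hp
    rw [Complex.norm_exp, ← Real.lt_log_iff_exp_lt hε]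
    exact hp
  let q : X → ℂ[X] := fun p => Q p.1.1 (Complex.exp p.1.2)
  have hcq : ∀ k, Continuous fun x => (q x).coeff k := by
    intro k
    have : Continuous fun p : X => ((p.1.1, Complex.exp p.1.2) : ℝ × ℂ) := by fun_prop
    exact (hc k).comp this
  obtain ⟨k, θ, h1, h2, h3⟩ := gpd_glue (X := X) (Y := ℂ) (fun x y => (q x).IsRoot y) (by
    intro x0
    obtain ⟨U, hU, hx, θ, h1, h2, h3⟩ := gpd_sections q d d hcq (fun x => hd _ _ (hexp _ x.2))
      (fun x => hne _ _ (hexp _ x.2)) (fun x => hsep _ _ (Complex.exp_ne_zero _) (hexp _ x.2)) x0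
    exact ⟨U, hU, hx, d, θ, h1, h2, h3⟩) ⟨_, hXn.some_mem⟩
  have hk : k = d := by
    let x : X := ⟨_, hXn.some_mem⟩
    have e1 := hsep x.1.1 _ (Complex.exp_ne_zero _) (hexp _ x.2)
    have : Finset.univ.image (fun i => θ i x) = (q x).roots.toFinset := by
      ext y
      rw [Multiset.mem_toFinset, mem_roots (hne _ _ (hexp _ x.2)), h3 x y]
      simp
    rw [← e1]
    change _ = (q x).roots.toFinset.card
    rw [← this, Finset.card_image_of_injective _ (h2 x)]
    simp
  subst hk
  refine ⟨fun i p => if h : p ∈ X then θ i ⟨p, h⟩ else 0, ?_, ?_, ?_⟩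
  · intro i
    rw [continuousOn_iff_continuous_restrict]
    convert h1 i using 1
    funext p
    simp [Set.restrict]
  · intro p hp i j hij
    have hp' : p ∈ X := hp
    simp only [dif_pos hp'] at hij
    exact h2 _ hij
  · intro p hp y
    have hp' : p ∈ X := hp
    simp only [dif_pos hp']
    exact h3 ⟨p, hp'⟩ y

/-- the same with periodicity -/
theorem gpd_core2 (Q : ℝ → ℂ → ℂ[X]) (d : ℕ) (ε : ℝ) (hε : 0 < ε)
    (hc : ∀ k, Continuous fun p : ℝ × ℂ => (Q p.1 p.2).coeff k)
    (hd : ∀ t τ, ‖τ‖ < ε → (Q t τ).natDegree = d)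
    (hne : ∀ t τ, ‖τ‖ < ε → Q t τ ≠ 0)
    (hsep : ∀ t τ, τ ≠ 0 → ‖τ‖ < ε → (Q t τ).roots.toFinset.card = d) :
    ∃ (Z : Fin d → ℝ × ℂ → ℂ) (s : Fin d → Fin d) (N : ℕ), N ≠ 0 ∧ (∀ i, ContinuousOn (Z i) {p | p.2.re < Real.log ε}) ∧
      (∀ p : ℝ × ℂ, p.2.re < Real.log ε → Function.Injective fun i => Z i p) ∧
      (∀ p : ℝ × ℂ, p.2.re < Real.log ε → ∀ y, (Q p.1 (Complex.exp p.2)).IsRoot y ↔ ∃ i, Z i p = y) ∧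
      (∀ i t w, w.re < Real.log ε → Z i (t, w + 2 * Real.pi * Complex.I) = Z (s i) (t, w)) ∧
      (∀ i t (n : ℤ) w, w.re < Real.log ε → Z i (t, w + n * (N * (2 * Real.pi * Complex.I))) = Z i (t, w)) := by
  classical
  obtain ⟨Z, h1, h2, h3⟩ := gpd_core1 Q d ε hε hc hd hne hsep
  set X : Set (ℝ × ℂ) := {p | p.2.re < Real.log ε} with hX
  have hXc : Convex ℝ X := by
    have : X = (LinearMap.snd ℝ ℝ ℂ) ⁻¹' {w : ℂ | w.re < Real.log ε} := rfl
    rw [this]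
    exact (convex_halfSpace_re_lt _).linear_preimage _
  have hXn : X.Nonempty := ⟨(0, ((Real.log ε - 1 : ℝ) : ℂ)), by simp [hX]⟩
  haveI : PreconnectedSpace X := Subtype.preconnectedSpace hXc.isPreconnected
  have hsh : ∀ w : ℂ, (w + 2 * Real.pi * Complex.I).re = w.re := by intro w; simp
  have hexs : ∀ i, ∃ j, ∀ t w, w.re < Real.log ε → Z i (t, w + 2 * Real.pi * Complex.I) = Z j (t, w) := by
    intro i
    let x0 : X := ⟨_, hXn.some_mem⟩
    have hs : ∀ x : X, ∃ l, Z i (x.1.1, x.1.2 + 2 * Real.pi * Complex.I) = Z l x.1 := by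
      intro x
      have := (h3 (x.1.1, x.1.2 + 2 * Real.pi * Complex.I) (by rw [hsh]; exact x.2) _).2 ⟨i, rfl⟩
      simp only [Complex.exp_add, Complex.exp_two_pi_mul_I, mul_one] at this
      obtain ⟨l, hl⟩ := (h3 x.1 x.2 _).1 this
      exact ⟨l, hl.symm⟩
    obtain ⟨j, hj⟩ := hs x0
    have := gpd_select (fun i (x : X) => Z i x.1) (fun l => by
        have := h1 l; rw [continuousOn_iff_continuous_restrict] at this; exact this)
      (by
        rintro l l' ⟨x, hx⟩ y
        have : l = l' := h2 x.1 x.2 hx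
        rw [this])
      (fun x : X => Z i (x.1.1, x.1.2 + 2 * Real.pi * Complex.I))
      (by
        refine (h1 i).comp_continuous (f := fun x : X => ((x.1.1, x.1.2 + 2 * Real.pi * Complex.I) : ℝ × ℂ)) (by fun_prop) ?_
        intro x
        change (x.1.2 + 2 * Real.pi * Complex.I).re < _
        rw [hsh]; exact x.2)
      hs x0 j hj
    exact ⟨j, fun t w hw => this ⟨(t, w), hw⟩⟩
  choose s hs using hexs
  have hsinj : Function.Injective s := by
    intro i j hij
    obtain ⟨p, hp⟩ := hXn
    have a := hs i p.1 p.2 hp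
    have b := hs j p.1 p.2 hp
    rw [hij, ← b] at a
    exact h2 (p.1, p.2 + 2 * Real.pi * Complex.I) (by rw [hsh]; exact hp) a
  let σ : Equiv.Perm (Fin d) := Equiv.ofBijective s (Finite.injective_iff_bijective.1 hsinj)
  have hσ : ∀ (n : ℕ) i t w, w.re < Real.log ε → Z i (t, w + n * (2 * Real.pi * Complex.I)) = Z ((σ ^ n) i) (t, w) := by
    intro n
    induction n with
    | zero => intro i t w hw; simp
    | succ n ih =>
      intro i t w hw
      have e : w + ((n + 1 : ℕ) : ℂ) * (2 * Real.pi * Complex.I) = (w + n * (2 * Real.pi * Complex.I)) + 2 * Real.pi * Complex.I := by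
        push_cast; ring
      have hre : (w + n * (2 * Real.pi * Complex.I)).re < Real.log ε := by simpa using hw
      rw [e, hs i _ _ hre, ih _ _ _ hw, pow_succ]
      rfl
  have hper : ∀ i t w, w.re < Real.log ε → Z i (t, w + (Fintype.card (Equiv.Perm (Fin d)) : ℕ) * (2 * Real.pi * Complex.I)) = Z i (t, w) := by
    intro i t w hw
    rw [hσ _ _ _ _ hw, pow_card_eq_one]
    rfl
  refine ⟨Z, s, Fintype.card (Equiv.Perm (Fin d)), Fintype.card_ne_zero, h1, h2, h3, hs, ?_⟩
  set N := Fintype.card (Equiv.Perm (Fin d))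
  have hnat : ∀ (n : ℕ) i t w, w.re < Real.log ε → Z i (t, w + n * (N * (2 * Real.pi * Complex.I))) = Z i (t, w) := by
    intro n
    induction n with
    | zero => intro i t w hw; simp
    | succ n ih =>
      intro i t w hw
      have e : w + ((n + 1 : ℕ) : ℂ) * (N * (2 * Real.pi * Complex.I)) = (w + n * (N * (2 * Real.pi * Complex.I))) + N * (2 * Real.pi * Complex.I) := by
        push_cast; ring
      have hre : (w + n * (N * (2 * Real.pi * Complex.I))).re < Real.log ε := by simpa using hw
      rw [e, hper i _ _ hre, ih _ _ _ hw]
  intro i t n w hw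
  rcases Int.eq_nat_or_neg n with ⟨m, rfl | rfl⟩
  · simpa using hnat m i t w hw
  · have hre : (w + ((-(m:ℤ) : ℤ) : ℂ) * (N * (2 * Real.pi * Complex.I))).re < Real.log ε := by simpa using hw
    rw [← hnat m i t _ hre]
    congr 2
    push_cast; ring

theorem gpd_deriv_aux (f G k : ℂ → ℂ) (u0 : ℂ) (hG : DifferentiableAt ℂ G u0) (hG0 : G u0 = 0)
    (hk : ContinuousAt k u0) (h : ∀ᶠ u in nhds u0, f u - f u0 = G u * k u) : DifferentiableAt ℂ f u0 := by
  have h1 := hG.hasDerivAt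
  rw [hasDerivAt_iff_tendsto_slope] at h1
  have h2 : HasDerivAt f (deriv G u0 * k u0) u0 := by
    rw [hasDerivAt_iff_tendsto_slope]
    refine (h1.mul (hk.tendsto.mono_left nhdsWithin_le_nhds)).congr' ?_
    filter_upwards [h.filter_mono nhdsWithin_le_nhds] with u hu
    simp only [slope_def_field, hG0, sub_zero, hu]
    ring
  exact h2.differentiableAt

theorem gpd_sep_prod (q : ℂ[X]) (d : ℕ) (hq : q ≠ 0) (hd : q.natDegree = d) 
    (y : Fin d → ℂ) (hi : Function.Injective y) (hy : ∀ z, q.IsRoot z ↔ ∃ i, y i = z) (z : ℂ) : 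
    q.eval z = q.coeff d * ∏ i, (z - y i) := by
  classical
  have hcard : q.roots.card = d := by rw [← hd]; exact (IsAlgClosed.splits q).natDegree_eq_card_roots.symm
  have h1 : (Finset.univ.image y) = q.roots.toFinset := by
    ext w; rw [Multiset.mem_toFinset, mem_roots hq, hy]; simp
  have h2 : (Finset.univ.val.map y) = q.roots := by
    apply Multiset.eq_of_le_of_card_le
    · rw [Multiset.le_iff_subset (Multiset.Nodup.map hi Finset.univ.nodup)]
      intro w hw
      rw [mem_roots hq, hy]
      simpa using hw
    · simp [hcard]
  rw [gpd_prod_roots, leadingCoeff, hd, ← h2, Multiset.map_map]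
  rfl

set_option maxHeartbeats 2000000 in
theorem gpd_core3 (Q : ℝ → ℂ → ℂ[X]) (d : ℕ) (ε : ℝ) (hε : 0 < ε)
    (hc : ∀ k, Continuous fun p : ℝ × ℂ => (Q p.1 p.2).coeff k)
    (hh : ∀ t k, Differentiable ℂ fun τ => (Q t τ).coeff k)
    (hd : ∀ t τ, ‖τ‖ < ε → (Q t τ).natDegree = d)
    (hne : ∀ t τ, ‖τ‖ < ε → Q t τ ≠ 0)
    (hsep : ∀ t τ, τ ≠ 0 → ‖τ‖ < ε → (Q t τ).roots.toFinset.card = d) :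
    ∃ (Y : Fin d → ℝ → ℂ → ℂ) (s : Fin d → Fin d) (N : ℕ) (ρ : ℝ) (ω : ℂ), N ≠ 0 ∧ 0 < ρ ∧ 
      IsPrimitiveRoot ω N ∧
      (∀ u : ℂ, ‖u‖ < ρ → ‖u ^ N‖ < ε) ∧
      (∀ i, ContinuousOn (fun p : ℝ × ℂ => Y i p.1 p.2) {p | p.2 ≠ 0 ∧ ‖p.2‖ < ρ}) ∧
      (∀ i t, DifferentiableOn ℂ (Y i t) (Metric.ball 0 ρ)) ∧
      (∀ t u, u ≠ 0 → ‖u‖ < ρ → Function.Injective fun i => Y i t u) ∧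
      (∀ t u, ‖u‖ < ρ → ∀ z, (Q t (u ^ N)).eval z = (Q t (u ^ N)).coeff d * ∏ i, (z - Y i t u)) ∧
      (∀ i t u, ‖u‖ < ρ → Y i t (ω * u) = Y (s i) t u) := by
  classical
  obtain ⟨Z, s, N, hN, h1, h2, h3, h4, h5⟩ := gpd_core2 Q d ε hε hc hd hne hsep
  have hNpos : (0:ℝ) < N := by positivity
  have hNC : (N:ℂ) ≠ 0 := by exact_mod_cast hN
  set ρ : ℝ := Real.exp (Real.log ε / N) with hρ
  have hρ0 : 0 < ρ := Real.exp_pos _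
  have hρN : ρ ^ N = ε := by
    rw [hρ, ← Real.exp_nat_mul, mul_div_cancel₀ _ hNpos.ne', Real.exp_log hε]
  have hpow : ∀ u : ℂ, ‖u‖ < ρ → ‖u ^ N‖ < ε := by
    intro u hu
    rw [norm_pow, ← hρN]
    exact pow_lt_pow_left₀ hu (norm_nonneg _) hN
  have hlt : ∀ w : ℂ, ‖Complex.exp w‖ < ρ → (N * w).re < Real.log ε := by
    intro w hw
    rw [Complex.norm_exp, hρ, Real.exp_lt_exp, lt_div_iff₀ hNpos] at hw
    simpa [mul_comm] using hw
  set Y0 : Fin d → ℝ → ℂ → ℂ := fun i t u => Z i (t, N * Complex.log u) with hY0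
  have hZY : ∀ i t w, ‖Complex.exp w‖ < ρ → Z i (t, N * w) = Y0 i t (Complex.exp w) := by
    intro i t w hw
    obtain ⟨n, hn⟩ := Complex.exp_eq_exp_iff_exists_int.1 (Complex.exp_log (Complex.exp_ne_zero w)).symm
    have e : (N:ℂ) * w = N * Complex.log (Complex.exp w) + n * (N * (2 * Real.pi * Complex.I)) := by
      conv_lhs => rw [hn]
      ring
    rw [e, h5 i t n]
    apply hlt
    rwa [Complex.exp_log (Complex.exp_ne_zero w)]
  have hY0c : ∀ i, ContinuousOn (fun p : ℝ × ℂ => Y0 i p.1 p.2) {p | p.2 ≠ 0 ∧ ‖p.2‖ < ρ} := by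
    rintro i ⟨t0, u0⟩ ⟨hu0, hu1⟩
    apply ContinuousAt.continuousWithinAt
    simp only at hu0 hu1
    set wf : ℝ × ℂ → ℂ := fun p => Complex.log (p.2 / u0) + Complex.log u0 with hwf
    have hwc : ContinuousAt wf (t0, u0) := by
      refine ContinuousAt.add ?_ continuousAt_const
      refine ContinuousAt.clog (by fun_prop) ?_
      simp [hu0]
    have hexp : ∀ p : ℝ × ℂ, p.2 ≠ 0 → Complex.exp (wf p) = p.2 := by
      intro p hp
      rw [hwf, Complex.exp_add, Complex.exp_log hu0, Complex.exp_log (div_ne_zero hp hu0)]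
      field_simp
    have hev : (fun p : ℝ × ℂ => Y0 i p.1 p.2) =ᶠ[nhds (t0, u0)] fun p => Z i (p.1, N * wf p) := by
      have a : ∀ᶠ p : ℝ × ℂ in nhds (t0, u0), p.2 ≠ 0 := 
        (continuous_snd.continuousAt (x := (t0,u0))).eventually_ne hu0
      have b : ∀ᶠ p : ℝ × ℂ in nhds (t0, u0), ‖p.2‖ < ρ := 
        ContinuousAt.eventually_lt (by fun_prop) (by fun_prop) hu1
      filter_upwards [a, b] with p hp hp'
      rw [hZY i p.1 _ (by rw [hexp p hp]; exact hp'), hexp p hp]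
    refine ContinuousAt.congr ?_ hev.symm
    have hXo : IsOpen {p : ℝ × ℂ | p.2.re < Real.log ε} := isOpen_lt (by fun_prop) (by fun_prop)
    have hmem : ((t0, (N:ℂ) * wf (t0, u0)) : ℝ × ℂ) ∈ {p : ℝ × ℂ | p.2.re < Real.log ε} := by
      apply hlt
      rw [hexp (t0, u0) hu0]; exact hu1
    have := (h1 i).continuousAt (hXo.mem_nhds hmem)
    exact ContinuousAt.comp (f := fun p : ℝ × ℂ => ((p.1, (N:ℂ) * wf p) : ℝ × ℂ)) this (by fun_prop)
  have hre : ∀ u : ℂ, u ≠ 0 → ‖u‖ < ρ → (N * Complex.log u).re < Real.log ε := by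
    intro u hu hu'
    apply hlt; rwa [Complex.exp_log hu]
  have hexpN : ∀ u : ℂ, u ≠ 0 → Complex.exp (N * Complex.log u) = u ^ N := by
    intro u hu; rw [Complex.exp_nat_mul, Complex.exp_log hu]
  have hY0i : ∀ t u, u ≠ 0 → ‖u‖ < ρ → Function.Injective fun i => Y0 i t u := by
    intro t u hu hu'
    exact h2 (t, N * Complex.log u) (hre u hu hu')
  have hY0r : ∀ t u, u ≠ 0 → ‖u‖ < ρ → ∀ z, (Q t (u ^ N)).IsRoot z ↔ ∃ i, Y0 i t u = z := by
    intro t u hu hu' z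
    have := h3 (t, N * Complex.log u) (hre u hu hu') z
    rwa [hexpN u hu] at this
  have hY0p : ∀ t u, u ≠ 0 → ‖u‖ < ρ → ∀ z, (Q t (u ^ N)).eval z = (Q t (u ^ N)).coeff d * ∏ i, (z - Y0 i t u) := by
    intro t u hu hu'
    exact gpd_sep_prod _ d (hne _ _ (hpow u hu')) (hd _ _ (hpow u hu')) _ (hY0i t u hu hu') (hY0r t u hu hu')
  have hlead : ∀ t τ, ‖τ‖ < ε → (Q t τ).coeff d ≠ 0 := by
    intro t τ hτ
    rw [← hd t τ hτ]
    exact leadingCoeff_ne_zero.2 (hne t τ hτ)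
  have hsec : ∀ i t, ContinuousOn (Y0 i t) {u | u ≠ 0 ∧ ‖u‖ < ρ} := by
    intro i t
    exact (hY0c i).comp (f := fun u : ℂ => ((t, u) : ℝ × ℂ)) (by fun_prop) (fun u hu => hu)
  have hPo : IsOpen {u : ℂ | u ≠ 0 ∧ ‖u‖ < ρ} := 
    (isOpen_ne).inter (isOpen_lt (f := fun u : ℂ => ‖u‖) (g := fun _ => ρ) (by fun_prop) (by fun_prop))
  have hevaldiff : ∀ t z, Differentiable ℂ (fun u : ℂ => ∑ k ∈ Finset.range (d+1), (Q t (u ^ N)).coeff k * z ^ k) := by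
    intro t z
    refine Differentiable.fun_sum fun k _ => ?_
    have := (hh t k).comp (f := fun u : ℂ => u ^ N) (by fun_prop)
    simp only [Function.comp_def] at this
    exact this.mul_const _
  have hevals : ∀ t u z, ‖u‖ < ρ → (Q t (u ^ N)).eval z = ∑ k ∈ Finset.range (d+1), (Q t (u ^ N)).coeff k * z ^ k := by
    intro t u z hu
    rw [eval_eq_sum_range, hd _ _ (hpow u hu)]
  have hY0d : ∀ i t, DifferentiableOn ℂ (Y0 i t) {u | u ≠ 0 ∧ ‖u‖ < ρ} := by
    rintro i t u0 ⟨hu0, hu1⟩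
    apply DifferentiableAt.differentiableWithinAt
    set z0 := Y0 i t u0 with hz0
    have hcont : ∀ j, ContinuousAt (Y0 j t) u0 := fun j => (hsec j t).continuousAt (hPo.mem_nhds ⟨hu0, hu1⟩)
    have hDc : ContinuousAt (fun u => (Q t (u ^ N)).coeff d * ∏ j ∈ Finset.univ.erase i, (z0 - Y0 j t u)) u0 := by
      refine ContinuousAt.mul ?_ ?_
      · have := (hh t d).continuous.comp (f := fun u : ℂ => u ^ N) (by fun_prop)
        exact this.continuousAt
      · exact tendsto_finsetProd _ fun j _ => (continuousAt_const.sub (hcont j)).tendsto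
    have hD0 : (Q t (u0 ^ N)).coeff d * ∏ j ∈ Finset.univ.erase i, (z0 - Y0 j t u0) ≠ 0 := by
      refine mul_ne_zero (hlead _ _ (hpow _ hu1)) (Finset.prod_ne_zero_iff.2 fun j hj => sub_ne_zero.2 ?_)
      exact (hY0i t u0 hu0 hu1).ne (Finset.ne_of_mem_erase hj).symm
    refine gpd_deriv_aux _ (fun u : ℂ => ∑ k ∈ Finset.range (d+1), (Q t (u ^ N)).coeff k * z0 ^ k)
      (fun u => - ((Q t (u ^ N)).coeff d * ∏ j ∈ Finset.univ.erase i, (z0 - Y0 j t u))⁻¹) u0 (hevaldiff t z0 u0) ?_ ?_ ?_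
    · rw [← hevals t u0 z0 hu1]
      exact (hY0r t u0 hu0 hu1 z0).2 ⟨i, rfl⟩
    · exact (hDc.inv₀ hD0).neg
    · filter_upwards [hPo.mem_nhds ⟨hu0, hu1⟩, hDc.eventually_ne hD0] with u hu hu'
      rw [← hevals t u z0 hu.2, hY0p t u hu.1 hu.2, ← Finset.mul_prod_erase _ _ (Finset.mem_univ i)]
      have e : Y0 i t u0 = z0 := rfl
      rw [e, mul_neg, eq_neg_iff_add_eq_zero]
      rw [mul_left_comm, mul_assoc, mul_inv_cancel₀ hu']
      ring
  -- boundedness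
  have hbd : ∀ i t, ∀ᶠ u in nhdsWithin (0:ℂ) {0}ᶜ, ‖Y0 i t u‖ ≤ ((∑ k ∈ Finset.range d, (‖(Q t 0).coeff k‖₊ + 1)) / (‖(Q t 0).coeff d‖₊ / 2) + 1 : NNReal) := by
    intro i t
    have hcc : ∀ k, ContinuousAt (fun u : ℂ => ‖(Q t (u ^ N)).coeff k‖₊) 0 := by
      intro k
      have := (hh t k).continuous.comp (f := fun u : ℂ => u ^ N) (by fun_prop)
      exact this.nnnorm.continuousAt
    have hz : (0:ℂ) ^ N = 0 := zero_pow hN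
    have a1 : ∀ᶠ u in nhds (0:ℂ), ∀ k ∈ Finset.range d, ‖(Q t (u ^ N)).coeff k‖₊ < ‖(Q t 0).coeff k‖₊ + 1 := by
      rw [Filter.eventually_all_finset]
      intro k _
      refine (hcc k).eventually_lt continuousAt_const ?_
      rw [hz]; exact lt_add_one _
    have hl0 : 0 < ‖(Q t 0).coeff d‖₊ := by
      have := hlead t 0 (by simpa using hε)
      simpa [pos_iff_ne_zero] using this
    have a2 : ∀ᶠ u in nhds (0:ℂ), ‖(Q t 0).coeff d‖₊ / 2 < ‖(Q t (u ^ N)).coeff d‖₊ := by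
      refine continuousAt_const.eventually_lt (hcc d) ?_
      rw [hz]; exact half_lt_self hl0
    have a3 : ∀ᶠ u in nhds (0:ℂ), ‖u‖ < ρ := ContinuousAt.eventually_lt (by fun_prop) (by fun_prop) (by simpa using hρ0)
    filter_upwards [a1.filter_mono nhdsWithin_le_nhds, a2.filter_mono nhdsWithin_le_nhds, a3.filter_mono nhdsWithin_le_nhds, self_mem_nhdsWithin] with u b1 b2 b3 b4
    have hroot := (hY0r t u b4 b3 _).2 ⟨i, rfl⟩
    have := hroot.norm_lt_cauchyBound (hne _ _ (hpow u b3))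
    refine this.le.trans (NNReal.coe_le_coe.2 ?_)
    rw [cauchyBound, leadingCoeff, hd _ _ (hpow u b3)]
    gcongr
    refine Finset.sup_le fun k hk => (b1 k hk).le.trans ?_
    exact Finset.single_le_sum (f := fun k => ‖(Q t 0).coeff k‖₊ + 1) (fun _ _ => zero_le) hk
  set Y : Fin d → ℝ → ℂ → ℂ := fun i t => Function.update (Y0 i t) 0 (Filter.limUnder (nhdsWithin (0:ℂ) {0}ᶜ) (Y0 i t)) with hY
  have hYY0 : ∀ i t u, u ≠ 0 → Y i t u = Y0 i t u := by
    intro i t u hu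
    simp [hY, Function.update_of_ne hu]
  have hYd : ∀ i t, DifferentiableOn ℂ (Y i t) (Metric.ball 0 ρ) := by
    intro i t
    set C : ℝ := (((∑ k ∈ Finset.range d, (‖(Q t 0).coeff k‖₊ + 1)) / (‖(Q t 0).coeff d‖₊ / 2) + 1 : NNReal) : ℝ)
    have := hbd i t
    rw [eventually_nhdsWithin_iff, Metric.eventually_nhds_iff_ball] at this
    obtain ⟨r, hr, hrb⟩ := this
    have hm : DifferentiableOn ℂ (Y i t) (Metric.ball 0 (min r ρ)) := by
      refine Complex.differentiableOn_update_limUnder_of_bddAbove (Metric.ball_mem_nhds 0 (lt_min hr hρ0)) ?_ ?_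
      · refine (hY0d i t).mono ?_
        rintro u ⟨hu, hu'⟩
        refine ⟨hu', ?_⟩
        have := Metric.mem_ball.1 hu
        rw [dist_zero_right] at this
        exact this.trans_le (min_le_right _ _)
      · refine ⟨C, ?_⟩
        rintro _ ⟨u, ⟨hu, hu'⟩, rfl⟩
        exact hrb u (Metric.ball_subset_ball (min_le_left _ _) hu) hu'
    intro u hu
    apply DifferentiableAt.differentiableWithinAt
    by_cases hu0 : u = 0
    · subst hu0
      exact hm.differentiableAt (Metric.ball_mem_nhds 0 (lt_min hr hρ0))
    · have hmem : u ∈ {u : ℂ | u ≠ 0 ∧ ‖u‖ < ρ} := ⟨hu0, by simpa using hu⟩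
      refine ((hY0d i t).differentiableAt (hPo.mem_nhds hmem)).congr_of_eventuallyEq ?_
      filter_upwards [hPo.mem_nhds hmem] with v hv using hYY0 i t v hv.1
  have hYc0 : ∀ i t, ContinuousAt (Y i t) 0 := fun i t => 
    ((hYd i t).differentiableAt (Metric.ball_mem_nhds 0 hρ0)).continuousAt
  have heq0 : ∀ f g : ℂ → ℂ, ContinuousAt f 0 → ContinuousAt g 0 → (∀ u, u ≠ 0 → ‖u‖ < ρ → f u = g u) → f 0 = g 0 := by
    intro f g hf hg h
    refine tendsto_nhds_unique (f := f) (l := nhdsWithin (0:ℂ) {0}ᶜ) (hf.tendsto.mono_left nhdsWithin_le_nhds) ?_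
    refine (hg.tendsto.mono_left nhdsWithin_le_nhds).congr' ?_
    have a3 : ∀ᶠ u in nhds (0:ℂ), ‖u‖ < ρ := ContinuousAt.eventually_lt (by fun_prop) (by fun_prop) (by simpa using hρ0)
    filter_upwards [a3.filter_mono nhdsWithin_le_nhds, self_mem_nhdsWithin] with u b1 b2
    exact (h u b2 b1).symm
  refine ⟨Y, s, N, ρ, Complex.exp (2 * Real.pi * Complex.I / N), hN, hρ0, Complex.isPrimitiveRoot_exp N hN, hpow, ?_, hYd, ?_, ?_, ?_⟩
  · intro i
    refine (hY0c i).congr ?_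
    intro p hp
    exact hYY0 i _ _ hp.1
  · intro t u hu hu' i j hij
    simp only [hYY0 _ _ _ hu] at hij
    exact hY0i t u hu hu' hij
  · intro t u hu z
    by_cases hu0 : u = 0
    · subst hu0
      rw [hevals t 0 z (by simpa using hρ0)]
      refine heq0 (fun u => ∑ k ∈ Finset.range (d+1), (Q t (u ^ N)).coeff k * z ^ k) (fun u => (Q t (u ^ N)).coeff d * ∏ i, (z - Y i t u)) (hevaldiff t z).continuous.continuousAt ?_ ?_
      · refine ContinuousAt.mul ?_ ?_
        · have := (hh t d).continuous.comp (f := fun u : ℂ => u ^ N) (by fun_prop)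
          exact this.continuousAt
        · exact tendsto_finsetProd _ fun j _ => (continuousAt_const.sub (hYc0 j t)).tendsto
      · intro u hu hu'
        rw [← hevals t u z hu', hY0p t u hu hu']
        simp only [hYY0 _ _ _ hu]
    · rw [hY0p t u hu0 hu]
      simp only [hYY0 _ _ _ hu0]
  · intro i t
    have hoff : ∀ u : ℂ, u ≠ 0 → ‖u‖ < ρ → Y i t (Complex.exp (2 * Real.pi * Complex.I / N) * u) = Y (s i) t u := by
      intro u hu0 hu
      rw [hYY0 _ _ _ hu0, hYY0 _ _ _ (mul_ne_zero (Complex.exp_ne_zero _) hu0)]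
      have hn : ‖Complex.exp (2 * Real.pi * Complex.I / N)‖ = 1 := 
        (Complex.isPrimitiveRoot_exp N hN).norm'_eq_one hN
      have e1 : Complex.exp (2 * Real.pi * Complex.I / N) * u = Complex.exp (Complex.log u + 2 * Real.pi * Complex.I / N) := by
        rw [Complex.exp_add, Complex.exp_log hu0, mul_comm]
      rw [e1, ← hZY i t]
      · change _ = Z (s i) (t, N * Complex.log u)
        rw [← h4 i t _ (hre u hu0 hu)]
        congr 2
        field_simp
      · rw [← e1, norm_mul, hn, one_mul]; exact hu
    intro u hu
    by_cases hu0 : u = 0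
    · subst hu0
      refine heq0 (fun u => Y i t (Complex.exp (2 * Real.pi * Complex.I / N) * u)) (Y (s i) t) ?_ (hYc0 _ t) hoff
      refine ContinuousAt.comp (f := fun u : ℂ => Complex.exp (2 * Real.pi * Complex.I / N) * u) (g := Y i t) ?_ (by fun_prop)
      simpa using hYc0 i t
    · exact hoff u hu0 hu

theorem gpd_card_image {ι : Type*} [Fintype ι] (y y' : ι → ℂ) (h : ∀ i j, y i = y j → y' i = y' j) :
    (Finset.univ.image y').card ≤ (Finset.univ.image y).card := by
  classical
  have hf : Function.FactorsThrough y' y := fun i j hij => h i j hij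
  have : y' = (Function.extend y y' 0) ∘ y := by
    funext i; exact (hf.extend_apply 0 i).symm
  rw [this, ← Finset.image_image]
  exact Finset.card_image_le

theorem gpd_ord_prod {ι : Type*} (s : Finset ι) (f : ι → ℂ → ℂ) (hf : ∀ i, AnalyticAt ℂ (f i) 0) :
    analyticOrderAt (fun u => ∏ i ∈ s, f i u) 0 = ∑ i ∈ s, analyticOrderAt (f i) 0 := by
  classical
  induction s using Finset.induction_on with
  | empty => 
    simp only [Finset.prod_empty, Finset.sum_empty]
    rw [(analyticAt_const).analyticOrderAt_eq_zero]; exact one_ne_zero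
  | insert a s ha ih =>
    simp only [Finset.prod_insert ha, Finset.sum_insert ha]
    rw [← ih]
    exact analyticOrderAt_mul (hf a) (Finset.analyticAt_fun_prod s (fun i _ => hf i))

theorem gpd_homog_prod (d : ℕ) (q : ℂ[X]) (hd : q.natDegree = d) (y : Fin d → ℂ)
    (h : ∀ z, q.eval z = q.coeff d * ∏ i, (z - y i)) (A B : ℂ) (hB : B ≠ 0) :
    ∑ k ∈ Finset.range (d+1), q.coeff k * A ^ k * B ^ (d - k) = q.coeff d * ∏ i, (A - B * y i) := by
  have h1 := h (A / B)
  rw [eval_eq_sum_range, hd] at h1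
  have h2 : ∏ i, (A - B * y i) = B ^ d * ∏ i, (A / B - y i) := by
    have : B ^ d = ∏ i : Fin d, B := by simp
    rw [this, ← Finset.prod_mul_distrib]
    refine Finset.prod_congr rfl fun i _ => ?_
    field_simp
  rw [h2, mul_left_comm, ← h1, Finset.mul_sum]
  refine Finset.sum_congr rfl fun k hk => ?_
  have hk' : k ≤ d := Nat.lt_succ_iff.1 (Finset.mem_range.1 hk)
  have : B ^ d = B ^ k * B ^ (d - k) := by rw [← pow_add, Nat.add_sub_cancel' hk']
  rw [this, div_pow]
  field_simp

theorem gpd_roots_eq (d : ℕ) (q : ℂ[X]) (hl : q.coeff d ≠ 0) (y : Fin d → ℂ)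
    (h : ∀ z, q.eval z = q.coeff d * ∏ i, (z - y i)) : q.roots = Finset.univ.val.map y := by
  have : q = C (q.coeff d) * ∏ i, (X - C (y i)) := by
    apply Polynomial.funext
    intro z
    rw [h z, eval_mul, eval_C, eval_prod]
    simp
  conv_lhs => rw [this]
  rw [roots_C_mul _ hl]
  have := Polynomial.roots_multiset_prod_X_sub_C (Finset.univ.val.map y)
  rw [Multiset.map_map] at this
  exact this

set_option maxHeartbeats 1000000 in
theorem gpd_core (Q : ℝ → ℂ → ℂ[X]) (d : ℕ) (ε : ℝ) (hε : 0 < ε)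
    (hc : ∀ k, Continuous fun p : ℝ × ℂ => (Q p.1 p.2).coeff k)
    (hh : ∀ t k, Differentiable ℂ fun τ => (Q t τ).coeff k)
    (hd : ∀ t τ, ‖τ‖ < ε → (Q t τ).natDegree = d)
    (hne : ∀ t τ, ‖τ‖ < ε → Q t τ ≠ 0)
    (hsep : ∀ t τ, τ ≠ 0 → ‖τ‖ < ε → (Q t τ).roots.toFinset.card = d) :
    (∀ t t', (Q t 0).roots.toFinset.card = (Q t' 0).roots.toFinset.card) ∧
    ∀ θ : ℝ → ℂ, Continuous θ → (∀ t, (Q t 0).IsRoot (θ t)) → ∀ t t', 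
      (Q t 0).rootMultiplicity (θ t) = (Q t' 0).rootMultiplicity (θ t') ∧
      ∀ (n : ℕ∞) (α β : ℂ), analyticOrderAt (fun τ => ∑ k ∈ Finset.range (d+1), 
          (Q t τ).coeff k * (θ t + τ * α) ^ k * (1 + τ * β) ^ (d - k)) 0 ≤ n → 
        ∃ α' : ℝ, analyticOrderAt (fun τ => ∑ k ∈ Finset.range (d+1), 
          (Q t' τ).coeff k * (θ t' + τ * α') ^ k * (1 + τ * 0) ^ (d - k)) 0 ≤ n := by
  classical
  obtain ⟨Y, s, N, ρ, ω, hN, hρ, hω, hpow, hYc, hYd, hYi, hYp, hYs⟩ := gpd_core3 Q d ε hε hc hh hd hne hsep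
  have hlead : ∀ t τ, ‖τ‖ < ε → (Q t τ).coeff d ≠ 0 := by
    intro t τ hτ
    rw [← hd t τ hτ]
    exact leadingCoeff_ne_zero.2 (hne t τ hτ)
  have hYa : ∀ i t, AnalyticAt ℂ (Y i t) 0 := fun i t => 
    (hYd i t).analyticAt (Metric.ball_mem_nhds 0 hρ)
  have hz : (0:ℂ) ^ N = 0 := zero_pow hN
  have hYat : ∀ i t u, u ≠ 0 → ‖u‖ < ρ → ContinuousAt (fun p : ℝ × ℂ => Y i p.1 p.2) (t, u) := by
    intro i t u hu hu'
    refine (hYc i).continuousAt (IsOpen.mem_nhds ?_ ⟨hu, hu'⟩)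
    exact (isOpen_ne_fun (by fun_prop) (by fun_prop)).inter (isOpen_lt (f := fun p : ℝ × ℂ => ‖p.2‖) (g := fun _ => ρ) (by fun_prop) (by fun_prop))
  have hYat' : ∀ i t t0 u, u ≠ 0 → ‖u‖ < ρ → ContinuousAt (fun p : ℝ × ℂ => Y i t0 p.2) (t, u) := by
    intro i t t0 u hu hu'
    have : ContinuousAt (Y i t0) u := ((hYd i t0).differentiableAt (Metric.isOpen_ball.mem_nhds (by simpa using hu'))).continuousAt
    exact ContinuousAt.comp (f := fun p : ℝ × ℂ => p.2) (g := Y i t0) this (by fun_prop)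
  -- sphere facts
  set r := ρ / 2 with hr
  have hr0 : 0 < r := half_pos hρ
  have hrρ : r < ρ := half_lt_self hρ
  have hsph : ∀ u ∈ Metric.sphere (0:ℂ) r, u ≠ 0 ∧ ‖u‖ < ρ := by
    intro u hu
    have : ‖u‖ = r := by simpa using hu
    refine ⟨?_, this ▸ hrρ⟩
    rintro rfl
    simp at this; exact hr0.ne this
  have hord : ∀ i j t t', analyticOrderAt (fun u => Y i t u - Y j t u) 0 = analyticOrderAt (fun u => Y i t' u - Y j t' u) 0 := by
    intro i j
    by_cases hij : i = j
    · subst hij; simp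
    have hloc : IsLocallyConstant (fun t => analyticOrderAt (fun u => Y i t u - Y j t u) 0) := by
      rw [IsLocallyConstant.iff_eventually_eq]
      intro t0
      have hnz : ∀ t u, ‖u‖ < ρ → u ≠ 0 → Y i t u - Y j t u ≠ 0 := by
        intro t u hu hu0
        exact sub_ne_zero.2 ((hYi t u hu0 hu).ne hij)
      have hev : ∀ᶠ t in nhds t0, ∀ u ∈ Metric.sphere (0:ℂ) r, 
          ‖(Y i t u - Y j t u) - (Y i t0 u - Y j t0 u)‖ < ‖Y i t0 u - Y j t0 u‖ := by
        refine (isCompact_sphere (0:ℂ) r).eventually_forall_of_forall_eventually 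
          (P := fun t u => ‖(Y i t u - Y j t u) - (Y i t0 u - Y j t0 u)‖ < ‖Y i t0 u - Y j t0 u‖) ?_
        intro u hu
        obtain ⟨hu0, hu1⟩ := hsph u hu
        refine ContinuousAt.eventually_lt ?_ ?_ ?_
        · exact (((hYat i t0 u hu0 hu1).sub (hYat j t0 u hu0 hu1)).sub ((hYat' i t0 t0 u hu0 hu1).sub (hYat' j t0 t0 u hu0 hu1))).norm
        · exact ((hYat' i t0 t0 u hu0 hu1).sub (hYat' j t0 t0 u hu0 hu1)).norm
        · simpa using hnz t0 u hu1 hu0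
      filter_upwards [hev] with t ht
      exact gpd_rouche (fun u => Y i t u - Y j t u) (fun u => Y i t0 u - Y j t0 u) ρ r hr0 hrρ 
        ((hYd i t).sub (hYd j t)) ((hYd i t0).sub (hYd j t0)) (fun u hu => hnz t u (by simpa using hu)) 
        (fun u hu => hnz t0 u (by simpa using hu)) ht
    intro t t'
    exact hloc.apply_eq_of_preconnectedSpace t t'
  have hcoin : ∀ i j t t', Y i t 0 = Y j t 0 → Y i t' 0 = Y j t' 0 := by
    intro i j t t' h
    have h0 : ∀ t, Y i t 0 = Y j t 0 ↔ analyticOrderAt (fun u => Y i t u - Y j t u) 0 ≠ 0 := by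
      intro t
      rw [AnalyticAt.analyticOrderAt_ne_zero ((hYa i t).fun_sub (hYa j t)), sub_eq_zero]
    rw [h0, ← hord i j t t', ← h0]
    exact h
  have hY0c : ∀ i, Continuous fun t => Y i t 0 := by
    intro i
    rw [continuous_iff_continuousAt]
    intro t0
    rw [Metric.continuousAt_iff']
    intro η hη
    have hev : ∀ᶠ t in nhds t0, ∀ u ∈ Metric.sphere (0:ℂ) r, ‖Y i t u - Y i t0 u‖ < η / 2 := by
      refine (isCompact_sphere (0:ℂ) r).eventually_forall_of_forall_eventually 
        (P := fun t u => ‖Y i t u - Y i t0 u‖ < η / 2) ?_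
      intro u hu
      obtain ⟨hu0, hu1⟩ := hsph u hu
      refine ContinuousAt.eventually_lt ((hYat i t0 u hu0 hu1).sub (hYat' i t0 t0 u hu0 hu1)).norm continuousAt_const ?_
      simpa using hη
    filter_upwards [hev] with t ht
    rw [dist_eq_norm]
    refine lt_of_le_of_lt ?_ (half_lt_self hη)
    refine Complex.norm_le_of_forall_mem_frontier_norm_le (f := fun u => Y i t u - Y i t0 u) (U := Metric.ball (0:ℂ) r) Metric.isBounded_ball ?_ ?_ (subset_closure (Metric.mem_ball_self hr0))
    · apply DifferentiableOn.diffContOnCl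
      rw [closure_ball _ hr0.ne']
      exact ((hYd i t).sub (hYd i t0)).mono (Metric.closedBall_subset_ball hrρ)
    · intro z hz
      rw [frontier_ball _ hr0.ne'] at hz
      exact (ht z hz).le
  have hp0 : ∀ t z, (Q t 0).eval z = (Q t 0).coeff d * ∏ i, (z - Y i t 0) := by
    intro t z
    have := hYp t 0 (by simpa using hρ) z
    rwa [hz] at this
  have hroots : ∀ t, (Q t 0).roots = Finset.univ.val.map (fun i => Y i t 0) := by
    intro t
    exact gpd_roots_eq d (Q t 0) (hlead t 0 (by simpa using hε)) _ (hp0 t)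
  have htf : ∀ t, (Q t 0).roots.toFinset = Finset.univ.image (fun i => Y i t 0) := by
    intro t
    rw [hroots]; rfl
  refine ⟨?_, ?_⟩
  · intro t t'
    rw [htf, htf]
    exact le_antisymm (gpd_card_image _ _ fun i j => hcoin i j t' t) (gpd_card_image _ _ fun i j => hcoin i j t t')
  intro θ hθ hroot
  have hex : ∀ t, ∃ l, θ t = Y l t 0 := by
    intro t
    have := (mem_roots (hne t 0 (by simpa using hε))).2 (hroot t)
    rw [hroots] at this
    obtain ⟨l, -, hl⟩ := Multiset.mem_map.1 this
    exact ⟨l, hl.symm⟩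
  obtain ⟨i0, hi0⟩ := hex 0
  have hsel : ∀ t, θ t = Y i0 t 0 := gpd_select (fun i t => Y i t 0) hY0c 
    (by rintro l l' ⟨x, hx⟩ y; exact hcoin l l' x y hx) θ hθ hex 0 i0 hi0
  -- the order
  set I : Finset (Fin d) := Finset.univ.filter (fun i => Y i 0 0 = Y i0 0 0) with hI
  have hIt : ∀ t i, i ∈ I ↔ Y i t 0 = θ t := by
    intro t i
    rw [hI, Finset.mem_filter, hsel t]
    simp only [Finset.mem_univ, true_and]
    exact ⟨hcoin _ _ _ _, hcoin _ _ _ _⟩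
  set M : ℕ∞ := ∑ i ∈ I, min (N:ℕ∞) (analyticOrderAt (fun u => Y i 0 u - Y (s i) 0 u) 0) with hM
  have hMt : ∀ t, M = ∑ i ∈ I, min (N:ℕ∞) (analyticOrderAt (fun u => Y i t u - Y i t 0) 0) := by
    intro t
    refine Finset.sum_congr rfl fun i _ => ?_
    rw [gpd_twist (fun u => Y i t u - Y i t 0) ((hYa i t).fun_sub analyticAt_const) (sub_self _) N ω hω hN]
    rw [hord i (s i) 0 t]
    congr 1
    apply analyticOrderAt_congr
    filter_upwards [Metric.ball_mem_nhds (0:ℂ) hρ] with u hu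
    rw [← hYs i t u (by simpa using hu)]
    ring
  -- substitution u^N
  set G : ℝ → ℂ → ℂ → ℂ → ℂ := fun t α β τ => ∑ k ∈ Finset.range (d+1), 
          (Q t τ).coeff k * (θ t + τ * α) ^ k * (1 + τ * β) ^ (d - k) with hG
  have hGd : ∀ t α β, Differentiable ℂ (G t α β) := by
    intro t α β
    refine Differentiable.fun_sum fun k _ => ?_
    exact ((hh t k).mul (by fun_prop)).mul (by fun_prop)
  have hGcomp : ∀ t α β, analyticOrderAt (fun u => G t α β (u ^ N)) 0 = analyticOrderAt (G t α β) 0 * N := by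
    intro t α β
    have := AnalyticAt.analyticOrderAt_comp (f := G t α β) (g := fun u : ℂ => u ^ N) (z₀ := 0) 
      ((hGd t α β).analyticAt _) (by fun_prop)
    rw [Function.comp_def] at this
    rw [this]
    simp only [hz, sub_zero]
    congr 1
    refine (AnalyticAt.analyticOrderAt_eq_natCast (by fun_prop)).2 ⟨fun _ => 1, by fun_prop, one_ne_zero, ?_⟩
    filter_upwards with z; simp
  have hGprod : ∀ t α β, analyticOrderAt (fun u => G t α β (u ^ N)) 0 = 
      ∑ i, analyticOrderAt (fun u => (θ t + u ^ N * α) - (1 + u ^ N * β) * Y i t u) 0 := by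
    intro t α β
    rw [← gpd_ord_prod Finset.univ (fun i u => (θ t + u ^ N * α) - (1 + u ^ N * β) * Y i t u) 
      (fun i => by have := hYa i t; fun_prop)]
    have e : (fun u => G t α β (u ^ N)) =ᶠ[nhds 0] (fun u => (Q t (u ^ N)).coeff d) * 
        (fun u => ∏ i, ((θ t + u ^ N * α) - (1 + u ^ N * β) * Y i t u)) := by
      have hb : ∀ᶠ u in nhds (0:ℂ), 1 + u ^ N * β ≠ 0 := by
        have : ContinuousAt (fun u : ℂ => 1 + u ^ N * β) 0 := by fun_prop
        refine this.eventually_ne ?_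
        simp [hN]
      filter_upwards [hb, Metric.ball_mem_nhds (0:ℂ) hρ] with u hu1 hu2
      have hu3 : ‖u‖ < ρ := by simpa using hu2
      exact gpd_homog_prod d _ (hd _ _ (hpow u hu3)) (fun i => Y i t u) (hYp t u hu3) _ _ hu1
    have hca : AnalyticAt ℂ (fun u : ℂ => (Q t (u ^ N)).coeff d) 0 := by
      have : Differentiable ℂ (fun u : ℂ => (Q t (u ^ N)).coeff d) := (hh t d).comp (f := fun u : ℂ => u ^ N) (by fun_prop)
      exact this.analyticAt _
    rw [analyticOrderAt_congr e, analyticOrderAt_mul hca 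
      (Finset.analyticAt_fun_prod _ fun i _ => by have := hYa i t; fun_prop)]
    rw [(hca.analyticOrderAt_eq_zero).2, zero_add]
    rw [hz]
    exact hlead t 0 (by simpa using hε)
  have hout : ∀ t α β i, i ∉ I → analyticOrderAt (fun u => (θ t + u ^ N * α) - (1 + u ^ N * β) * Y i t u) 0 = 0 := by
    intro t α β i hi
    have := hYa i t
    rw [AnalyticAt.analyticOrderAt_eq_zero (by fun_prop)]
    simp only [hz, zero_mul, add_zero, one_mul]
    exact sub_ne_zero.2 (fun h => hi ((hIt t i).2 h.symm))
  have hGI : ∀ t α β, analyticOrderAt (fun u => G t α β (u ^ N)) 0 = 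
      ∑ i ∈ I, analyticOrderAt (fun u => (θ t + u ^ N * α) - (1 + u ^ N * β) * Y i t u) 0 := by
    intro t α β
    rw [hGprod]
    symm
    apply Finset.sum_subset (Finset.subset_univ _)
    intro i _ hi
    exact hout t α β i hi
  have hge : ∀ t α β, M ≤ analyticOrderAt (fun u => G t α β (u ^ N)) 0 := by
    intro t α β
    rw [hGI, hMt t]
    refine Finset.sum_le_sum fun i hi => ?_
    rw [← (hIt t i).1 hi]
    exact gpd_fac_ge (Y i t) (hYa i t) N α β
  have heq : ∀ t, ∃ α : ℝ, analyticOrderAt (fun u => G t α 0 (u ^ N)) 0 = M := by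
    intro t
    choose a ha using fun i => gpd_fac_eq (Y i t) (hYa i t) N
    obtain ⟨α, hα⟩ := Infinite.exists_notMem_finset (insert 0 (Finset.univ.image fun i => (a i).re))
    simp only [Finset.mem_insert, Finset.mem_image, Finset.mem_univ, true_and, not_or, not_exists] at hα
    refine ⟨α, ?_⟩
    rw [hGI, hMt t]
    refine Finset.sum_congr rfl fun i hi => ?_
    rw [← (hIt t i).1 hi, ha i α (by exact_mod_cast hα.1)]
    · simp
    · intro h
      exact hα.2 i (by rw [← h]; simp)
  intro t t'
  refine ⟨?_, ?_⟩
  · have : ∀ t, (Q t 0).rootMultiplicity (θ t) = I.card := by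
      intro t
      rw [← count_roots, hroots, Multiset.count_map]
      have : I = Finset.univ.filter (fun i => θ t = Y i t 0) := by
        ext i; rw [hIt t i]; simp [eq_comm]
      rw [this]; rfl
    rw [this, this]
  · intro n α β hn
    obtain ⟨α', hα'⟩ := heq t'
    refine ⟨α', ?_⟩
    have h1 := hge t α β
    rw [← hα', hGcomp, hGcomp] at h1
    refine le_trans ?_ hn
    have hN1 : (N:ℕ∞) ≠ 0 := by exact_mod_cast hN
    exact (ENat.mul_le_mul_right_iff hN1 (ENat.coe_ne_top N)).1 h1

/-- homogeneous evaluation -/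
noncomputable def gpdH {R : Type*} [CommRing R] (d : ℕ) (p : R[X]) (u v : R) : R :=
  ∑ k ∈ Finset.range (d+1), p.coeff k * u ^ k * v ^ (d - k)

/-- polynomial along an affine line -/
noncomputable def gpdq {R : Type*} [CommRing R] (d : ℕ) (p : R[X]) (a b : Fin 2 → R) : R[X] :=
  ∑ k ∈ Finset.range (d+1), C (p.coeff k) * (C (a 0) * X + C (b 0)) ^ k * (C (a 1) * X + C (b 1)) ^ (d - k)

theorem gpdq_eval {R : Type*} [CommRing R] (d : ℕ) (p : R[X]) (a b : Fin 2 → R) (z : R) :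
    (gpdq d p a b).eval z = gpdH d p (a 0 * z + b 0) (a 1 * z + b 1) := by
  simp [gpdq, gpdH, eval_finsetSum]

theorem gpdq_aux {R : Type*} [CommRing R] (a0 b0 a1 b1 : R) (k l : ℕ) :
    ((C a0 * X + C b0) ^ k * (C a1 * X + C b1) ^ l).natDegree ≤ k + l ∧
    ((C a0 * X + C b0) ^ k * (C a1 * X + C b1) ^ l).coeff (k + l) = a0 ^ k * a1 ^ l := by
  have h0 : ∀ (a b : R) (k : ℕ), ((C a * X + C b) ^ k).natDegree ≤ k := by
    intro a b k
    refine (natDegree_pow_le_of_le k (natDegree_linear_le)).trans (by simp)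
  have h1 : ∀ (a b : R) (k : ℕ), ((C a * X + C b) ^ k).coeff k = a ^ k := by
    intro a b k
    have := coeff_pow_of_natDegree_le (p := C a * X + C b) (m := k) (n := 1) natDegree_linear_le
    simpa using this
  refine ⟨(natDegree_mul_le).trans (add_le_add (h0 _ _ _) (h0 _ _ _)), ?_⟩
  rw [coeff_mul_add_eq_of_natDegree_le (h0 _ _ _) (h0 _ _ _), h1, h1]

theorem gpdq_natDegree_le {R : Type*} [CommRing R] (d : ℕ) (p : R[X]) (a b : Fin 2 → R) :
    (gpdq d p a b).natDegree ≤ d := by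
  apply natDegree_sum_le_of_forall_le
  intro k hk
  have hk' : k ≤ d := Nat.lt_succ_iff.1 (Finset.mem_range.1 hk)
  rw [mul_assoc]
  refine natDegree_C_mul_le _ _ |>.trans ((gpdq_aux _ _ _ _ _ _).1.trans (by omega))

theorem gpdq_coeff {R : Type*} [CommRing R] (d : ℕ) (p : R[X]) (a b : Fin 2 → R) :
    (gpdq d p a b).coeff d = gpdH d p (a 0) (a 1) := by
  rw [gpdq, gpdH, finsetSum_coeff]
  refine Finset.sum_congr rfl fun k hk => ?_
  have hk' : k ≤ d := Nat.lt_succ_iff.1 (Finset.mem_range.1 hk)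
  rw [mul_assoc, coeff_C_mul, mul_assoc]
  congr 1
  have := (gpdq_aux (a 0) (b 0) (a 1) (b 1) k (d - k)).2
  rwa [Nat.add_sub_cancel' hk'] at this

theorem gpdq_coeff_sum {R : Type*} [CommRing R] (d : ℕ) (p : R[X]) (a b : Fin 2 → R) (j : ℕ) :
    (gpdq d p a b).coeff j = ∑ k ∈ Finset.range (d+1), p.coeff k * 
      ((C (a 0) * X + C (b 0)) ^ k * (C (a 1) * X + C (b 1)) ^ (d - k)).coeff j := by
  rw [gpdq, finsetSum_coeff]
  refine Finset.sum_congr rfl fun k hk => ?_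
  rw [mul_assoc, coeff_C_mul]

theorem gpdq_map {R S : Type*} [CommRing R] [CommRing S] (φ : R →+* S) (d : ℕ) (p : R[X]) (a b : Fin 2 → R) :
    (gpdq d p a b).map φ = gpdq d (p.map φ) (fun i => φ (a i)) (fun i => φ (b i)) := by
  simp [gpdq, Polynomial.map_sum]

theorem gpdH_map {R S : Type*} [CommRing R] [CommRing S] (φ : R →+* S) (d : ℕ) (p : R[X]) (u v : R) :
    φ (gpdH d p u v) = gpdH d (p.map φ) (φ u) (φ v) := by
  simp [gpdH]

theorem gpd_disc_map {R S : Type*} [CommRing R] [CommRing S] (φ : R →+* S) (d : ℕ) (p : R[X]) :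
    φ (discFixed d p) = discFixed d (p.map φ) := by
  unfold discFixed resFixed
  rw [map_mul, map_pow, map_neg, map_one, RingHom.map_det]
  congr 2
  ext i j
  simp only [RingHom.mapMatrix_apply, Matrix.map_apply, _root_.sylvester]
  have hQ : C (d : S) * p.map φ - X * (derivative p).map φ = (C (d : R) * p - X * derivative p).map φ := by
    simp [-derivative_map]
  rw [derivative_map, hQ]
  simp only [coeff_map]
  split_ifs <;> simp only [map_zero]

theorem gpd_res_zero (e : ℕ) (he : e ≠ 0) (P Q : ℂ[X]) (u v : ℂ) (huv : u ≠ 0 ∨ v ≠ 0) 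
    (h1 : gpdH e P u v = 0) (h2 : gpdH e Q u v = 0) : resFixed e e P Q = 0 := by
  have row : ∀ (P : ℂ[X]) (i : ℕ), i < e → gpdH e P u v = 0 → 
      ∑ j : Fin (e + e), (if i ≤ (j:ℕ) ∧ (j:ℕ) ≤ i + e then P.coeff (e + i - (j:ℕ)) else 0) * (u ^ (e + e - 1 - (j:ℕ)) * v ^ (j:ℕ)) = 0 := by
    intro P i hi h
    rw [Fin.sum_univ_eq_sum_range (fun j => (if i ≤ j ∧ j ≤ i + e then P.coeff (e + i - j) else 0) * (u ^ (e + e - 1 - j) * v ^ j))]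
    simp only [ite_mul, zero_mul]
    rw [← Finset.sum_filter]
    have : ∑ j ∈ (Finset.range (e+e)).filter (fun j => i ≤ j ∧ j ≤ i + e), P.coeff (e + i - j) * (u ^ (e + e - 1 - j) * v ^ j) 
      = u ^ (e - 1 - i) * v ^ i * gpdH e P u v := by
      rw [gpdH, Finset.mul_sum]
      symm
      refine Finset.sum_bij' (fun l _ => e + i - l) (fun j _ => e + i - j) ?_ ?_ ?_ ?_ ?_
      · intro l hl; simp only [Finset.mem_range, Finset.mem_filter] at *; omega
      · intro l hl; simp only [Finset.mem_range, Finset.mem_filter] at *; omega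
      · intro l hl; simp only [Finset.mem_range, Finset.mem_filter] at *; omega
      · intro l hl; simp only [Finset.mem_range, Finset.mem_filter] at *; omega
      · intro l hl
        simp only [Finset.mem_range] at hl
        have e1 : e + i - (e + i - l) = l := by omega
        have e2 : e + e - 1 - (e + i - l) = (e - 1 - i) + l := by omega
        have e3 : e + i - l = i + (e - l) := by omega
        rw [e1, e2, e3, pow_add, pow_add]
        ring
    rw [this, h, mul_zero]
  rw [resFixed, ← Matrix.exists_mulVec_eq_zero_iff]
  refine ⟨fun j => u ^ (e + e - 1 - (j:ℕ)) * v ^ (j:ℕ), ?_, ?_⟩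
  · intro h
    rcases huv with hu | hv
    · have := congrFun h ⟨0, by omega⟩
      simp [hu] at this
    · have := congrFun h ⟨e + e - 1, by omega⟩
      simp [hv] at this
  · funext i
    rw [Matrix.mulVec, dotProduct, Pi.zero_apply]
    simp only [_root_.sylvester]
    by_cases hi : (i:ℕ) < e
    · simp only [if_pos hi]
      exact row P i hi h1
    · simp only [if_neg hi]
      have := row Q ((i:ℕ) - e) (by omega) h2
      have e1 : (i:ℕ) - e + e = i := by omega
      rw [e1] at this
      exact this

theorem gpd_disc_sep (d : ℕ) (p : ℂ[X]) (a b : Fin 2 → ℂ) (hab : b 0 * a 1 - b 1 * a 0 ≠ 0)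
    (hD : discFixed d p ≠ 0) (ha : gpdH d p (a 0) (a 1) ≠ 0) :
    (gpdq d p a b).natDegree = d ∧ gpdq d p a b ≠ 0 ∧ (gpdq d p a b).roots.toFinset.card = d := by
  classical
  set q := gpdq d p a b with hq
  have hcoeff : q.coeff d ≠ 0 := by rw [hq, gpdq_coeff]; exact ha
  have hdeg : q.natDegree = d := natDegree_eq_of_le_of_coeff_ne_zero (gpdq_natDegree_le d p a b) hcoeff
  have hq0 : q ≠ 0 := by rintro h; rw [h] at hcoeff; simp at hcoeff
  refine ⟨hdeg, hq0, ?_⟩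
  have hcard : q.roots.card = d := by rw [← hdeg]; exact (IsAlgClosed.splits q).natDegree_eq_card_roots.symm
  suffices hnd : q.roots.Nodup by
    rw [Multiset.toFinset_card_of_nodup hnd, hcard]
  rw [Multiset.nodup_iff_count_le_one]
  intro z
  rcases Nat.lt_or_ge d 2 with hd2 | hd2
  · exact (Multiset.count_le_card _ _).trans (by omega)
  rw [count_roots]
  by_contra hcon
  push Not at hcon
  obtain ⟨h2, h1⟩ := (one_lt_rootMultiplicity_iff_isRoot hq0).1 hcon
  obtain ⟨e, rfl⟩ : ∃ e, d = e + 1 := ⟨d - 1, by omega⟩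
  set u := a 0 * z + b 0 with hu
  set v := a 1 * z + b 1 with hv
  have hF : gpdH (e+1) p u v = 0 := by rw [← gpdq_eval]; exact h2
  set FX := gpdH e (derivative p) u v with hFX
  set FY := gpdH e (C ((e+1 : ℕ):ℂ) * p - X * derivative p) u v with hFY
  have hcY : ∀ k : ℕ, (C ((e+1 : ℕ):ℂ) * p - X * derivative p).coeff k = ((e + 1 : ℕ) - k : ℂ) * p.coeff k := by
    intro k
    cases k with
    | zero => simp
    | succ k => 
      rw [coeff_sub, coeff_C_mul, coeff_X_mul, coeff_derivative]; push_cast; ring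
  have hEuler : ((e + 1 : ℕ) : ℂ) * gpdH (e+1) p u v = u * FX + v * FY := by
    have e1 : u * FX = ∑ k ∈ Finset.range (e+2), k * p.coeff k * u ^ k * v ^ (e + 1 - k) := by
      rw [Finset.sum_range_succ', hFX, gpdH, Finset.mul_sum]
      simp only [Nat.cast_zero, zero_mul, add_zero]
      refine Finset.sum_congr rfl fun k _ => ?_
      rw [coeff_derivative, Nat.add_sub_add_right]
      push_cast; ring
    have e2 : v * FY = ∑ k ∈ Finset.range (e+2), ((e + 1 : ℕ) - k : ℂ) * p.coeff k * u ^ k * v ^ (e + 1 - k) := by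
      rw [Finset.sum_range_succ, hFY, gpdH, Finset.mul_sum]
      simp only [sub_self, zero_mul, add_zero]
      refine Finset.sum_congr rfl fun k hk => ?_
      have : e + 1 - k = (e - k) + 1 := by have := Finset.mem_range.1 hk; omega
      rw [hcY, this, pow_succ]
      ring
    rw [e1, e2, ← Finset.sum_add_distrib, gpdH, Finset.mul_sum]
    refine Finset.sum_congr rfl fun k hk => ?_
    ring
  have hder : (derivative q).eval z = a 0 * FX + a 1 * FY := by
    have e1 : a 0 * FX = ∑ k ∈ Finset.range (e+2), k * p.coeff k * u ^ (k - 1) * v ^ (e + 1 - k) * a 0 := by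
      rw [Finset.sum_range_succ', hFX, gpdH, Finset.mul_sum]
      simp only [Nat.cast_zero, zero_mul, add_zero]
      refine Finset.sum_congr rfl fun k _ => ?_
      rw [coeff_derivative, show k + 1 - 1 = k by omega, show e + 1 - (k + 1) = e - k by omega]
      push_cast; ring
    have e2 : a 1 * FY = ∑ k ∈ Finset.range (e+2), ((e + 1 : ℕ) - k : ℂ) * p.coeff k * u ^ k * v ^ (e + 1 - k - 1) * a 1 := by
      rw [Finset.sum_range_succ, hFY, gpdH, Finset.mul_sum]
      simp only [sub_self, zero_mul, add_zero]
      refine Finset.sum_congr rfl fun k hk => ?_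
      have : e + 1 - k - 1 = (e - k) := by omega
      rw [hcY, this]
      ring
    rw [e1, e2, ← Finset.sum_add_distrib, hq, gpdq, derivative_sum, eval_finsetSum]
    refine Finset.sum_congr rfl fun k hk => ?_
    have hk' : k ≤ e + 1 := Nat.lt_succ_iff.1 (Finset.mem_range.1 hk)
    simp only [derivative_mul, derivative_C, zero_mul, zero_add, derivative_pow, derivative_add, derivative_X, mul_one, add_zero, eval_add, eval_mul, eval_pow, eval_C, eval_X, eval_natCast, map_natCast]
    rw [Nat.cast_sub hk']
    push_cast
    ring
  have hlin : a 0 * FX + a 1 * FY = 0 := by rw [← hder]; exact h1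
  rw [hF, mul_zero] at hEuler
  have hdet : u * a 1 - v * a 0 ≠ 0 := by
    have : u * a 1 - v * a 0 = b 0 * a 1 - b 1 * a 0 := by rw [hu, hv]; ring
    rwa [this]
  have hFX0 : FX = 0 := by
    have : (u * a 1 - v * a 0) * FX = 0 := by linear_combination -a 1 * hEuler - v * hlin
    exact (mul_eq_zero.1 this).resolve_left hdet
  have hFY0 : FY = 0 := by
    have : (u * a 1 - v * a 0) * FY = 0 := by linear_combination a 0 * hEuler + u * hlin
    exact (mul_eq_zero.1 this).resolve_left hdet
  apply hD
  rw [discFixed, gpd_res_zero (e + 1 - 1) (by omega) _ _ u v ?_ hFX0 hFY0, mul_zero]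
  by_contra h
  push Not at h
  apply hdet
  rw [h.1, h.2]; ring

/-- restriction to a line -/
noncomputable def gpdL {m : ℕ} (x v : Fin m → ℝ) : MvPolynomial (Fin m) ℝ →+* ℝ[X] :=
  MvPolynomial.eval₂Hom C (fun i => C (x i) + C (v i) * X)

/-- evaluation at a complex point of a line -/
noncomputable def gpdphi {m : ℕ} (x v : Fin m → ℝ) (τ : ℂ) : MvPolynomial (Fin m) ℝ →+* ℂ :=
  (Polynomial.evalRingHom τ).comp ((Polynomial.mapRingHom Complex.ofRealHom).comp (gpdL x v))

theorem gpdL_eval {m : ℕ} (x v : Fin m → ℝ) (τ : ℝ) :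
    (Polynomial.evalRingHom τ).comp (gpdL x v) = MvPolynomial.eval (x + τ • v) := by
  apply MvPolynomial.ringHom_ext
  · intro r; simp [gpdL]
  · intro i; simp [gpdL]; ring

theorem gpdL_eval' {m : ℕ} (x v : Fin m → ℝ) (τ : ℝ) (c : MvPolynomial (Fin m) ℝ) :
    (gpdL x v c).eval τ = MvPolynomial.eval (x + τ • v) c := by
  rw [← gpdL_eval]; rfl

theorem gpdphi_zero {m : ℕ} (x v : Fin m → ℝ) :
    gpdphi x v 0 = Complex.ofRealHom.comp (MvPolynomial.eval x) := by
  apply MvPolynomial.ringHom_ext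
  · intro r; simp [gpdphi, gpdL]
  · intro i; simp [gpdphi, gpdL]

theorem gpdphi_apply {m : ℕ} (x v : Fin m → ℝ) (τ : ℂ) (c : MvPolynomial (Fin m) ℝ) :
    gpdphi x v τ c = ((gpdL x v c).map Complex.ofRealHom).eval τ := rfl

theorem gpdL_cont {m : ℕ} (c : MvPolynomial (Fin m) ℝ) : ∀ j, 
    Continuous fun p : (Fin m → ℝ) × (Fin m → ℝ) => (gpdL p.1 p.2 c).coeff j := by
  induction c using MvPolynomial.induction_on with
  | C r => intro j; simp only [gpdL, MvPolynomial.eval₂Hom_C, coeff_C]; exact continuous_const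
  | add p q hp hq => intro j; simp only [map_add, coeff_add]; exact (hp j).add (hq j)
  | mul_X p i hp =>
    intro j
    have : ∀ x v : Fin m → ℝ, gpdL x v (p * MvPolynomial.X i) = gpdL x v p * C (x i) + gpdL x v p * C (v i) * X := by
      intro x v; rw [map_mul]; simp [gpdL]; ring
    simp only [this, coeff_add, coeff_mul_C]
    cases j with
    | zero => simp only [mul_coeff_zero, coeff_X_zero, mul_zero, add_zero]; exact (hp 0).mul (by fun_prop)
    | succ j => 
      simp only [coeff_mul_X, coeff_mul_C]
      exact ((hp (j+1)).mul (by fun_prop)).add ((hp j).mul (by fun_prop))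

theorem gpdL_deg {m : ℕ} (c : MvPolynomial (Fin m) ℝ) : ∃ B, ∀ x v, (gpdL x v c).natDegree ≤ B := by
  induction c using MvPolynomial.induction_on with
  | C r => exact ⟨0, fun x v => by simp [gpdL]⟩
  | add p q hp hq => 
    obtain ⟨B1, h1⟩ := hp
    obtain ⟨B2, h2⟩ := hq
    exact ⟨max B1 B2, fun x v => by rw [map_add]; exact (natDegree_add_le _ _).trans (max_le_max (h1 x v) (h2 x v))⟩
  | mul_X p i hp =>
    obtain ⟨B, h⟩ := hp
    refine ⟨B + 1, fun x v => ?_⟩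
    rw [map_mul]
    refine natDegree_mul_le.trans (add_le_add (h x v) ?_)
    simp only [gpdL, MvPolynomial.coe_eval₂Hom, MvPolynomial.eval₂_X]
    rw [add_comm]
    exact natDegree_linear_le

theorem gpdphi_cont {m : ℕ} (c : MvPolynomial (Fin m) ℝ) (v : Fin m → ℝ) :
    Continuous fun p : (Fin m → ℝ) × ℂ => gpdphi p.1 v p.2 c := by
  obtain ⟨B, hB⟩ := gpdL_deg c
  have : (fun p : (Fin m → ℝ) × ℂ => gpdphi p.1 v p.2 c) = fun p => ∑ j ∈ Finset.range (B+1), (((gpdL p.1 v c).coeff j : ℝ) : ℂ) * p.2 ^ j := by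
    funext p
    rw [gpdphi_apply, eval_eq_sum_range' (n := B + 1)]
    · simp
    · rw [natDegree_map]; exact Nat.lt_succ_of_le (hB _ _)
  rw [this]
  refine continuous_finsetSum _ fun j _ => ?_
  have h1 : Continuous fun p : (Fin m → ℝ) × ℂ => (p.1, v) := continuous_fst.prodMk continuous_const
  have h2 := (gpdL_cont c j).comp h1
  have h3 := Complex.continuous_ofReal.comp h2
  have h4 : Continuous fun p : (Fin m → ℝ) × ℂ => p.2 ^ j := continuous_snd.pow j
  exact h3.mul h4

theorem gpdphi_diff {m : ℕ} (c : MvPolynomial (Fin m) ℝ) (x v : Fin m → ℝ) :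
    Differentiable ℂ fun τ => gpdphi x v τ c := by
  simp only [gpdphi_apply]
  exact Polynomial.differentiable _

/-- the form along a line -/
noncomputable def gpdLF {m : ℕ} (d : ℕ) (P : Polynomial (MvPolynomial (Fin m) ℝ)) (x : Fin m → ℝ) (V : Fin 2 → ℝ) 
    (v : Fin m → ℝ) (Λ : Fin 2 → ℝ) : ℝ[X] :=
  gpdH d (P.map (gpdL x v)) (C (V 0) + C (Λ 0) * X) (C (V 1) + C (Λ 1) * X)

theorem gpdLF_eval {m : ℕ} (d : ℕ) (P : Polynomial (MvPolynomial (Fin m) ℝ)) (x : Fin m → ℝ) (V : Fin 2 → ℝ) 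
    (v : Fin m → ℝ) (Λ : Fin 2 → ℝ) (τ : ℝ) : 
    (gpdLF d P x V v Λ).eval τ = gpdH d (evalP P (x + τ • v)) (V 0 + τ * Λ 0) (V 1 + τ * Λ 1) := by
  have := gpdH_map (Polynomial.evalRingHom τ) d (P.map (gpdL x v)) (C (V 0) + C (Λ 0) * X) (C (V 1) + C (Λ 1) * X)
  rw [Polynomial.map_map, gpdL_eval] at this
  rw [gpdLF, ← Polynomial.coe_evalRingHom, this, evalP]
  simp only [map_add, map_mul, coe_evalRingHom, eval_C, eval_X, mul_comm τ]

theorem gpdLF_evalC {m : ℕ} (d : ℕ) (P : Polynomial (MvPolynomial (Fin m) ℝ)) (x : Fin m → ℝ) (V : Fin 2 → ℝ) 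
    (v : Fin m → ℝ) (Λ : Fin 2 → ℝ) (τ : ℂ) : 
    ((gpdLF d P x V v Λ).map Complex.ofRealHom).eval τ = gpdH d (P.map (gpdphi x v τ)) (V 0 + τ * Λ 0) (V 1 + τ * Λ 1) := by
  have := gpdH_map ((Polynomial.evalRingHom τ).comp (Polynomial.mapRingHom Complex.ofRealHom)) d (P.map (gpdL x v)) (C (V 0) + C (Λ 0) * X) (C (V 1) + C (Λ 1) * X)
  rw [Polynomial.map_map, RingHom.comp_assoc] at this
  change _ = gpdH d (P.map (gpdphi x v τ)) _ _ at this
  change ((Polynomial.evalRingHom τ).comp (Polynomial.mapRingHom Complex.ofRealHom)) (gpdLF d P x V v Λ) = _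
  rw [gpdLF, this]
  simp only [map_add, map_mul, RingHom.comp_apply, coe_mapRingHom, coe_evalRingHom, map_C, map_X, eval_C, eval_X, mul_comm τ, Complex.ofRealHom_eq_coe]

theorem gpd_poly_ord (p : ℝ[X]) (n : ℕ) : 
    analyticOrderAt (fun τ : ℂ => (p.map Complex.ofRealHom).eval τ) 0 ≤ n ↔ ∃ j ≤ n, p.coeff j ≠ 0 := by
  classical
  have han : AnalyticAt ℂ (fun τ : ℂ => (p.map Complex.ofRealHom).eval τ) 0 := (Polynomial.differentiable _).analyticAt _
  constructor
  · intro h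
    by_contra hcon
    push Not at hcon
    obtain ⟨q, hq⟩ := (X_pow_dvd_iff (n := n+1)).2 (fun j hj => hcon j (Nat.lt_succ_iff.1 hj))
    have : ((n + 1 : ℕ) : ℕ∞) ≤ analyticOrderAt (fun τ : ℂ => (p.map Complex.ofRealHom).eval τ) 0 := by
      rw [natCast_le_analyticOrderAt han]
      refine ⟨fun τ => (q.map Complex.ofRealHom).eval τ, (Polynomial.differentiable _).analyticAt _, ?_⟩
      filter_upwards with z
      rw [hq]; simp
    have h2 := this.trans h
    have h3 : n + 1 ≤ n := by exact_mod_cast h2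
    omega
  · intro h
    have hex : ∃ j, p.coeff j ≠ 0 := ⟨h.choose, h.choose_spec.2⟩
    set j := Nat.find hex with hj
    have hjn : j ≤ n := by
      obtain ⟨i, hi, hi'⟩ := h
      exact (Nat.find_min' hex hi').trans hi
    obtain ⟨q, hq⟩ := (X_pow_dvd_iff (n := j)).2 (fun i hi => not_not.1 (Nat.find_min hex hi))
    have : analyticOrderAt (fun τ : ℂ => (p.map Complex.ofRealHom).eval τ) 0 = j := by
      rw [han.analyticOrderAt_eq_natCast]
      refine ⟨fun τ => (q.map Complex.ofRealHom).eval τ, (Polynomial.differentiable _).analyticAt _, ?_, ?_⟩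
      · have : p.coeff j ≠ 0 := Nat.find_spec hex
        rw [hq, mul_comm, coeff_mul_X_pow'] at this
        simp only [le_refl, if_true, Nat.sub_self] at this
        simp only [← coeff_zero_eq_eval_zero, coeff_map]
        simpa using this
      · filter_upwards with z
        conv_lhs => rw [hq]
        simp
    rw [this]; exact_mod_cast hjn

theorem gpdH_smul {R : Type*} [CommRing R] (d : ℕ) (p : R[X]) (c u v : R) : 
    gpdH d p (c * u) (c * v) = c ^ d * gpdH d p u v := by
  rw [gpdH, gpdH, Finset.mul_sum]
  refine Finset.sum_congr rfl fun k hk => ?_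
  have hk' : k ≤ d := Nat.lt_succ_iff.1 (Finset.mem_range.1 hk)
  have : c ^ d = c ^ k * c ^ (d - k) := by rw [← pow_add, Nat.add_sub_cancel' hk']
  rw [this]; ring

theorem gpdH_one {R : Type*} [CommRing R] (d : ℕ) (p : R[X]) (hp : p.natDegree ≤ d) (z : R) : 
    gpdH d p z 1 = p.eval z := by
  rw [gpdH, eval_eq_sum_range' (Nat.lt_succ_of_le hp)]
  simp

theorem gpdH_basis {K : Type*} [Field K] (d : ℕ) (p : K[X]) (a b : Fin 2 → K) (A B : K) (hB : B ≠ 0) :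
    gpdH d p (a 0 * A + b 0 * B) (a 1 * A + b 1 * B) = gpdH d (gpdq d p a b) A B := by
  have h1 := gpdH_smul d p B (a 0 * (A / B) + b 0) (a 1 * (A / B) + b 1)
  have h2 := gpdH_smul d (gpdq d p a b) B (A / B) 1
  rw [gpdH_one _ _ (gpdq_natDegree_le d p a b), gpdq_eval, ← h1] at h2
  have e1 : B * (A / B) = A := by field_simp
  rw [e1, mul_one] at h2
  rw [h2]
  congr 1 <;> field_simp

theorem gpd_eps {m : ℕ} (f : (Fin m → ℝ) × ℂ → ℂ) (hf : Continuous f) (K : Set (Fin m → ℝ)) (hK : IsCompact K)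
    (h : ∀ x ∈ K, f (x, 0) ≠ 0) : ∃ ε > 0, ∀ x ∈ K, ∀ τ : ℂ, ‖τ‖ < ε → f (x, τ) ≠ 0 := by
  have h1 : ∀ᶠ τ in nhds (0 : ℂ), ∀ x ∈ K, f (x, τ) ≠ 0 := by
    apply hK.eventually_forall_of_forall_eventually
    intro x hx
    have hc : Continuous fun z : ℂ × (Fin m → ℝ) => f (z.2, z.1) := hf.comp continuous_swap
    exact hc.continuousAt.eventually_ne (h x hx)
  obtain ⟨ε, hε, h2⟩ := Metric.eventually_nhds_iff.1 h1
  exact ⟨ε, hε, fun x hx τ hτ => h2 (by simpa using hτ) x hx⟩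

theorem gpd_disc_factor {m : ℕ} (D : MvPolynomial (Fin m) ℝ) (v : Fin m → ℝ) (k : ℕ) :
    ∃ g : (Fin m → ℝ) × ℂ → ℂ, Continuous g ∧ (∀ x, g (x, 0) = ((gpdL x v D).coeff k : ℝ)) ∧
      ∀ x τ, (∀ j < k, (gpdL x v D).coeff j = 0) → gpdphi x v τ D = τ ^ k * g (x, τ) := by
  obtain ⟨B, hB⟩ := gpdL_deg D
  refine ⟨fun p => ∑ j ∈ Finset.range (B+1), (((gpdL p.1 v D).coeff (j+k) : ℝ) : ℂ) * p.2 ^ j, ?_, ?_, ?_⟩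
  · refine continuous_finsetSum _ fun j _ => ?_
    have h1 : Continuous fun p : (Fin m → ℝ) × ℂ => (p.1, v) := continuous_fst.prodMk continuous_const
    have h2 := (gpdL_cont D (j+k)).comp h1
    have h3 := Complex.continuous_ofReal.comp h2
    have h4 : Continuous fun p : (Fin m → ℝ) × ℂ => p.2 ^ j := continuous_snd.pow j
    exact h3.mul h4
  · intro x
    beta_reduce
    rw [Finset.sum_eq_single 0]
    · simp
    · intro j _ hj; simp [hj]
    · simp
  · intro x τ h
    rw [gpdphi_apply, eval_eq_sum_range' (n := k + (B + 1))]
    · rw [Finset.sum_range_add, Finset.sum_eq_zero, zero_add, Finset.mul_sum]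
      · refine Finset.sum_congr rfl fun j _ => ?_
        rw [coeff_map, pow_add, add_comm k j]
        simp only [Complex.ofRealHom_eq_coe]; ring
      · intro j hj
        rw [coeff_map, h j (Finset.mem_range.1 hj)]; simp
    · rw [natDegree_map]; exact lt_of_le_of_lt (hB _ _) (by omega)

theorem gpd_lf_basis {m : ℕ} (d : ℕ) (P : Polynomial (MvPolynomial (Fin m) ℝ)) (x v : Fin m → ℝ) (a b : Fin 2 → ℝ)
    (θ α β : ℝ) (n : ℕ) : 
    analyticOrderAt (fun τ : ℂ => ∑ k ∈ Finset.range (d+1), 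
          (gpdq d (P.map (gpdphi x v τ)) (fun i => (a i : ℂ)) (fun i => (b i : ℂ))).coeff k * ((θ:ℂ) + τ * α) ^ k * (1 + τ * β) ^ (d - k)) 0 ≤ n
    ↔ ∃ j ≤ n, (gpdLF d P x (fun i => θ * a i + b i) v (fun i => α * a i + β * b i)).coeff j ≠ 0 := by
  rw [← gpd_poly_ord]
  have : (fun τ : ℂ => ((gpdLF d P x (fun i => θ * a i + b i) v (fun i => α * a i + β * b i)).map Complex.ofRealHom).eval τ)
     =ᶠ[nhds 0] (fun τ : ℂ => ∑ k ∈ Finset.range (d+1), 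
          (gpdq d (P.map (gpdphi x v τ)) (fun i => (a i : ℂ)) (fun i => (b i : ℂ))).coeff k * ((θ:ℂ) + τ * α) ^ k * (1 + τ * β) ^ (d - k)) := by
    have hne : ∀ᶠ τ : ℂ in nhds 0, 1 + τ * (β:ℂ) ≠ 0 := by
      have hc : Continuous fun τ : ℂ => 1 + τ * (β:ℂ) := by fun_prop
      exact hc.continuousAt.eventually_ne (by simp)
    filter_upwards [hne] with τ hτ
    have := gpdH_basis d (P.map (gpdphi x v τ)) (fun i => (a i : ℂ)) (fun i => (b i : ℂ)) ((θ:ℂ) + τ * α) (1 + τ * β) hτ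
    rw [gpdLF_evalC]
    convert this using 1
    · simp only [gpdH]
      refine Finset.sum_congr rfl fun k _ => ?_
      push_cast
      ring_nf
    · rfl
  rw [analyticOrderAt_congr this]

theorem gpd_path {m : ℕ} (d : ℕ) (P : Polynomial (MvPolynomial (Fin m) ℝ)) (σ : ℝ → Fin m → ℝ) (hσ : Continuous σ)
    (hK : IsCompact (Set.range σ)) (v : Fin m → ℝ) (a b : Fin 2 → ℝ) (hab : b 0 * a 1 - b 1 * a 0 ≠ 0)
    (ha : ∀ t, gpdH d (evalP P (σ t)) (a 0) (a 1) ≠ 0) (k : ℕ) 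
    (hk : ∀ t, ∀ j < k, (gpdL (σ t) v (discFixed d P)).coeff j = 0)
    (hk' : ∀ t, (gpdL (σ t) v (discFixed d P)).coeff k ≠ 0) :
    (∀ t t', ((gpdq d (evalP P (σ t)) a b).map Complex.ofRealHom).roots.toFinset.card = 
      ((gpdq d (evalP P (σ t')) a b).map Complex.ofRealHom).roots.toFinset.card) ∧
    ∀ θ : ℝ → ℝ, Continuous θ → (∀ t, (gpdq d (evalP P (σ t)) a b).IsRoot (θ t)) → ∀ t t',
      (gpdq d (evalP P (σ t)) a b).rootMultiplicity (θ t) = (gpdq d (evalP P (σ t')) a b).rootMultiplicity (θ t') ∧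
      ∀ (n : ℕ) (α β : ℝ), 
        (∃ j ≤ n, (gpdLF d P (σ t) (fun i => θ t * a i + b i) v (fun i => α * a i + β * b i)).coeff j ≠ 0) →
        ∃ Λ : Fin 2 → ℝ, ∃ j ≤ n, (gpdLF d P (σ t') (fun i => θ t' * a i + b i) v Λ).coeff j ≠ 0 := by
  set a' : Fin 2 → ℂ := fun i => (a i : ℂ) with ha'
  set b' : Fin 2 → ℂ := fun i => (b i : ℂ) with hb'
  set Q : ℝ → ℂ → ℂ[X] := fun t τ => gpdq d (P.map (gpdphi (σ t) v τ)) a' b' with hQ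
  have hab' : b' 0 * a' 1 - b' 1 * a' 0 ≠ 0 := by
    simp only [ha', hb']; exact_mod_cast hab
  have hQ0 : ∀ t, Q t 0 = (gpdq d (evalP P (σ t)) a b).map Complex.ofRealHom := by
    intro t
    rw [gpdq_map, evalP, Polynomial.map_map, ← gpdphi_zero (σ t) v]
    rfl
  have hlc : Continuous fun p : (Fin m → ℝ) × ℂ => gpdH d (P.map (gpdphi p.1 v p.2)) (a' 0) (a' 1) := by
    simp only [gpdH, coeff_map]
    refine continuous_finsetSum _ fun j _ => ?_
    exact ((gpdphi_cont _ v).mul continuous_const).mul continuous_const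
  obtain ⟨ε1, hε1, h1⟩ := gpd_eps _ hlc _ hK (by
    rintro _ ⟨t, rfl⟩
    have := gpdH_map Complex.ofRealHom d (evalP P (σ t)) (a 0) (a 1)
    rw [evalP, Polynomial.map_map, ← gpdphi_zero (σ t) v] at this
    intro h0
    have h2 : Complex.ofRealHom (gpdH d (evalP P (σ t)) (a 0) (a 1)) = 0 := this.trans h0
    exact ha t (by simpa using h2))
  obtain ⟨g, hg, hg0, hgf⟩ := gpd_disc_factor (discFixed d P) v k
  obtain ⟨ε2, hε2, h2⟩ := gpd_eps g hg _ hK (by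
    rintro _ ⟨t, rfl⟩
    rw [hg0]; exact_mod_cast hk' t)
  have hd : ∀ t τ, ‖τ‖ < min ε1 ε2 → (Q t τ).coeff d ≠ 0 := by
    intro t τ hτ
    simp only [hQ]; rw [gpdq_coeff]
    exact h1 _ ⟨t, rfl⟩ τ (hτ.trans_le (min_le_left _ _))
  have core := gpd_core Q d (min ε1 ε2) (lt_min hε1 hε2) (by
      intro j
      simp only [hQ, gpdq_coeff_sum, coeff_map]
      refine continuous_finsetSum _ fun i _ => ?_
      refine Continuous.mul ?_ continuous_const
      exact (gpdphi_cont (P.coeff i) v).comp ((hσ.comp continuous_fst).prodMk continuous_snd)) (by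
      intro t j
      simp only [hQ, gpdq_coeff_sum, coeff_map]
      refine Differentiable.fun_sum fun i _ => ?_
      exact (gpdphi_diff _ _ _).mul (differentiable_const _)) 
      (fun t τ hτ => natDegree_eq_of_le_of_coeff_ne_zero (gpdq_natDegree_le _ _ _ _) (hd t τ hτ))
      (fun t τ hτ h0 => hd t τ hτ (by rw [h0]; simp)) (by
      intro t τ hτ0 hτ
      refine (gpd_disc_sep d _ a' b' hab' ?_ ?_).2.2
      · rw [← gpd_disc_map, hgf _ _ (hk t)]
        exact mul_ne_zero (pow_ne_zero _ hτ0) (h2 _ ⟨t, rfl⟩ τ (hτ.trans_le (min_le_right _ _)))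
      · exact h1 _ ⟨t, rfl⟩ τ (hτ.trans_le (min_le_left _ _)))
  obtain ⟨cA, cB⟩ := core
  refine ⟨fun t t' => by rw [← hQ0, ← hQ0]; exact cA t t', fun θ hθ hr t t' => ?_⟩
  obtain ⟨c1, c2⟩ := cB (fun t => (θ t : ℂ)) (Complex.continuous_ofReal.comp hθ) (by
    intro t; rw [hQ0]
    exact (hr t).map) t t'
  refine ⟨?_, ?_⟩
  · rw [eq_rootMultiplicity_map (f := Complex.ofRealHom) Complex.ofReal_injective, 
      eq_rootMultiplicity_map (f := Complex.ofRealHom) Complex.ofReal_injective, ← hQ0, ← hQ0]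
    exact c1
  · intro n α β h
    rw [← gpd_lf_basis] at h
    obtain ⟨α', h'⟩ := c2 n α β h
    refine ⟨fun i => α' * a i + 0 * b i, ?_⟩
    rw [← gpd_lf_basis]
    simpa [hQ] using h'

theorem gpd_homog_eval (d : ℕ) (p : ℝ[X]) (V : Fin 2 → ℝ) :
    MvPolynomial.eval V (homog d p) = gpdH d p (V 0) (V 1) := by
  simp [homog, gpdH]

theorem gpd_mv_contDiff {m : ℕ} (c : MvPolynomial (Fin m) ℝ) : 
    ContDiff ℝ ⊤ fun x : Fin m → ℝ => MvPolynomial.eval x c := by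
  induction c using MvPolynomial.induction_on with
  | C r => simp only [MvPolynomial.eval_C]; exact contDiff_const
  | add p q hp hq => simp only [map_add]; exact hp.add hq
  | mul_X p i hp => 
    simp only [map_mul, MvPolynomial.eval_X]
    exact hp.mul (contDiff_apply ℝ ℝ i)

theorem gpd_F_contDiff {m : ℕ} (d : ℕ) (P : Polynomial (MvPolynomial (Fin m) ℝ)) :
    ContDiff ℝ ⊤ fun p : (Fin m → ℝ) × (Fin 2 → ℝ) => MvPolynomial.eval p.2 (homog d (evalP P p.1)) := by
  simp only [gpd_homog_eval, gpdH, evalP, coeff_map]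
  refine ContDiff.sum fun k _ => ?_
  have h1 := (gpd_mv_contDiff (P.coeff k)).comp (contDiff_fst (𝕜 := ℝ) (E := Fin m → ℝ) (F := Fin 2 → ℝ) (n := ⊤))
  have h2 : ∀ i : Fin 2, ContDiff ℝ ⊤ fun p : (Fin m → ℝ) × (Fin 2 → ℝ) => p.2 i := fun i => 
    (contDiff_apply ℝ ℝ i).comp (contDiff_snd (𝕜 := ℝ) (E := Fin m → ℝ) (F := Fin 2 → ℝ) (n := ⊤))
  exact (h1.mul ((h2 0).pow k)).mul ((h2 1).pow (d-k))

theorem gpd_ordD {m : ℕ} (D : MvPolynomial (Fin m) ℝ) (x : Fin m → ℝ) (n : ℕ) :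
    ordAt (fun x => MvPolynomial.eval x D) x ≤ n ↔ ∃ j ≤ n, ∃ v, (gpdL x v D).coeff j ≠ 0 :=
  gpd_ord_le _ (gpd_mv_contDiff D) x (fun v => gpdL x v D) (fun w τ => gpdL_eval' x w τ D) n

/-- the form as a function -/
noncomputable def gpdF {m : ℕ} (d : ℕ) (P : Polynomial (MvPolynomial (Fin m) ℝ)) : (Fin m → ℝ) × (Fin 2 → ℝ) → ℝ :=
  fun p => MvPolynomial.eval p.2 (homog d (evalP P p.1))

theorem gpd_ordF {m : ℕ} (d : ℕ) (P : Polynomial (MvPolynomial (Fin m) ℝ)) (x : Fin m → ℝ) (V : Fin 2 → ℝ) (n : ℕ) :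
    ordAt (gpdF d P) (x, V) ≤ n ↔ 
      ∃ j ≤ n, ∃ w : (Fin m → ℝ) × (Fin 2 → ℝ), (gpdLF d P x V w.1 w.2).coeff j ≠ 0 :=
  gpd_ord_le _ (gpd_F_contDiff d P) (x, V) (fun w => gpdLF d P x V w.1 w.2) (fun w τ => by
    rw [gpdLF_eval]
    simp [gpd_homog_eval]) n

theorem gpd_enat {A B : ℕ∞} (h : ∀ n : ℕ, A ≤ n → B ≤ n) : B ≤ A := by
  induction A using ENat.recTopCoe with
  | top => exact le_top
  | coe a => exact h a le_rfl

theorem gpdLF_smul {m : ℕ} (d : ℕ) (P : Polynomial (MvPolynomial (Fin m) ℝ)) (x v : Fin m → ℝ) (V Λ : Fin 2 → ℝ) (c : ℝ) :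
    gpdLF d P x (c • V) v (c • Λ) = C (c ^ d) * gpdLF d P x V v Λ := by
  rw [gpdLF, gpdLF, map_pow, ← gpdH_smul]
  congr 1 <;> simp <;> ring

theorem gpd_ordF_smul_le {m : ℕ} (d : ℕ) (P : Polynomial (MvPolynomial (Fin m) ℝ)) (x : Fin m → ℝ) (V : Fin 2 → ℝ) (c : ℝ) (hc : c ≠ 0) :
    ordAt (gpdF d P) (x, c • V) ≤ ordAt (gpdF d P) (x, V) := by
  apply gpd_enat
  intro n
  rw [gpd_ordF, gpd_ordF]
  rintro ⟨j, hj, w, hw⟩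
  refine ⟨j, hj, (w.1, c • w.2), ?_⟩
  simp only
  rw [gpdLF_smul, coeff_C_mul]
  exact mul_ne_zero (pow_ne_zero _ hc) hw

theorem gpd_ordF_smul {m : ℕ} (d : ℕ) (P : Polynomial (MvPolynomial (Fin m) ℝ)) (x : Fin m → ℝ) (V : Fin 2 → ℝ) (c : ℝ) (hc : c ≠ 0) :
    ordAt (gpdF d P) (x, c • V) = ordAt (gpdF d P) (x, V) := by
  apply le_antisymm (gpd_ordF_smul_le d P x V c hc)
  have := gpd_ordF_smul_le d P x (c • V) c⁻¹ (inv_ne_zero hc)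
  rwa [smul_smul, inv_mul_cancel₀ hc, one_smul] at this

/-- density of good directions -/
theorem gpd_dense {m : ℕ} (d : ℕ) (P : Polynomial (MvPolynomial (Fin m) ℝ)) (x : Fin m → ℝ) (V : Fin 2 → ℝ)
    (v1 : Fin m → ℝ) (Λ : Fin 2 → ℝ) (j : ℕ) (h : (gpdLF d P x V v1 Λ).coeff j ≠ 0) (v0 : Fin m → ℝ) (K : Set (Fin m → ℝ))
    (hK : K ∈ nhds v0) : ∃ v ∈ K, (gpdLF d P x V v Λ).coeff j ≠ 0 := by
  let M : MvPolynomial (Fin m) ℝ →+* (ℝ[X])[X] := 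
    MvPolynomial.eval₂Hom (C.comp C) (fun i => C (C (x i)) + C (C (v0 i) + C (v1 i - v0 i) * X) * X)
  let G : (ℝ[X])[X] := gpdH d (P.map M) (C (C (V 0)) + C (C (Λ 0)) * X) (C (C (V 1)) + C (C (Λ 1)) * X)
  have hM : ∀ s : ℝ, (mapRingHom (evalRingHom s)).comp M = gpdL x (v0 + s • (v1 - v0)) := by
    intro s
    apply MvPolynomial.ringHom_ext
    · intro r; simp [M, gpdL]
    · intro i; simp [M, gpdL]; ring
  have hG : ∀ s : ℝ, G.map (evalRingHom s) = gpdLF d P x V (v0 + s • (v1 - v0)) Λ := by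
    intro s
    have := gpdH_map (mapRingHom (evalRingHom s)) d (P.map M) (C (C (V 0)) + C (C (Λ 0)) * X) (C (C (V 1)) + C (C (Λ 1)) * X)
    rw [Polynomial.map_map, hM] at this
    rw [← coe_mapRingHom, this, gpdLF]
    simp
  have hc : ∀ s : ℝ, (G.coeff j).eval s = (gpdLF d P x V (v0 + s • (v1 - v0)) Λ).coeff j := by
    intro s; rw [← hG, coeff_map]; rfl
  have hne : G.coeff j ≠ 0 := by
    intro h0
    have := hc 1
    rw [h0] at this
    simp only [eval_zero, one_smul, add_sub_cancel] at this
    exact h this.symm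
  have hcont : Continuous fun s : ℝ => v0 + s • (v1 - v0) := by fun_prop
  have hn : (fun s : ℝ => v0 + s • (v1 - v0)) ⁻¹' K ∈ nhds (0 : ℝ) := hcont.continuousAt (by simpa using hK)
  have hinf := infinite_of_mem_nhds (0 : ℝ) hn
  obtain ⟨s, hs, hs'⟩ := hinf.exists_notMem_finset (G.coeff j).roots.toFinset
  refine ⟨_, hs, ?_⟩
  rw [← hc]
  intro h0
  apply hs'
  simp [hne, h0]

theorem gpd_hasMult (d : ℕ) (p : ℝ[X]) (a b : Fin 2 → ℝ) (hab : b 0 * a 1 - b 1 * a 0 ≠ 0)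
    (hlead : gpdH d p (a 0) (a 1) ≠ 0) (θ c : ℝ) (hc : c ≠ 0) : 
    HasProjRootOfMult (homog d p) (fun i => c * (θ * a i + b i)) ((gpdq d p a b).rootMultiplicity θ) := by
  set q := gpdq d p a b with hq
  have hcoeff : q.coeff d ≠ 0 := by rw [hq, gpdq_coeff]; exact hlead
  have hdeg : q.natDegree = d := natDegree_eq_of_le_of_coeff_ne_zero (gpdq_natDegree_le d p a b) hcoeff
  have hq0 : q ≠ 0 := by rintro h; rw [h] at hcoeff; simp at hcoeff
  set μ := q.rootMultiplicity θ with hμ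
  obtain ⟨r, hr, hr'⟩ := exists_eq_pow_rootMultiplicity_mul_and_not_dvd q hq0 θ
  rw [← hμ] at hr
  have hrθ : r.eval θ ≠ 0 := fun h => hr' (dvd_iff_isRoot.2 h)
  have hr0 : r ≠ 0 := by rintro rfl; simp at hrθ
  have hdr : μ + r.natDegree = d := by
    rw [← hdeg]
    conv_rhs => rw [hr]
    rw [natDegree_mul (pow_ne_zero _ (X_sub_C_ne_zero θ)) hr0, natDegree_pow, natDegree_X_sub_C, mul_one]
  set e := r.natDegree with he
  set δ := a 0 * b 1 - a 1 * b 0 with hδ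
  have hδ0 : δ ≠ 0 := by intro h; apply hab; linarith
  let A : MvPolynomial (Fin 2) ℝ := MvPolynomial.C (b 1 / δ) * MvPolynomial.X 0 - MvPolynomial.C (b 0 / δ) * MvPolynomial.X 1
  let B : MvPolynomial (Fin 2) ℝ := MvPolynomial.C (a 0 / δ) * MvPolynomial.X 1 - MvPolynomial.C (a 1 / δ) * MvPolynomial.X 0
  have hA : ∀ V, MvPolynomial.eval V A = (b 1 * V 0 - b 0 * V 1) / δ := by intro V; simp [A]; ring
  have hB : ∀ V, MvPolynomial.eval V B = (a 0 * V 1 - a 1 * V 0) / δ := by intro V; simp [B]; ring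
  let G : MvPolynomial (Fin 2) ℝ := gpdH e (r.map MvPolynomial.C) A B
  have hG : ∀ V, MvPolynomial.eval V G = gpdH e r (MvPolynomial.eval V A) (MvPolynomial.eval V B) := by
    intro V
    have := gpdH_map (MvPolynomial.eval V) e (r.map MvPolynomial.C) A B
    rw [Polynomial.map_map] at this
    have hid : (MvPolynomial.eval V).comp (MvPolynomial.C : ℝ →+* MvPolynomial (Fin 2) ℝ) = RingHom.id ℝ := by
      ext; simp
    rw [hid, Polynomial.map_id] at this
    exact this
  clear_value G A B
  have hB0 : B ≠ 0 := by
    intro h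
    have h1 := hB b
    rw [h, ← hδ] at h1
    simp [hδ0] at h1
  have hLV : ∀ V : Fin 2 → ℝ, (θ * a 1 + b 1) * V 0 - (θ * a 0 + b 0) * V 1 = δ * ((b 1 * V 0 - b 0 * V 1) / δ - θ * ((a 0 * V 1 - a 1 * V 0) / δ)) := by
    intro V; field_simp; ring
  refine ⟨MvPolynomial.C ((c * δ)⁻¹ ^ μ) * G, ?_, ?_⟩
  · apply mul_left_cancel₀ hB0
    apply MvPolynomial.funext
    intro V
    obtain hBV | hBV := eq_or_ne (MvPolynomial.eval V B) 0
    · rw [map_mul, map_mul, hBV]; simp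
    rw [map_mul, map_mul]
    refine congrArg _ ?_
    have h1 := gpdH_basis d p a b (MvPolynomial.eval V A) (MvPolynomial.eval V B) hBV
    have e0 : a 0 * MvPolynomial.eval V A + b 0 * MvPolynomial.eval V B = V 0 := by
      rw [hA, hB]; field_simp; rw [hδ]; ring
    have e1 : a 1 * MvPolynomial.eval V A + b 1 * MvPolynomial.eval V B = V 1 := by
      rw [hA, hB]; field_simp; rw [hδ]; ring
    rw [e0, e1, ← hq] at h1
    rw [gpd_homog_eval, h1]
    simp only [map_mul, map_pow, map_sub, MvPolynomial.eval_C, MvPolynomial.eval_X, hG]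
    set α := MvPolynomial.eval V A with hα
    set β := MvPolynomial.eval V B with hβ
    have h2 := gpdH_smul d q β (α / β) 1
    have h3 := gpdH_smul e r β (α / β) 1
    rw [gpdH_one _ _ hdeg.le, mul_one, mul_div_cancel₀ _ hBV] at h2
    rw [gpdH_one _ _ he.ge, mul_one, mul_div_cancel₀ _ hBV] at h3
    rw [h2, h3]
    have h4 : q.eval (α / β) = (α / β - θ) ^ μ * r.eval (α / β) := by
      conv_lhs => rw [hr]
      simp
    have h5 : c * (θ * a 1 + b 1) * V 0 - c * (θ * a 0 + b 0) * V 1 = c * δ * (α - θ * β) := by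
      rw [hα, hβ, hA, hB, mul_assoc, mul_assoc, mul_assoc, ← hLV V]; ring
    rw [h5, h4, ← hdr, pow_add]
    have h6 : α - θ * β = β * (α / β - θ) := by field_simp
    rw [h6]
    have h7 : (c * δ) ^ μ * (c * δ)⁻¹ ^ μ = 1 := by
      rw [← mul_pow, mul_inv_cancel₀ (mul_ne_zero hc hδ0), one_pow]
    rw [mul_pow, mul_pow β]
    linear_combination (-(β ^ μ * (α / β - θ) ^ μ * β ^ e * eval (α / β) r)) * h7
  · rw [map_mul, hG, hA, hB, MvPolynomial.eval_C]
    have e1 : (b 1 * (c * (θ * a 0 + b 0)) - b 0 * (c * (θ * a 1 + b 1))) / δ = c * θ := by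
      rw [div_eq_iff hδ0, hδ]; ring
    have e2 : (a 0 * (c * (θ * a 1 + b 1)) - a 1 * (c * (θ * a 0 + b 0))) / δ = c * 1 := by
      rw [div_eq_iff hδ0, hδ]; ring
    rw [e1, e2, gpdH_smul, gpdH_one _ _ he.ge]
    exact mul_ne_zero (pow_ne_zero _ (inv_ne_zero (mul_ne_zero hc hδ0))) (mul_ne_zero (pow_ne_zero _ hc) hrθ)

theorem gpd_mult_unique (g : MvPolynomial (Fin 2) ℝ) (v : Fin 2 → ℝ) (hv : v ≠ 0) (m1 m2 : ℕ) 
    (h1 : HasProjRootOfMult g v m1) (h2 : HasProjRootOfMult g v m2) : m1 = m2 := by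
  have key : ∀ m1 m2, HasProjRootOfMult g v m1 → HasProjRootOfMult g v m2 → ¬ m1 < m2 := by
    rintro m1 m2 ⟨g1, e1, n1⟩ ⟨g2, e2, n2⟩ hlt
    set L : MvPolynomial (Fin 2) ℝ := MvPolynomial.C (v 1) * MvPolynomial.X 0 - MvPolynomial.C (v 0) * MvPolynomial.X 1 with hL
    have hLv : MvPolynomial.eval v L = 0 := by simp [hL]; ring
    have hL0 : L ≠ 0 := by
      intro h
      apply hv
      have h3 : MvPolynomial.eval ![v 1, -v 0] L = 0 := by rw [h]; simp
      simp [hL] at h3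
      have h4 : v 0 = 0 := by nlinarith [sq_nonneg (v 0), sq_nonneg (v 1)]
      have h5 : v 1 = 0 := by nlinarith [sq_nonneg (v 0), sq_nonneg (v 1)]
      ext i; fin_cases i <;> simp [h4, h5]
    obtain ⟨t, rfl⟩ := Nat.exists_eq_add_of_lt hlt
    have h3 : L ^ m1 * g1 = L ^ m1 * (L ^ (t+1) * g2) := by rw [← e1, e2]; ring
    have h4 := mul_left_cancel₀ (pow_ne_zero _ hL0) h3
    apply n1
    rw [h4]; simp [hLv]
  exact le_antisymm (not_lt.1 (key _ _ h2 h1)) (not_lt.1 (key _ _ h1 h2))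

theorem gpd_root_iff (d : ℕ) (p : ℝ[X]) (a b : Fin 2 → ℝ) (hab : b 0 * a 1 - b 1 * a 0 ≠ 0)
    (hlead : gpdH d p (a 0) (a 1) ≠ 0) (W : Fin 2 → ℝ) (hW : W ≠ 0) (h0 : gpdH d p (W 0) (W 1) = 0) :
    ∃ c θ : ℝ, c ≠ 0 ∧ W = (fun i => c * (θ * a i + b i)) ∧ (gpdq d p a b).IsRoot θ := by
  set δ := a 0 * b 1 - a 1 * b 0 with hδ
  have hδ0 : δ ≠ 0 := by intro h; apply hab; linarith
  set A := (b 1 * W 0 - b 0 * W 1) / δ with hA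
  set B := (a 0 * W 1 - a 1 * W 0) / δ with hB
  have e0 : a 0 * A + b 0 * B = W 0 := by rw [hA, hB]; field_simp; rw [hδ]; ring
  have e1 : a 1 * A + b 1 * B = W 1 := by rw [hA, hB]; field_simp; rw [hδ]; ring
  have hB0 : B ≠ 0 := by
    intro hB0
    rw [hB0] at e0 e1
    have hA0 : A ≠ 0 := by
      intro hA0
      apply hW
      ext i; fin_cases i
      · simp [← e0, hA0]
      · simp [← e1, hA0]
    have := gpdH_smul d p A (a 0) (a 1)
    rw [mul_comm A, mul_comm A, show a 0 * A = W 0 by linarith, show a 1 * A = W 1 by linarith, h0] at this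
    exact mul_ne_zero (pow_ne_zero _ hA0) hlead this.symm
  refine ⟨B, A / B, hB0, ?_, ?_⟩
  · ext i; fin_cases i
    · simp only [Fin.zero_eta, Fin.isValue]; rw [← e0]; field_simp
    · simp only [Fin.mk_one, Fin.isValue]; rw [← e1]; field_simp
  · have h1 := gpdH_basis d p a b A B hB0
    rw [e0, e1, h0] at h1
    have h2 := gpdH_smul d (gpdq d p a b) B (A / B) 1
    rw [gpdH_one _ _ (gpdq_natDegree_le d p a b), mul_one, mul_div_cancel₀ _ hB0, ← h1] at h2
    exact (mul_eq_zero.1 h2.symm).resolve_left (pow_ne_zero _ hB0)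

theorem gpd_mk_cont : Continuous fun v : {v : Fin 2 → ℝ // v ≠ 0} => (Projectivization.mk ℝ v.1 v.2 : RP1) :=
  continuous_quotient_mk'

/-- Veronese map -/
noncomputable def gpdVer (v : Fin 2 → ℝ) : ℝ × ℝ × ℝ := 
  (v 0 ^ 2 / (v 0 ^ 2 + v 1 ^ 2), v 0 * v 1 / (v 0 ^ 2 + v 1 ^ 2), v 1 ^ 2 / (v 0 ^ 2 + v 1 ^ 2))

theorem gpd_norm_pos (v : Fin 2 → ℝ) (hv : v ≠ 0) : v 0 ^ 2 + v 1 ^ 2 ≠ 0 := by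
  intro h
  apply hv
  have h4 : v 0 = 0 := by nlinarith [sq_nonneg (v 0), sq_nonneg (v 1)]
  have h5 : v 1 = 0 := by nlinarith [sq_nonneg (v 0), sq_nonneg (v 1)]
  ext i; fin_cases i <;> simp [h4, h5]

theorem gpd_t2 : T2Space RP1 := by
  have hwd : ∀ a b : {v : Fin 2 → ℝ // v ≠ 0}, (projectivizationSetoid ℝ (Fin 2 → ℝ)) a b → gpdVer a.1 = gpdVer b.1 := by
    rintro a b ⟨u, hu⟩
    have hu' : a.1 = (u : ℝ) • b.1 := hu.symm
    have hu0 : (u : ℝ) ≠ 0 := u.ne_zero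
    have hb := gpd_norm_pos b.1 b.2
    rw [hu']
    simp only [gpdVer, Pi.smul_apply, smul_eq_mul]
    have e : ((u:ℝ) * b.1 0) ^ 2 + ((u:ℝ) * b.1 1) ^ 2 = (u:ℝ)^2 * (b.1 0 ^ 2 + b.1 1 ^ 2) := by ring
    rw [e]
    ext
    · simp only; field_simp
    · simp only; field_simp
    · simp only; field_simp
  let f : RP1 → ℝ × ℝ × ℝ := Quotient.lift (fun v : {v : Fin 2 → ℝ // v ≠ 0} => gpdVer v.1) hwd
  have hf : Continuous f := by
    refine Continuous.quotient_lift (s := projectivizationSetoid ℝ (Fin 2 → ℝ)) ?_ hwd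
    unfold gpdVer
    have h0 : ∀ i : Fin 2, Continuous fun v : {v : Fin 2 → ℝ // v ≠ 0} => v.1 i := fun i => 
      (continuous_apply i).comp continuous_subtype_val
    have hn : ∀ v : {v : Fin 2 → ℝ // v ≠ 0}, v.1 0 ^ 2 + v.1 1 ^ 2 ≠ 0 := fun v => gpd_norm_pos v.1 v.2
    have hd := ((h0 0).pow 2).add ((h0 1).pow 2)
    exact (((h0 0).pow 2).div hd hn).prodMk ((((h0 0).mul (h0 1)).div hd hn).prodMk (((h0 1).pow 2).div hd hn))
  have hinj : Function.Injective f := by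
    intro y z
    induction y using Projectivization.ind with
    | h v hv => 
    induction z using Projectivization.ind with
    | h w hw =>
    intro h
    have h' : gpdVer v = gpdVer w := h
    simp only [gpdVer, Prod.mk.injEq] at h'
    obtain ⟨h1, h2, h3⟩ := h'
    have nv := gpd_norm_pos v hv
    have nw := gpd_norm_pos w hw
    rw [div_eq_div_iff nv nw] at h1 h2 h3
    rw [Projectivization.mk_eq_mk_iff']
    refine ⟨(v 0 * w 0 + v 1 * w 1) / (w 0 ^ 2 + w 1 ^ 2), ?_⟩
    ext i
    rw [Pi.smul_apply, smul_eq_mul, div_mul_eq_mul_div, div_eq_iff nw]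
    have hdet : v 0 * w 1 = v 1 * w 0 := by
      have : (v 0 * w 1 - v 1 * w 0) ^ 2 * ((v 0 ^ 2 + v 1 ^ 2) * (w 0 ^ 2 + w 1 ^ 2)) = 0 := by
        have i1 : v 0 ^ 2 * w 1 ^ 2 = v 1 ^ 2 * w 0 ^ 2 := by nlinarith
        have i2 : (v 0 * w 1 - v 1 * w 0) * (v 0 * w 1 + v 1 * w 0) = 0 := by linarith
        rcases mul_eq_zero.1 i2 with h | h
        · rw [h]; ring
        · have e1 : v 1 * w 0 = - (v 0 * w 1) := by linarith
          have e2 : v 0 * v 1 * w 0 ^2 + v 0 * v 1 * w 1 ^ 2 = w 0 * w 1 * v 0 ^2 + w 0 * w 1 * v 1 ^ 2 := by linarith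
          have e3 : v 0 * w 0 * (v 1 * w 0) + v 1 * w 1 * (v 0 * w 1)  = v 0 * w 0 * (v 0 * w 1) + v 1 * w 1 * (v 1 * w 0) := by linarith
          rw [e1] at e3
          have e4 : (v 0 * w 1) * (v 0 * w 0 - v 1 * w 1) = 0 := by linarith
          rcases mul_eq_zero.1 e4 with h5 | h5
          · rw [e1, h5]; ring
          · have e5 : v 0 * w 1 * (v 1 * w 1) = v 0 * w 1 * (v 0 * w 0) := by rw [show v 0 * w 0 = v 1 * w 1 by linarith]
            have e6 : v 0 * v 1 * (w 0 ^ 2 + w 1 ^ 2) = w 0 * w 1 * (v 0 ^ 2 + v 1 ^ 2) := h2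
            have e7 : v 0 * w 1 = 0 := by
              have k1 : (v 0 * w 1) ^ 2 = 0 := by
                have : (v 0 * w 1) * (v 1 * w 0) = (v 0 * w 0) * (v 1 * w 1) := by ring
                rw [e1, show v 1 * w 1 = v 0 * w 0 by linarith] at this
                nlinarith [sq_nonneg (v 0 * w 1), sq_nonneg (v 0 * w 0)]
              exact pow_eq_zero_iff (two_ne_zero) |>.1 k1
            rw [e1, e7]; ring
      have := (mul_eq_zero.1 this).resolve_right (mul_ne_zero nv nw)
      have := pow_eq_zero_iff (two_ne_zero) |>.1 this
      linarith
    fin_cases i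
    · simp only [Fin.zero_eta, Fin.isValue]; linear_combination (-w 1) * hdet
    · simp only [Fin.mk_one, Fin.isValue]; linear_combination (w 0) * hdet
  exact T2Space.of_injective_continuous hinj hf

theorem gpd_lpc {m : ℕ} (S : Set (Fin m → ℝ)) (hS : IsAnalyticSubmanifold S) : LocallyPathConnectedSpace S := by
  constructor
  intro x
  rw [Filter.hasBasis_self]
  intro N hN
  obtain ⟨U, V, φ, ψ, L, hU, hV, hxU, hφ, hψ, hφm, hψm, hψφ, hφψ, him⟩ := hS x.1 x.2
  have hmap : ∀ z ∈ V, z ∈ L → ψ z ∈ S := by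
    intro z hz hzL
    have : z ∈ φ '' (U ∩ S) := by rw [him]; exact ⟨hz, hzL⟩
    obtain ⟨u, ⟨huU, huS⟩, rfl⟩ := this
    have := hψφ huU
    simp only [Function.comp_apply, id] at this
    rwa [this]
  have hφL : ∀ u ∈ U, u ∈ S → φ u ∈ L := by
    intro u hu huS
    have : φ u ∈ V ∩ (L : Set (Fin m → ℝ)) := by rw [← him]; exact ⟨u, ⟨hu, huS⟩, rfl⟩
    exact this.2
  rw [nhds_subtype, Filter.mem_comap] at hN
  obtain ⟨N', hN', hNN⟩ := hN
  have hψx : ψ (φ x.1) = x.1 := hψφ hxU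
  have hVn : V ∈ nhds (φ x.1) := hV.mem_nhds (hφm hxU)
  have hpre : ψ ⁻¹' N' ∈ nhds (φ x.1) := (hψ _ (hφm hxU)).continuousAt (by rw [hψx]; exact hN')
  obtain ⟨r, hr, hball⟩ := Metric.mem_nhds_iff.1 (Filter.inter_mem hVn hpre)
  set B := Metric.ball (φ x.1) r ∩ (L : Set (Fin m → ℝ)) with hB
  have hBc : Convex ℝ B := (convex_ball _ _).inter L.convex
  have hBp : IsPathConnected B := hBc.isPathConnected ⟨φ x.1, Metric.mem_ball_self hr, hφL _ hxU x.2⟩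
  have hBV : B ⊆ V := fun z hz => (hball hz.1).1
  have hψc : ContinuousOn ψ B := fun z hz => (hψ z (hBV hz)).continuousAt.continuousWithinAt
  have himg : IsPathConnected (ψ '' B) := hBp.image' hψc
  have hsub : ψ '' B ⊆ S := by
    rintro _ ⟨z, hz, rfl⟩; exact hmap z (hBV hz) hz.2
  refine ⟨Subtype.val ⁻¹' (ψ '' B), ?_, ?_, ?_⟩
  · rw [nhds_subtype, Filter.mem_comap]
    refine ⟨U ∩ φ ⁻¹' (Metric.ball (φ x.1) r), Filter.inter_mem (hU.mem_nhds hxU) ((hφ _ hxU).continuousAt (Metric.ball_mem_nhds _ hr)), ?_⟩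
    rintro y ⟨hyU, hyb⟩
    exact ⟨φ y.1, ⟨hyb, hφL _ hyU y.2⟩, hψφ hyU⟩
  · exact himg.preimage_coe hsub
  · rintro y ⟨z, hz, hzy⟩
    apply hNN
    have := (hball hz.1).2
    simp only [Set.mem_preimage] at this ⊢
    rwa [hzy] at this

theorem gpd_real_sections_on {X : Type*} [TopologicalSpace X] (q : X → ℝ[X]) (d : ℕ) (W : Set X) (hW : IsOpen W)
    (hc : ∀ k, Continuous fun x => (q x).coeff k) (hd : ∀ x ∈ W, (q x).natDegree = d)
    (hne : ∀ x ∈ W, q x ≠ 0) (x0 : X) (hx0 : x0 ∈ W) 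
    (hl : ∀ x ∈ W, ((q x).map Complex.ofRealHom).roots.toFinset.card = ((q x0).map Complex.ofRealHom).roots.toFinset.card) :
    ∃ U : Set X, IsOpen U ∧ x0 ∈ U ∧ U ⊆ W ∧ ∃ (k : ℕ) (θ : Fin k → X → ℝ), (∀ i, ContinuousOn (θ i) U) ∧
      (∀ x ∈ U, Function.Injective fun i => θ i x) ∧ 
      (∀ x ∈ U, ∀ y, (q x).IsRoot y ↔ ∃ i, θ i x = y) := by
  classical
  obtain ⟨U, hU, hxU, k, θ, h1, h2, h3⟩ := gpd_real_sections (X := W) (fun x => q x.1) d _ 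
    (fun k => (hc k).comp continuous_subtype_val) (fun x => hd x.1 x.2) (fun x => hne x.1 x.2) (fun x => hl x.1 x.2) ⟨x0, hx0⟩
  have hval : ∀ i (x : W), (fun x => if h : x ∈ W then θ i ⟨x, h⟩ else 0) x.1 = θ i x := by
    intro i x; simp
  refine ⟨Subtype.val '' U, hW.isOpenMap_subtype_val U hU, ⟨_, hxU, rfl⟩, by rintro _ ⟨u, _, rfl⟩; exact u.2, k, 
    fun i x => if h : x ∈ W then θ i ⟨x, h⟩ else 0, ?_, ?_, ?_⟩
  · intro i
    rintro _ ⟨u, hu, rfl⟩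
    apply ContinuousAt.continuousWithinAt
    have hat : ContinuousAt (θ i) u := (h1 i).continuousAt (hU.mem_nhds hu)
    rw [← hW.isOpenEmbedding_subtypeVal.continuousAt_iff]
    refine hat.congr ?_
    filter_upwards with x
    exact (hval i x).symm
  · rintro _ ⟨u, hu, rfl⟩
    simp only [Subtype.coe_prop, dif_pos, Subtype.coe_eta]
    exact h2 u hu
  · rintro _ ⟨u, hu, rfl⟩ y
    simp only [Subtype.coe_prop, dif_pos, Subtype.coe_eta]
    exact h3 u hu y

/-- good data at a point of a section -/
def gpdGood {m : ℕ} (d : ℕ) (P : Polynomial (MvPolynomial (Fin m) ℝ)) (x : Fin m → ℝ) (y : RP1) (μ : ℕ × ℕ∞) : Prop :=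
  ∀ (v : Fin 2 → ℝ) (hv : v ≠ 0), y = Projectivization.mk ℝ v hv → 
    HasProjRootOfMult (homog d (evalP P x)) v μ.1 ∧ ordAt (gpdF d P) (x, v) = μ.2

/-- root relation -/
def gpdR {m : ℕ} (d : ℕ) (P : Polynomial (MvPolynomial (Fin m) ℝ)) (x : Fin m → ℝ) (y : RP1) : Prop :=
  ∃ (v : Fin 2 → ℝ) (hv : v ≠ 0), Projectivization.mk ℝ v hv = y ∧ gpdH d (evalP P x) (v 0) (v 1) = 0

theorem gpd_evalP_cont {m : ℕ} (P : Polynomial (MvPolynomial (Fin m) ℝ)) (k : ℕ) : 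
    Continuous fun x : Fin m → ℝ => (evalP P x).coeff k := by
  simp only [evalP, coeff_map]
  exact (gpd_mv_contDiff (P.coeff k)).continuous

theorem gpd_discord {m : ℕ} (D : MvPolynomial (Fin m) ℝ) (hD : D ≠ 0) (S : Set (Fin m → ℝ))
    (hinv : OrderInvariantOn (fun x => MvPolynomial.eval x D) S) (x0 : Fin m → ℝ) (hx0 : x0 ∈ S) :
    ∃ (k : ℕ) (v0 : Fin m → ℝ), (gpdL x0 v0 D).coeff k ≠ 0 ∧ ∀ x ∈ S, ∀ v, ∀ j < k, (gpdL x v D).coeff j = 0 := by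
  classical
  have hex : ∃ k, ∃ v, (gpdL x0 v D).coeff k ≠ 0 := by
    have : ∃ y, MvPolynomial.eval y D ≠ 0 := by
      by_contra hcon
      push Not at hcon
      exact hD (MvPolynomial.funext fun y => by rw [hcon y]; simp)
    obtain ⟨y, hy⟩ := this
    have h1 := gpdL_eval' x0 (y - x0) 1 D
    rw [one_smul, add_sub_cancel] at h1
    have h2 : gpdL x0 (y - x0) D ≠ 0 := by
      intro h; rw [h] at h1; simp at h1; exact hy h1.symm
    exact ⟨_, y - x0, leadingCoeff_ne_zero.2 h2⟩
  obtain ⟨v0, hv0⟩ := Nat.find_spec hex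
  refine ⟨Nat.find hex, v0, hv0, fun x hx v j hj => ?_⟩
  by_contra hne
  have h1 : ordAt (fun x => MvPolynomial.eval x D) x ≤ j := (gpd_ordD D x j).2 ⟨j, le_rfl, v, hne⟩
  rw [hinv x hx x0 hx0, gpd_ordD] at h1
  obtain ⟨i, hi, w, hw⟩ := h1
  exact Nat.find_min hex (lt_of_le_of_lt hi hj) ⟨w, hw⟩

/-- a path as a map of the line -/
theorem gpd_joined {X : Type*} [TopologicalSpace X] (W : Set X) (x y : X) (h : JoinedIn W x y) : 
    ∃ σ : ℝ → X, Continuous σ ∧ IsCompact (Set.range σ) ∧ (∀ t, σ t ∈ W) ∧ σ 0 = x ∧ σ 1 = y := by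
  obtain ⟨γ, hγ⟩ := h
  refine ⟨γ.extend, γ.continuous_extend, ?_, ?_, γ.extend_zero, γ.extend_one⟩
  · rw [γ.extend_range]; exact isCompact_range γ.continuous
  · intro t
    have : γ.extend t ∈ Set.range γ := by rw [← γ.extend_range]; exact ⟨t, rfl⟩
    obtain ⟨s, hs⟩ := this
    rw [← hs]; exact hγ s

theorem gpd_mk_ne (a b : Fin 2 → ℝ) (hab : b 0 * a 1 - b 1 * a 0 ≠ 0) (θ : ℝ) : (fun i => θ * a i + b i) ≠ 0 := by
  intro h
  have h0 := congrFun h 0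
  have h1 := congrFun h 1
  simp only [Pi.zero_apply] at h0 h1
  apply hab
  linear_combination a 1 * h0 - a 0 * h1

theorem gpd_local {m : ℕ} (d : ℕ) (P : Polynomial (MvPolynomial (Fin m) ℝ)) (hdeg : P.natDegree = d)
    (S : Set (Fin m → ℝ)) [LocallyPathConnectedSpace S]
    (hnn : ∀ x ∈ S, evalP P x ≠ 0)
    (hd0 : discFixed d P ≠ 0)
    (hdinv : OrderInvariantOn (fun x => MvPolynomial.eval x (discFixed d P)) S) (x0 : S) :
    ∃ W : Set S, IsOpen W ∧ x0 ∈ W ∧ ∃ (k : ℕ) (Θ : Fin k → S → RP1), (∀ l, ContinuousOn (Θ l) W) ∧ 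
      (∀ x ∈ W, Function.Injective fun l => Θ l x) ∧ (∀ x ∈ W, ∀ y, gpdR d P x.1 y ↔ ∃ l, Θ l x = y) ∧
      ∀ l, ∃ μ : ℕ × ℕ∞, 0 < μ.1 ∧ ∀ x ∈ W, gpdGood d P x.1 (Θ l x) μ := by
  -- choice of the frame
  obtain ⟨z, hz⟩ : ∃ z, (evalP P x0.1).eval z ≠ 0 := by
    by_contra hcon
    push Not at hcon
    exact hnn _ x0.2 (Polynomial.funext fun z => by rw [hcon z]; simp)
  set a : Fin 2 → ℝ := ![z, 1] with ha
  set b : Fin 2 → ℝ := ![1, 0] with hb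
  have hab : b 0 * a 1 - b 1 * a 0 ≠ 0 := by simp [ha, hb]
  have hlead0 : gpdH d (evalP P x0.1) (a 0) (a 1) ≠ 0 := by
    have : gpdH d (evalP P x0.1) z 1 ≠ 0 := by
      rw [gpdH_one d (evalP P x0.1) (natDegree_map_le.trans hdeg.le)]; exact hz
    simpa [ha] using this
  clear_value a b
  obtain ⟨k, v0, hkv, hlow⟩ := gpd_discord _ hd0 S hdinv x0.1 x0.2
  -- neighbourhoods
  have hnb : ∀ᶠ p : (Fin m → ℝ) × (Fin m → ℝ) in nhds (x0.1, v0), (gpdL p.1 p.2 (discFixed d P)).coeff k ≠ 0 :=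
    (gpdL_cont (discFixed d P) k).continuousAt.eventually_ne hkv
  rw [nhds_prod_eq, Filter.eventually_prod_iff] at hnb
  obtain ⟨pN, hN, pK, hK, hNK⟩ := hnb
  have hleadc : Continuous fun x : Fin m → ℝ => gpdH d (evalP P x) (a 0) (a 1) := by
    simp only [gpdH]
    exact continuous_finsetSum _ fun j _ => ((gpd_evalP_cont P j).mul continuous_const).mul continuous_const
  have hlead1 : ∀ᶠ x in nhds x0.1, gpdH d (evalP P x) (a 0) (a 1) ≠ 0 := hleadc.continuousAt.eventually_ne hlead0
  have hO : {x : S | pN x.1 ∧ gpdH d (evalP P x.1) (a 0) (a 1) ≠ 0} ∈ nhds x0 :=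
    continuous_subtype_val.continuousAt (hN.and hlead1)
  obtain ⟨W0, ⟨hW0o, hx0W0, hW0p⟩, hW0O⟩ := (isOpen_isPathConnected_basis x0).mem_iff.1 hO
  simp only [id] at hW0O
  -- the path lemma
  have path : ∀ σ : ℝ → S, Continuous σ → IsCompact (Set.range σ) → (∀ t, σ t ∈ W0) → ∀ v, pK v → 
    (∀ t t', ((gpdq d (evalP P (σ t)) a b).map Complex.ofRealHom).roots.toFinset.card = 
      ((gpdq d (evalP P (σ t')) a b).map Complex.ofRealHom).roots.toFinset.card) ∧
    ∀ θ : ℝ → ℝ, Continuous θ → (∀ t, (gpdq d (evalP P (σ t)) a b).IsRoot (θ t)) → ∀ t t',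
      (gpdq d (evalP P (σ t)) a b).rootMultiplicity (θ t) = (gpdq d (evalP P (σ t')) a b).rootMultiplicity (θ t') ∧
      ∀ (n : ℕ) (α β : ℝ), 
        (∃ j ≤ n, (gpdLF d P (σ t) (fun i => θ t * a i + b i) v (fun i => α * a i + β * b i)).coeff j ≠ 0) →
        ∃ Λ : Fin 2 → ℝ, ∃ j ≤ n, (gpdLF d P (σ t') (fun i => θ t' * a i + b i) v Λ).coeff j ≠ 0 := by
    intro σ hσ hσc hσW v hv
    refine gpd_path d P (fun t => (σ t).1) (continuous_subtype_val.comp hσ) ?_ v a b hab (fun t => (hW0O (hσW t)).2) k 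
      (fun t j hj => hlow _ (σ t).2 v j hj) (fun t => hNK (hW0O (hσW t)).1 hv)
    have := hσc.image continuous_subtype_val
    rwa [← Set.range_comp] at this
  have hv0K : pK v0 := hK.self_of_nhds
  have hcoeff : ∀ x ∈ W0, (gpdq d (evalP P x.1) a b).coeff d ≠ 0 := by
    intro x hx; rw [gpdq_coeff]; exact (hW0O hx).2
  obtain ⟨U, hUo, hxU, hUW, κ, θ, hθc, hθi, hθr⟩ := gpd_real_sections_on (fun x : S => gpdq d (evalP P x.1) a b) d W0 hW0o (by
      intro j
      simp only [gpdq_coeff_sum]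
      exact continuous_finsetSum _ fun i _ => ((gpd_evalP_cont P i).comp continuous_subtype_val).mul continuous_const)
    (fun x hx => natDegree_eq_of_le_of_coeff_ne_zero (gpdq_natDegree_le _ _ _ _) (hcoeff x hx))
    (fun x hx h0 => hcoeff x hx (by rw [h0]; simp)) x0 hx0W0 (by
      intro x hx
      obtain ⟨σ, h1, h2, h3, h4, h5⟩ := gpd_joined W0 x x0 (hW0p.joinedIn x hx x0 hx0W0)
      have := (path σ h1 h2 h3 v0 hv0K).1 0 1
      rwa [h4, h5] at this)
  obtain ⟨W, ⟨hWo, hx0W, hWp⟩, hWU⟩ := (isOpen_isPathConnected_basis x0).mem_iff.1 (hUo.mem_nhds hxU)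
  simp only [id] at hWU
  have hWW0 : W ⊆ W0 := hWU.trans hUW
  have hroot : ∀ l, ∀ x ∈ U, (gpdq d (evalP P x.1) a b).IsRoot (θ l x) := fun l x hx => (hθr x hx _).2 ⟨l, rfl⟩
  -- constancy
  have hmult : ∀ l, ∀ x ∈ W, ∀ y ∈ W, (gpdq d (evalP P x.1) a b).rootMultiplicity (θ l x) = (gpdq d (evalP P y.1) a b).rootMultiplicity (θ l y) := by
    intro l x hx y hy
    obtain ⟨σ, h1, h2, h3, h4, h5⟩ := gpd_joined W x y (hWp.joinedIn x hx y hy)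
    have hc : Continuous fun t => θ l (σ t) := (hθc l).comp_continuous h1 (fun t => hWU (h3 t))
    have := ((path σ h1 h2 (fun t => hWW0 (h3 t)) v0 hv0K).2 (fun t => θ l (σ t)) hc (fun t => hroot l _ (hWU (h3 t))) 0 1).1
    simpa only [h4, h5] using this
  have hord : ∀ l, ∀ x ∈ W, ∀ y ∈ W, ordAt (gpdF d P) (y.1, fun i => θ l y * a i + b i) ≤ ordAt (gpdF d P) (x.1, fun i => θ l x * a i + b i) := by
    intro l x hx y hy
    obtain ⟨σ, h1, h2, h3, h4, h5⟩ := gpd_joined W x y (hWp.joinedIn x hx y hy)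
    have hc : Continuous fun t => θ l (σ t) := (hθc l).comp_continuous h1 (fun t => hWU (h3 t))
    apply gpd_enat
    intro n hn
    rw [gpd_ordF] at hn ⊢
    obtain ⟨j, hj, ⟨v1, Λ⟩, hw⟩ := hn
    obtain ⟨v, hvK, hv⟩ := gpd_dense d P _ _ v1 Λ j hw v0 {v | pK v} hK
    have := ((path σ h1 h2 (fun t => hWW0 (h3 t)) v hvK).2 (fun t => θ l (σ t)) hc (fun t => hroot l _ (hWU (h3 t))) 0 1).2
    simp only [h4, h5] at this
    have hΛ : Λ = fun i => ((b 1 * Λ 0 - b 0 * Λ 1) / (a 0 * b 1 - a 1 * b 0)) * a i + ((a 0 * Λ 1 - a 1 * Λ 0) / (a 0 * b 1 - a 1 * b 0)) * b i := by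
      have hδ0 : a 0 * b 1 - a 1 * b 0 ≠ 0 := by intro h; apply hab; linarith
      ext i
      fin_cases i
      · simp only [Fin.zero_eta, Fin.isValue]; rw [div_mul_eq_mul_div, div_mul_eq_mul_div, ← add_div, eq_div_iff hδ0]; ring
      · simp only [Fin.mk_one, Fin.isValue]; rw [div_mul_eq_mul_div, div_mul_eq_mul_div, ← add_div, eq_div_iff hδ0]; ring
    obtain ⟨Λ', j', hj', h'⟩ := this n _ _ ⟨j, hj, by rw [← hΛ]; exact hv⟩
    exact ⟨j', hj', (v, Λ'), h'⟩
  have hne : ∀ t, (fun i => t * a i + b i) ≠ 0 := gpd_mk_ne a b hab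
  refine ⟨W, hWo, hx0W, κ, fun l x => Projectivization.mk ℝ (fun i => θ l x * a i + b i) (hne _), ?_, ?_, ?_, ?_⟩
  · intro l
    have hc : Continuous fun t : ℝ => (⟨fun i => t * a i + b i, hne t⟩ : {v : Fin 2 → ℝ // v ≠ 0}) := by
      refine Continuous.subtype_mk ?_ _
      fun_prop
    exact (gpd_mk_cont.comp hc).comp_continuousOn ((hθc l).mono hWU)
  · intro x hx l l' h
    apply hθi x (hWU hx)
    simp only at h ⊢
    rw [Projectivization.mk_eq_mk_iff'] at h
    obtain ⟨c, hc⟩ := h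
    have c0 := congrFun hc 0
    have c1 := congrFun hc 1
    simp only [Pi.smul_apply, smul_eq_mul] at c0 c1
    have k1 : (c - 1) * (b 0 * a 1 - b 1 * a 0) = 0 := by linear_combination a 1 * c0 - a 0 * c1
    have hc1 : c = 1 := by
      have := (mul_eq_zero.1 k1).resolve_right hab
      linarith
    subst hc1
    have k2 : (θ l x - θ l' x) * (b 0 * a 1 - b 1 * a 0) = 0 := by linear_combination (-b 0) * c1 + b 1 * c0
    have := (mul_eq_zero.1 k2).resolve_right hab
    linarith
  · intro x hx y
    constructor
    · rintro ⟨v, hv, hvy, h0⟩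
      obtain ⟨c, t, hc, hvt, ht⟩ := gpd_root_iff d (evalP P x.1) a b hab (hW0O (hWW0 hx)).2 v hv h0
      obtain ⟨l, hl⟩ := (hθr x (hWU hx) t).1 ht
      refine ⟨l, ?_⟩
      rw [← hvy, Projectivization.mk_eq_mk_iff']
      refine ⟨c⁻¹, ?_⟩
      rw [hvt, hl]
      ext i
      simp only [Pi.smul_apply, smul_eq_mul]
      field_simp
    · rintro ⟨l, hl⟩
      refine ⟨_, hne _, hl, ?_⟩
      have := hroot l x (hWU hx)
      rw [IsRoot, gpdq_eval] at this
      simpa only [mul_comm] using this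
  · intro l
    refine ⟨((gpdq d (evalP P x0.1) a b).rootMultiplicity (θ l x0), ordAt (gpdF d P) (x0.1, fun i => θ l x0 * a i + b i)), ?_, ?_⟩
    · simp only
      rw [rootMultiplicity_pos (fun h0 => hcoeff x0 hx0W0 (by rw [h0]; simp))]
      exact hroot l x0 hxU
    · intro x hx v hv hxv
      simp only at hxv ⊢
      rw [eq_comm, Projectivization.mk_eq_mk_iff'] at hxv
      obtain ⟨c, hc⟩ := hxv
      have hc0 : c ≠ 0 := by
        rintro rfl
        apply hv; rw [← hc]; simp
      refine ⟨?_, ?_⟩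
      · rw [hmult l x0 hx0W x hx]
        have := gpd_hasMult d (evalP P x.1) a b hab (hW0O (hWW0 hx)).2 (θ l x) c hc0
        rw [← hc]
        exact this
      · rw [← hc, gpd_ordF_smul _ _ _ _ _ hc0]
        exact le_antisymm (hord l x0 hx0W x hx) (hord l x hx x0 hx0W)

theorem gpd_good_unique {m : ℕ} (d : ℕ) (P : Polynomial (MvPolynomial (Fin m) ℝ)) (x : Fin m → ℝ) (y : RP1) (μ ν : ℕ × ℕ∞)
    (h1 : gpdGood d P x y μ) (h2 : gpdGood d P x y ν) : μ = ν := by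
  induction y using Projectivization.ind with
  | h v hv =>
  obtain ⟨a1, a2⟩ := h1 v hv rfl
  obtain ⟨b1, b2⟩ := h2 v hv rfl
  exact Prod.ext (gpd_mult_unique _ v hv _ _ a1 b1) (a2.symm.trans b2)

theorem gpd_main {m : ℕ} (d : ℕ) (P : Polynomial (MvPolynomial (Fin m) ℝ)) (hdeg : P.natDegree = d)
    (S : Set (Fin m → ℝ)) (hsub : IsAnalyticSubmanifold S) (hconn : IsConnected S)
    (hsc : SimplyConnectedSpace S)
    (hnn : ∀ x ∈ S, evalP P x ≠ 0)
    (hd0 : discFixed d P ≠ 0)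
    (hdinv : OrderInvariantOn (fun x => MvPolynomial.eval x (discFixed d P)) S) :
    ∃ (k : ℕ) (θ : Fin k → (Fin m → ℝ) → RP1), IsProjRootFunctions d P S θ ∧
      ∀ l : Fin k, ∀ x ∈ S, ∀ y ∈ S, ∀ (v w : Fin 2 → ℝ) (hv : v ≠ 0) (hw : w ≠ 0),
        θ l x = Projectivization.mk ℝ v hv → θ l y = Projectivization.mk ℝ w hw →
        ordAt (gpdF d P) (x, v) = ordAt (gpdF d P) (y, w) := by
  classical
  have := gpd_lpc S hsub
  have := gpd_t2
  have : ConnectedSpace S := isConnected_iff_connectedSpace.1 hconn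
  obtain ⟨xs, hxs⟩ := hconn.nonempty
  have loc := gpd_local d P hdeg S hnn hd0 hdinv
  obtain ⟨k, θ, hc, hi, hr⟩ := gpd_glue (X := S) (Y := RP1) (fun x y => gpdR d P x.1 y) (by
    intro x0
    obtain ⟨W, hW, hx, κ, Θ, h1, h2, h3, -⟩ := loc x0
    exact ⟨W, hW, hx, κ, Θ, h1, h2, h3⟩) ⟨xs, hxs⟩
  have hgood : ∀ l, ∀ x0 : S, ∃ μ : ℕ × ℕ∞, 0 < μ.1 ∧ ∀ᶠ x in nhds x0, gpdGood d P x.1 (θ l x) μ := by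
    intro l x0
    obtain ⟨W, hW, hx, κ, Θ, h1, h2, h3, h4⟩ := loc x0
    obtain ⟨l0, hl0⟩ := (h3 x0 hx _).1 ((hr x0 _).2 ⟨l, rfl⟩)
    obtain ⟨μ, hμ, hg⟩ := h4 l0
    refine ⟨μ, hμ, ?_⟩
    have hne : ∀ᶠ x in nhds x0, ∀ l', l' ≠ l0 → Θ l' x ≠ θ l x := by
      rw [Filter.eventually_all]
      intro l'
      by_cases hl' : l' = l0
      · filter_upwards with x h; exact absurd hl' h
      · have hca : ContinuousAt (Θ l') x0 := (h1 l').continuousAt (hW.mem_nhds hx)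
        have : Θ l' x0 ≠ θ l x0 := by
          rw [← hl0]; exact fun h => hl' (h2 x0 hx h)
        have ht := Filter.Tendsto.prodMk_nhds hca (hc l).continuousAt
        filter_upwards [ht (isOpen_ne_fun continuous_fst continuous_snd |>.mem_nhds this)] with x hx _ using hx
    filter_upwards [hne, hW.mem_nhds hx] with x hx1 hx2
    obtain ⟨l1, hl1⟩ := (h3 x hx2 _).1 ((hr x _).2 ⟨l, rfl⟩)
    have : l1 = l0 := by
      by_contra h
      exact hx1 l1 h hl1
    rw [← hl1, this]
    exact hg x hx2
  have hglob : ∀ l, ∃ μ : ℕ × ℕ∞, 0 < μ.1 ∧ ∀ x : S, gpdGood d P x.1 (θ l x) μ := by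
    intro l
    choose p hp0 hp using hgood l
    have hpx : ∀ x, gpdGood d P x.1 (θ l x) (p x) := fun x => (hp x).self_of_nhds
    have hlc : IsLocallyConstant p := by
      rw [IsLocallyConstant.iff_eventually_eq]
      intro x
      filter_upwards [hp x] with y hy
      exact gpd_good_unique d P _ _ _ _ (hpx y) hy
    refine ⟨p ⟨xs, hxs⟩, hp0 _, fun x => ?_⟩
    rw [hlc.apply_eq_of_preconnectedSpace ⟨xs, hxs⟩ x]
    exact hpx x
  have y0 : RP1 := Projectivization.mk ℝ (fun _ => 1) (fun h => one_ne_zero (congrFun h 0))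
  have hval : ∀ l (x : Fin m → ℝ) (hx : x ∈ S), (if h : x ∈ S then θ l ⟨x, h⟩ else y0) = θ l ⟨x, hx⟩ := by
    intro l x hx; simp [hx]
  refine ⟨k, fun l x => if h : x ∈ S then θ l ⟨x, h⟩ else y0, ⟨?_, ?_, ?_, ?_⟩, ?_⟩
  · intro l
    rw [continuousOn_iff_continuous_domRestrict]
    convert hc l using 1
    ext x
    exact hval l x.1 x.2
  · intro x hx l l' hll
    simp only [hval _ x hx]
    exact fun h => hll (hi ⟨x, hx⟩ h)
  · intro x hx v hv
    simp only [hval _ x hx]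
    rw [← hr ⟨x, hx⟩, gpd_homog_eval]
    constructor
    · intro h; exact ⟨v, hv, rfl, h⟩
    · rintro ⟨w, hw, hwv, h⟩
      rw [Projectivization.mk_eq_mk_iff'] at hwv
      obtain ⟨c, rfl⟩ := hwv
      have hc0 : c ≠ 0 := by rintro rfl; simp at hw
      simp only [Pi.smul_apply, smul_eq_mul] at h
      rw [gpdH_smul] at h
      exact (mul_eq_zero.1 h).resolve_left (pow_ne_zero _ hc0)
  · intro l
    obtain ⟨μ, hμ, hg⟩ := hglob l
    refine ⟨μ.1, hμ, fun x hx v hv h => ?_⟩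
    simp only [hval _ x hx] at h
    exact (hg ⟨x, hx⟩ v hv h).1
  · intro l x hx y hy v w hv hw h1 h2
    obtain ⟨μ, hμ, hg⟩ := hglob l
    simp only [hval _ x hx] at h1
    simp only [hval _ y hy] at h2
    exact (hg ⟨x, hx⟩ v hv h1).2.trans (hg ⟨y, hy⟩ w hw h2).2.symm

end

/-- **global theorem.** Let `S` be a connected and simply connected analytic
submanifold of `ℝ^m` and `P` of degree `d_n` in `x_n`, never nullifying on `S`, such that
`Disc^{d_n}_{x_n}(P)` is not the zero polynomial and is order-invariant on `S`. Then `P` is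
projectively delineable on `S` and `H^{d_n}(P)` is order-invariant on each projective
`P`-section over `S`. -/
theorem global_projective_delineability (m dn : ℕ)
    (P : Polynomial (MvPolynomial (Fin m) ℝ)) (hdeg : P.natDegree = dn)
    (S : Set (Fin m → ℝ)) (hsub : IsAnalyticSubmanifold S) (hconn : IsConnected S)
    (hsc : SimplyConnectedSpace S)
    (hnn : ∀ x ∈ S, evalP P x ≠ 0)
    (hd0 : discFixed dn P ≠ 0)
    (hdinv : OrderInvariantOn (fun x => MvPolynomial.eval x (discFixed dn P)) S) :
    ∃ (k : ℕ) (θ : Fin k → (Fin m → ℝ) → RP1), IsProjRootFunctions dn P S θ ∧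
      ∀ l : Fin k, ∀ x ∈ S, ∀ y ∈ S, ∀ (v w : Fin 2 → ℝ) (hv : v ≠ 0) (hw : w ≠ 0),
        θ l x = Projectivization.mk ℝ v hv → θ l y = Projectivization.mk ℝ w hw →
        ordAt (fun p : (Fin m → ℝ) × (Fin 2 → ℝ) =>
            MvPolynomial.eval p.2 (homog dn (evalP P p.1))) (x, v)
          = ordAt (fun p : (Fin m → ℝ) × (Fin 2 → ℝ) =>
              MvPolynomial.eval p.2 (homog dn (evalP P p.1))) (y, w) := by
  exact gpd_main dn P hdeg S hsub hconn hsc hnn hd0 hdinv
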